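/- Let f : G → G be a graph map with zero topological entropy. If ⟨x,y⟩ with x ≠ y is an IN-pair, then the pair ⟨x,y⟩ is asymptotic (i.e., lim_{n→∞} d(f^n x, f^n y) = 0) and ω_f(x) is a solenoid. -/

import Mathlib

open Set Filter Topology

/-- An arc in `X` with endpoints `a` and `b`: the image of a continuous injection
of `[0,1]` sending `0` to `a` and `1` to `b`. -/
def IsArcWithEnds {X : Type*} [TopologicalSpace X] (A : Set X) (a b : X) : Prop :=
  ∃ φ : Set.Icc (0:ℝ) 1 → X, Continuous φ ∧ Function.Injective φ ∧
    Set.range φ = A ∧ φ ⟨0, by norm_num⟩ = a ∧ φ ⟨1, by norm_num⟩ = b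

/-- A topological graph: a compact connected (metrizable) space which is a union of
finitely many arcs, any two of which are either disjoint or intersect in exactly one
common endpoint. -/
def IsTopGraph (X : Type*) [TopologicalSpace X] : Prop :=
  CompactSpace X ∧ ConnectedSpace X ∧
  ∃ (n : ℕ) (A : Fin n → Set X) (a b : Fin n → X),
    (∀ i, IsArcWithEnds (A i) (a i) (b i)) ∧
    (⋃ i, A i) = Set.univ ∧
    ∀ i j, i ≠ j →
      A i ∩ A j = ∅ ∨
      ∃ p, A i ∩ A j = {p} ∧ p ∈ ({a i, b i} : Set X) ∧ p ∈ ({a j, b j} : Set X)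

/-- A subgraph of `G`: a closed connected subset which is itself a topological graph. -/
def IsSubgraph {G : Type*} [TopologicalSpace G] (K : Set G) : Prop :=
  IsClosed K ∧ IsConnected K ∧ IsTopGraph ↥K

/-- A periodic subgraph with period `k`: `K, f(K), …, f^{k−1}(K)` are pairwise disjoint
and `f^k(K) = K`. -/
def IsPeriodicSubgraph {G : Type*} [TopologicalSpace G] (f : G → G) (K : Set G) (k : ℕ) :
    Prop :=
  IsSubgraph K ∧ 0 < k ∧ f^[k] '' K = K ∧
    ∀ i j, i < k → j < k → i ≠ j → Disjoint (f^[i] '' K) (f^[j] '' K)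

/-- A cycle of graphs with period `k`: the orbit `⋃_{i<k} f^i(K)` of a periodic
subgraph `K` with period `k`. -/
def IsCycleOfGraphs {G : Type*} [TopologicalSpace G] (f : G → G) (X : Set G) (k : ℕ) :
    Prop :=
  ∃ K, IsPeriodicSubgraph f K k ∧ X = ⋃ i ∈ Finset.range k, f^[i] '' K

/-- The ω-limit set of `x` under `f`. -/
def omegaSet {G : Type*} [TopologicalSpace G] (f : G → G) (x : G) : Set G :=
  ⋂ n : ℕ, closure ((fun m => f^[m] x) '' Set.Ici n)

/-- `ω(f) = ⋃_{x} ω_f(x)`. -/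
def omegaUnion {G : Type*} [TopologicalSpace G] (f : G → G) : Set G :=
  ⋃ x, omegaSet f x

/-- A set `W` is a solenoid for `f` if it is infinite and is contained in cycles of
graphs of arbitrarily large periods. -/
def IsSolenoid {G : Type*} [TopologicalSpace G] (f : G → G) (W : Set G) : Prop :=
  W.Infinite ∧ ∀ n : ℕ, ∃ X k, n ≤ k ∧ IsCycleOfGraphs f X k ∧ W ⊆ X

/-- Two points are separable if they belong to two disjoint periodic subgraphs. -/
def SeparablePoints {G : Type*} [TopologicalSpace G] (f : G → G) (x y : G) : Prop :=
  ∃ I J kI kJ, IsPeriodicSubgraph f I kI ∧ IsPeriodicSubgraph f J kJ ∧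
    Disjoint I J ∧ x ∈ I ∧ y ∈ J

/-- An NS-pair: a pair of distinct points of `ω(f)` contained in a nested sequence of
periodic subgraphs whose periods tend to infinity. -/
def IsNSPair {G : Type*} [TopologicalSpace G] (f : G → G) (x y : G) : Prop :=
  x ≠ y ∧ x ∈ omegaUnion f ∧ y ∈ omegaUnion f ∧
  ∃ (J : ℕ → Set G) (m : ℕ → ℕ),
    (∀ n, IsPeriodicSubgraph f (J n) (m n)) ∧
    (∀ n, J (n + 1) ⊆ J n) ∧
    Filter.Tendsto m Filter.atTop Filter.atTop ∧
    ∀ n, x ∈ J n ∧ y ∈ J n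

/-- The pair `⟨x,y⟩` is proximal. -/
def Proximal {G : Type*} [PseudoMetricSpace G] (f : G → G) (x y : G) : Prop :=
  ∀ ε > (0 : ℝ), ∀ N : ℕ, ∃ n ≥ N, dist (f^[n] x) (f^[n] y) < ε

/-- The pair `⟨x,y⟩` is asymptotic. -/
def Asymptotic {G : Type*} [PseudoMetricSpace G] (f : G → G) (x y : G) : Prop :=
  Filter.Tendsto (fun n => dist (f^[n] x) (f^[n] y)) Filter.atTop (nhds 0)

/-- A scrambled pair is proximal but not asymptotic. -/
def ScrambledPair {G : Type*} [PseudoMetricSpace G] (f : G → G) (x y : G) : Prop :=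
  Proximal f x y ∧ ¬ Asymptotic f x y

/-- Li–Yorke chaos: existence of an uncountable scrambled set. -/
def LiYorkeChaotic {G : Type*} [PseudoMetricSpace G] (f : G → G) : Prop :=
  ∃ S : Set G, ¬ S.Countable ∧ ∀ x ∈ S, ∀ y ∈ S, x ≠ y → ScrambledPair f x y

/-- `I ⊆ ℕ` is an independence set for the pair of sets `{A, B}`. -/
def IsIndepSet {G : Type*} (f : G → G) (A B : Set G) (I : Set ℕ) : Prop :=
  ∀ J : Finset ℕ, ↑J ⊆ I → J.Nonempty → ∀ S : ℕ → Bool,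
    (⋂ i ∈ J, f^[i] ⁻¹' (if S i then A else B)).Nonempty

/-- An IN-pair: every pair of neighborhoods has arbitrarily large finite
independence sets. -/
def IsINPair {G : Type*} [TopologicalSpace G] (f : G → G) (x y : G) : Prop :=
  ∀ U V : Set G, U ∈ nhds x → V ∈ nhds y →
    ∀ n : ℕ, ∃ I : Finset ℕ, n ≤ I.card ∧ IsIndepSet f U V ↑I

/-- An IT-pair: every pair of neighborhoods has an infinite independence set. -/
def IsITPair {G : Type*} [TopologicalSpace G] (f : G → G) (x y : G) : Prop :=
  ∀ U V : Set G, U ∈ nhds x → V ∈ nhds y →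
    ∃ I : Set ℕ, I.Infinite ∧ IsIndepSet f U V I

/-- The set of periodic points of `f`. -/
def PerPts {G : Type*} (f : G → G) : Set G :=
  {p | ∃ n ≥ 1, f^[n] p = p}

/-- A horseshoe: two disjoint nonempty compact sets, each of which is eventually mapped
over both. -/
def HasHorseshoe {G : Type*} [TopologicalSpace G] (f : G → G) : Prop :=
  ∃ (A B : Set G) (a b : ℕ), IsCompact A ∧ IsCompact B ∧ Disjoint A B ∧ A.Nonempty ∧
    1 ≤ a ∧ 1 ≤ b ∧ A ∪ B ⊆ f^[a] '' A ∧ A ∪ B ⊆ f^[b] '' B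

theorem subset_image_iterate_mul {G : Type*} {f : G → G} {A C : Set G} {a : ℕ}
    (hA : A ∪ C ⊆ f^[a] '' A) {b : ℕ} (hb : 1 ≤ b) : A ∪ C ⊆ f^[a * b] '' A := by
  induction b, hb using Nat.le_induction with
  | base => simpa using hA
  | succ k _ ih =>
    rw [Nat.mul_succ, Function.iterate_add, image_comp]
    exact ih.trans (image_mono (subset_union_left.trans hA))

theorem exists_itinerary {G : Type*} {g : G → G} {A B : Set G} (hne : A.Nonempty)
    (hA : A ∪ B ⊆ g '' A) (hB : A ∪ B ⊆ g '' B) (n : ℕ) :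
    ∀ w : ℕ → Bool, ∃ z ∈ A ∪ B, ∀ i < n, g^[i] z ∈ (if w i then A else B) := by
  induction n with
  | zero => intro w; obtain ⟨z, hz⟩ := hne; exact ⟨z, Or.inl hz, by simp⟩
  | succ n ih =>
    intro w
    obtain ⟨z, hz, hw⟩ := ih (fun i => w (i + 1))
    have : ∃ y ∈ (if w 0 then A else B), g y = z := by
      split_ifs
      · exact hA hz
      · exact hB hz
    obtain ⟨y, hy, rfl⟩ := this
    refine ⟨y, ?_, ?_⟩
    · split_ifs at hy
      · exact Or.inl hy
      · exact Or.inr hy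
    · rintro (_ | i) hi
      · simpa using hy
      · simpa using hw i (by omega)

theorem HasHorseshoe.coverEntropy_pos {G : Type*} [MetricSpace G] {f : G → G}
    (h : HasHorseshoe f) : 0 < Dynamics.coverEntropy f Set.univ := by
  obtain ⟨A, B, a, b, hAc, hBc, hd, hne, ha, hb, hA, hB⟩ := h
  set T := a * b with hT
  have hTpos : 0 < T := Nat.mul_pos ha hb
  have hA' : A ∪ B ⊆ f^[T] '' A := subset_image_iterate_mul hA hb
  have hB' : A ∪ B ⊆ f^[T] '' B := by
    rw [hT, mul_comm, union_comm]; exact subset_image_iterate_mul (by rwa [union_comm]) ha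
  obtain ⟨r, hr, hsep⟩ := hd.exists_thickenings hAc hBc.isClosed
  set U : SetRel G G := {p | dist p.1 p.2 < r} with hU
  have hUu : U ∈ uniformity G := Metric.dist_mem_uniformity hr
  have key : ∀ n : ℕ, (2 : ℕ∞) ^ n ≤ Dynamics.netMaxcard f univ U (n * T) := by
    intro n
    choose z _ hz using exists_itinerary hne hA' hB' n
    classical
    let e : (Fin n → Bool) → G := fun w => z (fun i => if h : i < n then w ⟨i, h⟩ else true)
    have hdiff : ∀ w w' : Fin n → Bool, w ≠ w' →
        Disjoint (UniformSpace.ball (e w) (Dynamics.dynEntourage f U (n * T)))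
          (UniformSpace.ball (e w') (Dynamics.dynEntourage f U (n * T))) := by
      intro w w' hw
      rw [Set.disjoint_left]
      intro u hu hu'
      rw [Dynamics.mem_ball_dynEntourage] at hu hu'
      obtain ⟨i, hi⟩ := Function.ne_iff.1 hw
      have hlt : T * i < n * T := by
        rw [mul_comm]; exact Nat.mul_lt_mul_of_pos_right i.2 hTpos
      have h1 := hu _ hlt
      have h2 := hu' _ hlt
      have h3 := hz (fun i => if h : i < n then w ⟨i, h⟩ else true) i i.2
      have h4 := hz (fun i => if h : i < n then w' ⟨i, h⟩ else true) i i.2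
      rw [← Function.iterate_mul] at h3 h4
      simp only [i.2, dite_true, Fin.eta] at h3 h4
      simp only [UniformSpace.ball, hU, mem_preimage, mem_ofPred_eq] at h1 h2
      have hmem : ∀ {C : Set G} {p}, p ∈ C → dist p (f^[T * i] u) < r →
          f^[T * i] u ∈ Metric.thickening r C := fun hp hd =>
        Metric.mem_thickening_iff.2 ⟨_, hp, by rwa [dist_comm]⟩
      cases hwi : w i <;> cases hwi' : w' i <;> simp [hwi, hwi'] at h3 h4 hi
      · exact Set.disjoint_left.1 hsep (hmem h4 h2) (hmem h3 h1)
      · exact Set.disjoint_left.1 hsep (hmem h3 h1) (hmem h4 h2)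
    have hself : ∀ w, e w ∈ UniformSpace.ball (e w) (Dynamics.dynEntourage f U (n * T)) := by
      intro w
      rw [Dynamics.mem_ball_dynEntourage]
      intro k _
      simp [UniformSpace.ball, hU, hr]
    have hinj : Function.Injective e := by
      intro w w' hww
      by_contra hne
      refine Set.disjoint_left.1 (hdiff w w' hne) (hself w) ?_
      rw [hww]; exact hself w'
    have hnet : Dynamics.IsDynNetIn f univ U (n * T) ((Finset.univ.image e : Finset G) : Set G) := by
      refine ⟨subset_univ _, ?_⟩
      intro p hp q hq hpq
      simp only [Finset.coe_image, Finset.coe_univ, image_univ, mem_range] at hp hq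
      obtain ⟨w, rfl⟩ := hp
      obtain ⟨w', rfl⟩ := hq
      exact hdiff w w' (fun h => hpq (by rw [h]))
    have := hnet.card_le_netMaxcard
    rw [Finset.card_image_of_injective _ hinj] at this
    simpa using this
  have hlt : (0 : EReal) < ((Real.log 2 / T : ℝ) : EReal) := by
    have : 0 < Real.log 2 / T := div_pos (Real.log_pos (by norm_num)) (by exact_mod_cast hTpos)
    exact_mod_cast this
  refine hlt.trans_le (le_trans ?_ (Dynamics.netEntropyEntourage_le_coverEntropy _ _ hUu))
  apply Frequently.le_expGrowthSup
  rw [Filter.frequently_atTop]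
  intro N
  refine ⟨N * T, Nat.le_mul_of_pos_right _ hTpos, ?_⟩
  have h1 : (((Real.log 2 / T : ℝ) : EReal) * ((N * T : ℕ) : EReal)) = ((N * Real.log 2 : ℝ) : EReal) := by
    have : ((N * T : ℕ) : EReal) = (((N * T : ℕ) : ℝ) : EReal) := by simp
    rw [this, ← EReal.coe_mul]
    congr 1
    have : (T : ℝ) ≠ 0 := by exact_mod_cast hTpos.ne'
    push_cast
    field_simp
  rw [h1, EReal.exp_coe, mul_comm, Real.exp_mul, Real.exp_log (by norm_num)]
  have h2 : ENNReal.ofReal ((2:ℝ) ^ (N:ℝ)) = (((2 : ℕ∞) ^ N : ℕ∞) : ENNReal) := by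
    rw [Real.rpow_natCast, ENNReal.ofReal_pow (by norm_num)]
    simp
  rw [h2]
  exact_mod_cast key N

theorem hasHorseshoe_of_images {G : Type*} [TopologicalSpace G] [T2Space G] {f : G → G}
    (hf : Continuous f) {B J₁ J₂ : Set G} {n s₁ s₂ : ℕ} (hB : IsCompact B) (hne : B.Nonempty)
    (hJ₁ : IsCompact J₁) (hJ₂ : IsCompact J₂) (hd : Disjoint J₁ J₂) (hn : 1 ≤ n)
    (h₁ : J₁ ⊆ f^[n] '' B) (h₂ : J₂ ⊆ f^[n] '' B) (h₁' : B ⊆ f^[s₁] '' J₁)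
    (h₂' : B ⊆ f^[s₂] '' J₂) : HasHorseshoe f := by
  have himg : ∀ J s, J ⊆ f^[n] '' B → B ⊆ f^[s] '' J → B ⊆ f^[s + n] '' (B ∩ f^[n] ⁻¹' J) := by
    intro J s hJ hs z hz
    obtain ⟨u, hu, rfl⟩ := hs hz
    obtain ⟨v, hv, rfl⟩ := hJ hu
    exact ⟨v, ⟨hv, hu⟩, by rw [Function.iterate_add_apply]⟩
  have hc : ∀ J, IsCompact J → IsCompact (B ∩ f^[n] ⁻¹' J) := fun J hJ =>
    hB.inter_right (hJ.isClosed.preimage (hf.iterate n))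
  refine ⟨B ∩ f^[n] ⁻¹' J₁, B ∩ f^[n] ⁻¹' J₂, s₁ + n, s₂ + n, hc _ hJ₁, hc _ hJ₂, ?_, ?_,
    by omega, by omega, ?_, ?_⟩
  · exact (hd.preimage _).mono inter_subset_right inter_subset_right
  · obtain ⟨z, hz⟩ := hne
    obtain ⟨u, hu, -⟩ := himg _ _ h₁ h₁' hz
    exact ⟨u, hu⟩
  · exact (union_subset inter_subset_left inter_subset_left).trans (himg _ _ h₁ h₁')
  · exact (union_subset inter_subset_left inter_subset_left).trans (himg _ _ h₂ h₂')

theorem HasHorseshoe.of_iterate {G : Type*} [TopologicalSpace G] {f : G → G} {q : ℕ} (hq : 1 ≤ q)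
    (h : HasHorseshoe f^[q]) : HasHorseshoe f := by
  obtain ⟨A, B, a, b, hAc, hBc, hd, hne, ha, hb, hA, hB⟩ := h
  rw [← Function.iterate_mul] at hA hB
  exact ⟨A, B, q * a, q * b, hAc, hBc, hd, hne, Nat.mul_pos hq ha, Nat.mul_pos hq hb, hA, hB⟩

/-- A parametrized edge of a graph: an arc over `[0,1]` all of whose open subarcs are open. -/
structure IsEdge {G : Type*} [TopologicalSpace G] (φ : ℝ → G) : Prop where
  continuous : Continuous φ
  injOn : InjOn φ (Icc 0 1)
  isOpen_image : ∀ a b, 0 ≤ a → b ≤ 1 → IsOpen (φ '' Ioo a b)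

namespace IsEdge

variable {G : Type*} [TopologicalSpace G] {φ : ℝ → G}

theorem eq_of_eq (h : IsEdge φ) {s t : ℝ} (hs : s ∈ Icc (0:ℝ) 1) (ht : t ∈ Icc (0:ℝ) 1)
    (hst : φ s = φ t) : s = t := h.injOn hs ht hst

theorem image_Ioo_mem_nhds (h : IsEdge φ) {a b t : ℝ} (ha : 0 ≤ a) (hb : b ≤ 1)
    (ht : t ∈ Ioo a b) : φ '' Ioo a b ∈ 𝓝 (φ t) :=
  (h.isOpen_image a b ha hb).mem_nhds (mem_image_of_mem _ ht)

theorem subset_image_Ioo_of_notMem [T2Space G] (h : IsEdge φ) {S : Set G} (hS : IsPreconnected S)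
    {a b : ℝ} (ha : 0 ≤ a) (hb : b ≤ 1) (hne : (S ∩ φ '' Ioo a b).Nonempty) (haS : φ a ∉ S)
    (hbS : φ b ∉ S) : S ⊆ φ '' Ioo a b := by
  have hcl : IsClosed (φ '' Icc a b) := (isCompact_Icc.image h.continuous).isClosed
  refine hS.subset_left_of_subset_union (h.isOpen_image a b ha hb) hcl.isOpen_compl ?_ ?_ hne
  · exact (disjoint_compl_right_iff_subset.2 (image_mono Ioo_subset_Icc_self))
  · intro z hz
    by_cases hzc : z ∈ φ '' Icc a b
    · left
      obtain ⟨t, ht, rfl⟩ := hzc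
      refine ⟨t, ⟨lt_of_le_of_ne ht.1 ?_, lt_of_le_of_ne ht.2 ?_⟩, rfl⟩
      · rintro rfl; exact haS hz
      · rintro rfl; exact hbS hz
    · exact Or.inr hzc

theorem image_Ioc_subset_or_image_Ico_subset [T2Space G] (h : IsEdge φ) {S : Set G}
    (hS : IsPreconnected S) {α β s₁ s₂ : ℝ} (hα : 0 ≤ α) (hβ : β ≤ 1)
    (hne : (S ∩ φ '' Icc s₁ s₂).Nonempty) (hnot : ¬ S ⊆ φ '' Ioo α β) :
    φ '' Ioc α s₁ ⊆ S ∨ φ '' Ico s₂ β ⊆ S := by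
  by_contra! hcon
  obtain ⟨h1, h2⟩ := hcon
  rw [not_subset] at h1 h2
  obtain ⟨_, ⟨u, hu, rfl⟩, huS⟩ := h1
  obtain ⟨_, ⟨v, hv, rfl⟩, hvS⟩ := h2
  obtain ⟨_, hz, ⟨t, ht, rfl⟩⟩ := hne
  refine hnot ((h.subset_image_Ioo_of_notMem hS (a := u) (b := v) (hα.trans hu.1.le)
    (hv.2.le.trans hβ) ⟨φ t, hz, t, ⟨lt_of_le_of_ne (hu.2.trans ht.1) ?_,
      lt_of_le_of_ne (ht.2.trans hv.1) ?_⟩, rfl⟩ huS hvS).trans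
    (image_mono (Ioo_subset_Ioo hu.1.le hv.2.le)))
  · rintro rfl; exact huS hz
  · rintro rfl; exact hvS hz

theorem reverse (h : IsEdge φ) : IsEdge fun t => φ (1 - t) where
  continuous := h.continuous.comp (by fun_prop)
  injOn := by
    intro s hs t ht hst
    have := h.injOn (show 1 - s ∈ Icc (0:ℝ) 1 from ⟨by linarith [hs.2], by linarith [hs.1]⟩)
      (show 1 - t ∈ Icc (0:ℝ) 1 from ⟨by linarith [ht.2], by linarith [ht.1]⟩) hst
    linarith
  isOpen_image := by
    intro a b ha hb
    have : (fun t => φ (1 - t)) '' Ioo a b = φ '' Ioo (1 - b) (1 - a) := by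
      rw [← image_const_sub_Ioo, image_image]
    rw [this]
    exact h.isOpen_image _ _ (by linarith) (by linarith)

end IsEdge

/-- The arcs of a topological graph, parametrized by `[0,1]`. -/
structure ArcSys (G : Type*) [TopologicalSpace G] (n : ℕ) where
  φ : Fin n → ℝ → G
  continuous : ∀ i, Continuous (φ i)
  injOn : ∀ i, InjOn (φ i) (Icc 0 1)
  cover : ∀ z, ∃ i, ∃ t ∈ Icc (0:ℝ) 1, φ i t = z
  endpoint : ∀ i j, i ≠ j → ∀ s ∈ Icc (0:ℝ) 1, ∀ t ∈ Icc (0:ℝ) 1, φ i s = φ j t → s = 0 ∨ s = 1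
  unique : ∀ i j, i ≠ j → ∀ s ∈ Icc (0:ℝ) 1, ∀ t ∈ Icc (0:ℝ) 1, ∀ s' ∈ Icc (0:ℝ) 1,
    ∀ t' ∈ Icc (0:ℝ) 1, φ i s = φ j t → φ i s' = φ j t' → φ i s = φ i s'

theorem IsTopGraph.exists_arcSys {G : Type*} [TopologicalSpace G] (hG : IsTopGraph G) :
    ∃ n, Nonempty (ArcSys G n) := by
  obtain ⟨-, -, n, A, a, b, harc, hcov, hinter⟩ := hG
  choose ψ hψc hψi hψr hψa hψb using harc
  have hval : ∀ i, ∀ s (hs : s ∈ Icc (0:ℝ) 1),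
      ψ i (projIcc 0 1 zero_le_one s) = ψ i ⟨s, hs⟩ := fun i s hs => by
    rw [projIcc_of_mem _ hs]
  have hmem : ∀ i s, ψ i (projIcc 0 1 zero_le_one s) ∈ A i := fun i s => by
    rw [← hψr i]; exact mem_range_self _
  refine ⟨n, ⟨⟨fun i t => ψ i (projIcc 0 1 zero_le_one t), ?_, ?_, ?_, ?_, ?_⟩⟩⟩
  · exact fun i => (hψc i).comp continuous_projIcc
  · intro i s hs t ht hst
    simp only [hval i s hs, hval i t ht] at hst
    simpa using hψi i hst
  · intro z
    have : z ∈ ⋃ i, A i := by rw [hcov]; trivial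
    obtain ⟨i, hi⟩ := mem_iUnion.1 this
    rw [← hψr i] at hi
    obtain ⟨⟨t, ht⟩, rfl⟩ := hi
    exact ⟨i, t, ht, hval i t ht⟩
  · intro i j hij s hs t ht hst
    have hz : ψ i (projIcc 0 1 zero_le_one s) ∈ A i ∩ A j := ⟨hmem i s, by
      rw [show ψ i _ = _ from hst]; exact hmem j t⟩
    rcases hinter i j hij with h | ⟨p, h, hp, -⟩
    · rw [h] at hz; exact hz.elim
    · rw [h, mem_singleton_iff, hval i s hs] at hz
      rcases hp with hp | hp
      · left
        rw [hp, ← hψa i] at hz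
        exact congrArg Subtype.val (hψi i hz)
      · right
        rw [mem_singleton_iff.1 hp, ← hψb i] at hz
        exact congrArg Subtype.val (hψi i hz)
  · intro i j hij s hs t ht s' hs' t' ht' h1 h2
    have hz : ψ i (projIcc 0 1 zero_le_one s) ∈ A i ∩ A j := ⟨hmem i s, by
      rw [show ψ i _ = _ from h1]; exact hmem j t⟩
    have hz' : ψ i (projIcc 0 1 zero_le_one s') ∈ A i ∩ A j := ⟨hmem i s', by
      rw [show ψ i _ = _ from h2]; exact hmem j t'⟩
    rcases hinter i j hij with h | ⟨p, h, hp, -⟩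
    · rw [h] at hz; exact hz.elim
    · rw [h, mem_singleton_iff] at hz hz'
      exact hz.trans hz'.symm

theorem ArcSys.isEdge {G : Type*} [TopologicalSpace G] [T2Space G] {n : ℕ} (E : ArcSys G n)
    (i : Fin n) : IsEdge (E.φ i) where
  continuous := E.continuous i
  injOn := E.injOn i
  isOpen_image := by
    intro a b ha hb
    rcases le_or_gt b a with hab | hab
    · simp [Ioo_eq_empty (not_lt.2 hab)]
    have hcl : IsClosed ((⋃ j ∈ {j | j ≠ i}, E.φ j '' Icc 0 1) ∪
        (E.φ i '' Icc 0 a ∪ E.φ i '' Icc b 1)) := by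
      refine ((Set.toFinite _).isClosed_biUnion fun j _ => ?_).union (IsClosed.union ?_ ?_) <;>
        exact (isCompact_Icc.image (E.continuous _)).isClosed
    convert hcl.isOpen_compl using 1
    ext z
    constructor
    · rintro ⟨t, ht, rfl⟩
      have ht' : t ∈ Icc (0:ℝ) 1 := ⟨ha.trans ht.1.le, ht.2.le.trans hb⟩
      simp only [mem_compl_iff, mem_union, mem_iUnion, not_or, not_exists]
      refine ⟨?_, ?_, ?_⟩
      · rintro j hj ⟨s, hs, hst⟩
        rcases E.endpoint i j (Ne.symm hj) t ht' s hs hst.symm with h | h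
        · linarith [ht.1]
        · linarith [ht.2]
      · rintro ⟨s, hs, hst⟩
        have := E.injOn i ⟨hs.1, by linarith [hs.2]⟩ ht' hst
        linarith [hs.2, ht.1]
      · rintro ⟨s, hs, hst⟩
        have := E.injOn i ⟨by linarith [hs.1], hs.2⟩ ht' hst
        linarith [hs.1, ht.2]
    · intro hz
      simp only [mem_compl_iff, mem_union, mem_iUnion, not_or, not_exists] at hz
      obtain ⟨j, t, ht, rfl⟩ := E.cover z
      have hji : j = i := by
        by_contra hne
        exact hz.1 j hne ⟨t, ht, rfl⟩
      subst hji
      refine ⟨t, ⟨?_, ?_⟩, rfl⟩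
      · by_contra! hlt
        exact hz.2.1 ⟨t, ⟨ht.1, hlt⟩, rfl⟩
      · by_contra! hlt
        exact hz.2.2 ⟨t, ⟨hlt, ht.2⟩, rfl⟩

theorem ArcSys.locallyConnectedSpace {G : Type*} [TopologicalSpace G] [T2Space G] {n : ℕ}
    (E : ArcSys G n) : LocallyConnectedSpace G := by
  let F : Fin n × Icc (0:ℝ) 1 → G := fun p => E.φ p.1 p.2
  have hFc : Continuous F := by
    rw [continuous_prod_of_discrete_left]
    exact fun i => (E.continuous i).comp continuous_subtype_val
  have hFs : Function.Surjective F := fun z => by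
    obtain ⟨i, t, ht, rfl⟩ := E.cover z
    exact ⟨(i, ⟨t, ht⟩), rfl⟩
  have : LocallyPathConnectedSpace (Icc (0:ℝ) 1) := (convex_Icc 0 1).locallyPathConnectedSpace
  exact (hFc.isClosedMap.isQuotientMap hFc hFs).isCoinducing.locallyConnectedSpace

theorem exists_compact_connected_nhds {G : Type*} [TopologicalSpace G] [T2Space G] [CompactSpace G]
    [LocallyConnectedSpace G] {w : G} {O : Set G} (hO : O ∈ 𝓝 w) :
    ∃ V ∈ 𝓝 w, V ⊆ O ∧ IsCompact V ∧ IsConnected V := by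
  obtain ⟨C, hC, hCcl, hCO⟩ := exists_mem_nhds_isClosed_subset hO
  refine ⟨closure (connectedComponentIn C w),
    mem_of_superset (connectedComponentIn_mem_nhds hC) subset_closure,
    (closure_minimal (connectedComponentIn_subset _ _) hCcl).trans hCO,
    isClosed_closure.isCompact, ?_⟩
  exact (isConnected_connectedComponentIn_iff.2 (mem_of_mem_nhds hC)).closure

/-- A finite family of edges, closed under reversal of orientation, which covers the space. -/
structure EdgeSys (G : Type*) [TopologicalSpace G] (ι : Type) where
  φ : ι → ℝ → G
  isEdge : ∀ i, IsEdge (φ i)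
  cover : ∀ z, ∃ i, ∃ t ∈ Icc (0:ℝ) 1, φ i t = z
  rev : ∀ i, ∃ j, ∀ t, φ j t = φ i (1 - t)

/-- The edges of a graph with both orientations. -/
def ArcSys.toEdgeSys {G : Type*} [TopologicalSpace G] [T2Space G] {n : ℕ} (E : ArcSys G n) :
    EdgeSys G (Fin n × Bool) where
  φ p t := E.φ p.1 (if p.2 then t else 1 - t)
  isEdge := by
    rintro ⟨i, b⟩
    cases b
    · simpa using (E.isEdge i).reverse
    · simpa using E.isEdge i
  cover z := by
    obtain ⟨i, t, ht, h⟩ := E.cover z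
    exact ⟨(i, true), t, ht, by simpa using h⟩
  rev := by
    rintro ⟨i, b⟩
    refine ⟨(i, !b), fun t => ?_⟩
    cases b <;> simp

namespace EdgeSys

variable {G : Type*} [MetricSpace G] {ι : Type} [Finite ι]

theorem exists_finite_cut (E : EdgeSys G ι) {ε : ℝ} (hε : 0 < ε) :
    ∃ D : Set G, D.Finite ∧ ∀ S : Set G, IsPreconnected S → Disjoint S D →
      ∀ u ∈ S, ∀ v ∈ S, dist u v < ε := by
  have huc : ∀ i, ∃ δ > 0, ∀ s ∈ Icc (0:ℝ) 1, ∀ t ∈ Icc (0:ℝ) 1, dist s t < δ →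
      dist (E.φ i s) (E.φ i t) < ε := fun i => by
    have := isCompact_Icc.uniformContinuousOn_of_continuous
      (E.isEdge i).continuous.continuousOn (s := Icc (0:ℝ) 1)
    exact Metric.uniformContinuousOn_iff.1 this ε hε
  choose δ hδ hδ' using huc
  obtain ⟨m, hm⟩ : ∃ m : ℕ, ∀ i, 1 / ((m:ℝ) + 1) < δ i := by
    choose m hm using fun i => exists_nat_one_div_lt (hδ i)
    obtain ⟨M, hM⟩ := (Set.finite_range m).bddAbove
    refine ⟨M, fun i => lt_of_le_of_lt ?_ (hm i)⟩
    have : (m i : ℝ) ≤ M := by exact_mod_cast hM (mem_range_self i)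
    gcongr
  have hm0 : (0:ℝ) < m + 1 := by positivity
  refine ⟨⋃ i, (fun k : ℕ => E.φ i (k / (m + 1))) '' Iic (m + 1),
    finite_iUnion fun i => (finite_Iic _).image _, ?_⟩
  intro S hS hSD u hu v hv
  have hnot : ∀ i, ∀ k : ℕ, k ≤ m + 1 → E.φ i (k / (m + 1)) ∉ S := fun i k hk h =>
    Set.disjoint_left.1 hSD h (mem_iUnion.2 ⟨i, k, hk, rfl⟩)
  obtain ⟨i, t, ht, rfl⟩ := E.cover u
  have ht0 : 0 ≤ t * (m + 1) := mul_nonneg ht.1 hm0.le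
  set k := ⌊t * (m + 1)⌋₊ with hk
  have hk1 : (k:ℝ) ≤ t * (m + 1) := Nat.floor_le ht0
  have hk2 : t * (m + 1) < k + 1 := Nat.lt_floor_add_one _
  have hkm : k < m + 1 := by
    by_contra! hcon
    have h1 : ((m + 1 : ℕ) : ℝ) ≤ k := by exact_mod_cast hcon
    push_cast at h1
    have h2 : t = 1 := by
      refine le_antisymm ht.2 ?_
      by_contra! hlt
      nlinarith
    apply hnot i (m + 1) le_rfl
    push_cast
    rw [div_self hm0.ne', ← h2]; exact hu
  have hkt : (k:ℝ) / (m + 1) < t := by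
    refine lt_of_le_of_ne ((div_le_iff₀ hm0).2 hk1) ?_
    intro h
    exact hnot i k hkm.le (h ▸ hu)
  have htk : t < ((k + 1 : ℕ):ℝ) / (m + 1) := by
    rw [lt_div_iff₀ hm0]; push_cast; exact hk2
  have hk0 : (0:ℝ) ≤ k / (m + 1) := by positivity
  have hk1' : ((k + 1 : ℕ):ℝ) / (m + 1) ≤ 1 := by
    rw [div_le_one hm0]; exact_mod_cast hkm
  have hsub := (E.isEdge i).subset_image_Ioo_of_notMem hS hk0 hk1'
    ⟨_, hu, t, ⟨hkt, htk⟩, rfl⟩ (hnot i k hkm.le) (hnot i (k + 1) hkm)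
  obtain ⟨s, hs, rfl⟩ := hsub hv
  refine hδ' i t ht s ⟨by linarith [hs.1], by linarith [hs.2]⟩ (lt_trans ?_ (hm i))
  have : ((k + 1 : ℕ):ℝ) / (m + 1) = k / (m + 1) + 1 / (m + 1) := by push_cast; ring
  rw [this] at hs htk
  rw [Real.dist_eq, abs_lt]
  constructor <;> linarith [hs.1, hs.2]

theorem exists_arc (E : EdgeSys G ι) (N : ℕ) {P : Set G} (hP : P.Finite) :
    ∃ M : ℕ, ∀ Q : Finset G, M ≤ Q.card → ∃ (i : ι) (t : ℕ → ℝ),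
      (∀ j k, j < k → k < N → t j < t k) ∧ (∀ k < N, t k ∈ Ioo (0:ℝ) 1 ∧ E.φ i (t k) ∈ Q) ∧
      ∀ j < N, ∀ k < N, ∀ s ∈ Icc (t j) (t k), E.φ i s ∉ P := by
  classical
  have := Fintype.ofFinite ι
  let P' : Finset G := hP.toFinset ∪ Finset.univ.image (fun i => E.φ i 0) ∪
    Finset.univ.image (fun i => E.φ i 1)
  have hP'0 : ∀ i, E.φ i 0 ∈ P' := fun i => by simp [P']
  have hP'1 : ∀ i, E.φ i 1 ∈ P' := fun i => by simp [P']
  have hPP' : ∀ p ∈ P, p ∈ P' := fun p hp => by simp [P', hp]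
  choose e τ hτ heτ using E.cover
  let sig : G → ι × Finset G := fun z =>
    (e z, P'.filter fun p => ∃ s ∈ Icc (0:ℝ) 1, s < τ z ∧ E.φ (e z) s = p)
  let colors : Finset (ι × Finset G) := Finset.univ ×ˢ P'.powerset
  refine ⟨colors.card * N + 1 + P'.card, fun Q hQ => ?_⟩
  have hcard : colors.card * N < (Q \ P').card := by
    have := Finset.le_card_sdiff P' Q
    omega
  obtain ⟨⟨i, c⟩, -, hfib⟩ := Finset.exists_lt_card_fiber_of_mul_lt_card_of_maps_to
    (s := Q \ P') (t := colors) (f := sig) (n := N)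
    (fun z _ => by simp [colors, sig]) hcard
  set R := {z ∈ Q \ P' | sig z = (i, c)} with hR
  have hRmem : ∀ z ∈ R, z ∈ Q ∧ z ∉ P' ∧ sig z = (i, c) := fun z hz => by
    simpa [hR, and_assoc] using hz
  have hRe : ∀ z ∈ R, E.φ i (τ z) = z := fun z hz => by
    have : e z = i := congrArg Prod.fst (hRmem z hz).2.2
    rw [← this]; exact heτ z
  have hinj : Set.InjOn τ R := fun z hz z' hz' h => by
    rw [← hRe z hz, ← hRe z' hz', h]
  set T := R.image τ with hT
  have hTc : T.card = R.card := Finset.card_image_of_injOn hinj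
  let t : ℕ → ℝ := fun k => if h : k < T.card then T.orderEmbOfFin rfl ⟨k, h⟩ else 0
  have htT : ∀ k < N, t k ∈ T := fun k hk => by
    have : k < T.card := by omega
    simp only [t, this, dite_true]
    exact Finset.orderEmbOfFin_mem _ _ _
  have htz : ∀ k < N, ∃ z ∈ R, τ z = t k := fun k hk => by
    simpa [hT] using htT k hk
  have hIoo : ∀ z ∈ R, τ z ∈ Ioo (0:ℝ) 1 := fun z hz => by
    refine ⟨lt_of_le_of_ne (hτ z).1 ?_, lt_of_le_of_ne (hτ z).2 ?_⟩
    · intro h; apply (hRmem z hz).2.1; rw [← hRe z hz, ← h]; exact hP'0 i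
    · intro h; apply (hRmem z hz).2.1; rw [← hRe z hz, h]; exact hP'1 i
  refine ⟨i, t, ?_, ?_, ?_⟩
  · intro j k hjk hk
    have h1 : k < T.card := by omega
    have h2 : j < T.card := by omega
    simp only [t, h1, h2, dite_true]
    exact (T.orderEmbOfFin rfl).strictMono hjk
  · intro k hk
    obtain ⟨z, hz, hzt⟩ := htz k hk
    rw [← hzt]
    exact ⟨hIoo z hz, by rw [hRe z hz]; exact (hRmem z hz).1⟩
  · intro j hj k hk s hs hsP
    obtain ⟨z, hz, hzt⟩ := htz j hj
    obtain ⟨z', hz', hzt'⟩ := htz k hk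
    rw [← hzt, ← hzt'] at hs
    have hs01 : s ∈ Icc (0:ℝ) 1 := ⟨(hτ z).1.trans hs.1, hs.2.trans (hτ z').2⟩
    have hne' : s ≠ τ z' := by
      intro h; rw [h, hRe z' hz'] at hsP; exact (hRmem z' hz').2.1 (hPP' _ hsP)
    have hez' : e z' = i := congrArg Prod.fst (hRmem z' hz').2.2
    have hez : e z = i := congrArg Prod.fst (hRmem z hz).2.2
    have hmem : E.φ i s ∈ (sig z').2 := by
      simp only [sig, Finset.mem_filter]
      exact ⟨hPP' _ hsP, s, hs01, lt_of_le_of_ne hs.2 hne', by rw [hez']⟩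
    rw [(hRmem z' hz').2.2, ← (hRmem z hz).2.2] at hmem
    simp only [sig, Finset.mem_filter] at hmem
    obtain ⟨-, s', hs', hlt, heq⟩ := hmem
    rw [hez] at heq
    have := (E.isEdge i).eq_of_eq hs' hs01 heq
    linarith [hs.1]

theorem finite_closure_diff (E : EdgeSys G ι) {C : Set G} (hC : IsPreconnected C) :
    (closure C \ C).Finite := by
  by_contra hinf
  obtain ⟨M, hM⟩ := E.exists_arc 4 (P := ∅) finite_empty
  obtain ⟨Q, hQ, hQc⟩ := Set.Infinite.exists_subset_card_eq hinf M
  obtain ⟨i, t, ht, hmem, -⟩ := hM Q hQc.ge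
  have hcl : ∀ k < 4, E.φ i (t k) ∈ closure C \ C := fun k hk => hQ (hmem k hk).2
  have h01 := ht 0 1 (by norm_num) (by norm_num)
  have h12 := ht 1 2 (by norm_num) (by norm_num)
  have h23 := ht 2 3 (by norm_num) (by norm_num)
  have hnh := (E.isEdge i).image_Ioo_mem_nhds (hmem 0 (by norm_num)).1.1.le
    (hmem 2 (by norm_num)).1.2.le ⟨h01, h12⟩
  have hne := mem_closure_iff_nhds.1 (hcl 1 (by norm_num)).1 _ hnh
  have hsub := (E.isEdge i).subset_image_Ioo_of_notMem hC (hmem 0 (by norm_num)).1.1.le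
    (hmem 2 (by norm_num)).1.2.le (by rwa [inter_comm]) (hcl 0 (by norm_num)).2
    (hcl 2 (by norm_num)).2
  have hsub' : closure C ⊆ E.φ i '' Icc (t 0) (t 2) :=
    closure_minimal (hsub.trans (image_mono Ioo_subset_Icc_self))
      (isCompact_Icc.image (E.isEdge i).continuous).isClosed
  obtain ⟨s, hs, hst⟩ := hsub' (hcl 3 (by norm_num)).1
  have h0 := (hmem 0 (by norm_num)).1
  have h2 := (hmem 2 (by norm_num)).1
  have h3 := (hmem 3 (by norm_num)).1
  have := (E.isEdge i).eq_of_eq ⟨h0.1.le.trans hs.1, hs.2.trans h2.2.le⟩ ⟨h3.1.le, h3.2.le⟩ hst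
  linarith [hs.2]

end EdgeSys

/-- Without horseshoes, returns of a small connected neighbourhood of `w` are confined to an arc
containing five points of the orbit of `w`. -/
theorem IsEdge.exists_nhds_image_subset {G : Type*} [TopologicalSpace G] [T2Space G] {φ : ℝ → G}
    (hφ : IsEdge φ) {f : G → G} (hf : Continuous f) (hH : ¬ HasHorseshoe f) {t : ℕ → ℝ}
    (ht : ∀ j k, j < k → k < 11 → t j < t k) (ht0 : 0 ≤ t 0) (ht1 : t 10 ≤ 1) {w : G} {k : ℕ → ℕ}
    (hk : ∀ j < 5, f^[k j] w = φ (t (2 * j + 1))) :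
    ∃ V₀ ∈ 𝓝 w, ∀ V ⊆ V₀, IsCompact V → IsConnected V → ∀ d, (∀ j < 5, k j < d + k 2) →
      (f^[d] '' V ∩ V).Nonempty → f^[d + k 2] '' V ⊆ φ '' Ioo (t 0) (t 10) := by
  have hle : ∀ j l, j ≤ l → l < 11 → t j ≤ t l := fun j l hjl hl => by
    rcases hjl.eq_or_lt with rfl | h
    · exact le_rfl
    · exact (ht j l h hl).le
  refine ⟨⋂ j ∈ Finset.range 5, f^[k j] ⁻¹' (φ '' Ioo (t (2 * j)) (t (2 * j + 2))), ?_, ?_⟩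
  · rw [Filter.biInter_finset_mem]
    intro j hj
    rw [Finset.mem_range] at hj
    refine (hf.iterate (k j)).continuousAt.preimage_mem_nhds ?_
    rw [hk j hj]
    exact hφ.image_Ioo_mem_nhds (ht0.trans (hle 0 _ (by omega) (by omega)))
      ((hle _ 10 (by omega) (by omega)).trans ht1) ⟨ht _ _ (by omega) (by omega),
        ht _ _ (by omega) (by omega)⟩
  intro V hV hVc hVconn d hd hret
  have hVN : ∀ j < 5, f^[k j] '' V ⊆ φ '' Ioo (t (2 * j)) (t (2 * j + 2)) := by
    rintro j hj _ ⟨v, hv, rfl⟩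
    exact mem_iInter₂.1 (hV hv) j (Finset.mem_range.2 hj)
  have hSpre : IsPreconnected (f^[d + k 2] '' V) :=
    hVconn.isPreconnected.image _ (hf.iterate _).continuousOn
  by_contra hnot
  have hmeet : (f^[d + k 2] '' V ∩ φ '' Icc (t 4) (t 6)).Nonempty := by
    obtain ⟨_, ⟨v, hv, rfl⟩, hv'⟩ := hret
    refine ⟨f^[k 2] (f^[d] v), ⟨v, hv, by rw [add_comm, Function.iterate_add_apply]⟩, ?_⟩
    exact image_mono Ioo_subset_Icc_self (hVN 2 (by norm_num) ⟨_, hv', rfl⟩)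
  have hpair : ∀ a b, a < b → b < 5 → f^[k a] '' V ⊆ f^[d + k 2] '' V →
      f^[k b] '' V ⊆ f^[d + k 2] '' V → False := by
    intro a b hab hb ha' hb'
    have himg : ∀ j < 5, f^[k a] '' V ∪ f^[k b] '' V ⊆ f^[d + k 2 - k j] '' (f^[k j] '' V) := by
      intro j hj
      rw [← image_comp, ← Function.iterate_add, Nat.sub_add_cancel (hd j hj).le]
      exact union_subset ha' hb'
    refine hH ⟨f^[k a] '' V, f^[k b] '' V, d + k 2 - k a, d + k 2 - k b,
      hVc.image (hf.iterate _), hVc.image (hf.iterate _), ?_, hVconn.nonempty.image _,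
      by have := hd a (by omega); omega, by have := hd b hb; omega,
      himg a (by omega), himg b hb⟩
    refine Disjoint.mono (hVN a (by omega)) (hVN b hb) ?_
    rw [Set.disjoint_left]
    rintro _ ⟨s, hs, rfl⟩ ⟨s', hs', hss⟩
    have h1 := hle 0 (2 * a) (by omega) (by omega)
    have h2 := hle (2 * a + 2) (2 * b) (by omega) (by omega)
    have h3 := hle (2 * b + 2) 10 (by omega) (by omega)
    have := hφ.eq_of_eq (s := s') (t := s) ⟨by linarith [hs.1, hs.2, hs'.1], by linarith [hs'.2]⟩
      ⟨by linarith [hs.1], by linarith [hs.2, hs'.1, hs'.2]⟩ hss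
    linarith [hs.2, hs'.1]
  rcases hφ.image_Ioc_subset_or_image_Ico_subset hSpre ht0 ht1 hmeet hnot with h | h
  · refine hpair 0 1 (by norm_num) (by norm_num) ((hVN 0 (by norm_num)).trans
      ((image_mono ?_).trans h)) ((hVN 1 (by norm_num)).trans ((image_mono ?_).trans h))
    · exact fun s hs => ⟨hs.1, hs.2.le.trans (hle 2 4 (by norm_num) (by norm_num))⟩
    · exact fun s hs => ⟨(hle 0 2 (by norm_num) (by norm_num)).trans_lt hs.1, hs.2.le⟩
  · refine hpair 3 4 (by norm_num) (by norm_num) ((hVN 3 (by norm_num)).trans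
      ((image_mono ?_).trans h)) ((hVN 4 (by norm_num)).trans ((image_mono ?_).trans h))
    · exact fun s hs => ⟨hs.1.le, hs.2.trans_le (hle 8 10 (by norm_num) (by norm_num))⟩
    · exact fun s hs => ⟨(hle 6 8 (by norm_num) (by norm_num)).trans hs.1.le, hs.2⟩

theorem Set.Finite.exists_iterate_eq {G : Type*} {f : G → G} {F : Set G} (hF : F.Finite)
    (hsub : F ⊆ f '' F) : MapsTo f F F ∧ ∀ p ∈ F, ∃ m ≥ 1, f^[m] p = p := by
  have heq : f '' F = F := by
    have hc : (f '' F).ncard ≤ F.ncard := ncard_image_le hF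
    exact (eq_of_subset_of_ncard_le hsub hc (hF.image f)).symm
  have hmaps : MapsTo f F F := fun p hp => heq ▸ mem_image_of_mem f hp
  refine ⟨hmaps, fun p hp => ?_⟩
  have := hF.to_subtype
  have hsurj : Function.Surjective (hmaps.restrict f F F) := by
    rintro ⟨q, hq⟩
    obtain ⟨r, hr, rfl⟩ := hsub hq
    exact ⟨⟨r, hr⟩, rfl⟩
  obtain ⟨m, hm, hmp⟩ := (Finite.injective_iff_surjective.2 hsurj).mem_periodicPts ⟨p, hp⟩
  refine ⟨m, hm, ?_⟩
  have h := congrArg Subtype.val (show (hmaps.restrict f F F)^[m] ⟨p, hp⟩ = ⟨p, hp⟩ from hmp)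
  rwa [MapsTo.iterate_restrict] at h

/-- The forward orbit of a set. -/
def forwardOrbit {G : Type*} (f : G → G) (V : Set G) : Set G := ⋃ n : ℕ, f^[n] '' V

section ForwardOrbit

variable {G : Type*} {f : G → G} {V : Set G}

theorem image_subset_forwardOrbit (f : G → G) (V : Set G) (n : ℕ) :
    f^[n] '' V ⊆ forwardOrbit f V := subset_iUnion (fun n => f^[n] '' V) n

theorem subset_forwardOrbit (f : G → G) (V : Set G) : V ⊆ forwardOrbit f V := by
  simpa using image_subset_forwardOrbit f V 0

theorem image_forwardOrbit_subset (f : G → G) (V : Set G) (n : ℕ) :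
    f^[n] '' forwardOrbit f V ⊆ forwardOrbit f V := by
  rintro _ ⟨z, hz, rfl⟩
  obtain ⟨m, v, hv, rfl⟩ := mem_iUnion.1 hz
  exact image_subset_forwardOrbit f V (n + m) ⟨v, hv, Function.iterate_add_apply f n m v⟩

theorem forwardOrbit_mono {V' : Set G} (h : V' ⊆ V) : forwardOrbit f V' ⊆ forwardOrbit f V :=
  iUnion_mono fun _ => image_mono h

theorem mem_or_mem_image_of_mem_closure_forwardOrbit [TopologicalSpace G] [T2Space G]
    [CompactSpace G] (hf : Continuous f) (hV : IsCompact V) {p : G}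
    (hp : p ∈ closure (forwardOrbit f V)) : p ∈ V ∨ p ∈ f '' closure (forwardOrbit f V) := by
  have hcl : IsClosed (V ∪ f '' closure (forwardOrbit f V)) :=
    hV.isClosed.union (isClosed_closure.isCompact.image hf).isClosed
  refine closure_minimal ?_ hcl hp
  intro z hz
  obtain ⟨n, v, hv, rfl⟩ := mem_iUnion.1 hz
  rcases n with _ | n
  · exact Or.inl hv
  · right
    exact ⟨f^[n] v, subset_closure (image_subset_forwardOrbit f V n ⟨v, hv, rfl⟩),
      (Function.iterate_succ_apply' f n v).symm⟩

theorem isPreconnected_iUnion_iterate [TopologicalSpace G] (hf : Continuous f)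
    (hV : IsPreconnected V) {e : ℕ} (he : (f^[e] '' V ∩ V).Nonempty) (r : ℕ) :
    IsPreconnected (⋃ n : ℕ, f^[r + e * n] '' V) := by
  refine IsPreconnected.iUnion_of_chain (fun n => hV.image _ (hf.iterate _).continuousOn) ?_
  intro n
  obtain ⟨_, ⟨v, hv, rfl⟩, hv'⟩ := he
  refine ⟨f^[r + e * n] (f^[e] v), ⟨_, hv', rfl⟩, v, hv, ?_⟩
  rw [← Function.iterate_add_apply, Nat.succ_eq_succ, Nat.mul_succ, add_assoc]

theorem forwardOrbit_eq_biUnion {e : ℕ} (he : 0 < e) :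
    forwardOrbit f V = ⋃ r ∈ Finset.range e, ⋃ n : ℕ, f^[r + e * n] '' V := by
  apply Subset.antisymm
  · refine iUnion_subset fun n => ?_
    intro z hz
    refine mem_iUnion₂.2 ⟨n % e, Finset.mem_range.2 (Nat.mod_lt _ he), mem_iUnion.2 ⟨n / e, ?_⟩⟩
    rwa [Nat.mod_add_div]
  · exact iUnion₂_subset fun r _ => iUnion_subset fun n => image_subset_forwardOrbit f V _

end ForwardOrbit

theorem EdgeSys.finite_closure_forwardOrbit_diff {G : Type*} [MetricSpace G] {ι : Type} [Finite ι]
    (E : EdgeSys G ι) {f : G → G} (hf : Continuous f) {V : Set G} (hV : IsPreconnected V) {e : ℕ}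
    (he : 0 < e) (hret : (f^[e] '' V ∩ V).Nonempty) :
    (closure (forwardOrbit f V) \ forwardOrbit f V).Finite := by
  rw [forwardOrbit_eq_biUnion he]
  set C : ℕ → Set G := fun r => ⋃ n : ℕ, f^[r + e * n] '' V with hC
  refine Set.Finite.subset ((Finset.range e).finite_toSet.biUnion fun r _ =>
    E.finite_closure_diff (isPreconnected_iUnion_iterate hf hV hret r)) ?_
  rintro z ⟨hz, hz'⟩
  rw [Finset.closure_biUnion] at hz
  obtain ⟨r, hr, hzr⟩ := mem_iUnion₂.1 hz
  refine mem_iUnion₂.2 ⟨r, hr, hzr, fun h => hz' (mem_iUnion₂.2 ⟨r, hr, h⟩)⟩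

theorem EdgeSys.disjoint_closure_forwardOrbit {G : Type*} [MetricSpace G] [CompactSpace G]
    {ι : Type} [Finite ι] (E : EdgeSys G ι) {f : G → G} (hf : Continuous f) {V A P : Set G}
    {j D₀ : ℕ} (hVc : IsCompact V) (hV : IsConnected V)
    (hret : ∀ d ≥ D₀, (f^[d] '' V ∩ V).Nonempty → f^[d + j] '' V ⊆ A)
    (hub : ∀ T, ∃ d ≥ T, (f^[d] '' V ∩ V).Nonempty) (hP : P.Finite) (hPf : MapsTo f P P)
    (hPA : Disjoint P (closure A)) : Disjoint P (closure (forwardOrbit f V)) := by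
  set Z := forwardOrbit f V with hZ
  have hPfn : ∀ n, MapsTo f^[n] P P := fun n => hPf.iterate n
  -- orbits of points of `Z` visit `A` at arbitrarily late times
  have hvisit : ∀ n T, ∃ d, n ≤ d ∧ T ≤ d ∧ ∀ v ∈ V, f^[d] v ∈ A := by
    intro n T
    obtain ⟨d, hd, hdr⟩ := hub (max D₀ (max n T))
    simp only [ge_iff_le, max_le_iff] at hd
    exact ⟨d + j, by omega, by omega, fun v hv => hret d hd.1 hdr ⟨v, hv, rfl⟩⟩
  have hPZ : ∀ p ∈ P, p ∉ Z := by
    intro p hp hpZ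
    obtain ⟨n, v, hv, rfl⟩ := mem_iUnion.1 hpZ
    obtain ⟨d, hd, -, hdA⟩ := hvisit n 0
    have h1 := hPfn (d - n) hp
    rw [← Function.iterate_add_apply, Nat.sub_add_cancel hd] at h1
    exact Set.disjoint_left.1 hPA h1 (subset_closure (hdA v hv))
  obtain ⟨e, he, heret⟩ := hub 1
  set F := closure Z \ Z with hF
  have hFfin : F.Finite := E.finite_closure_forwardOrbit_diff hf hV.isPreconnected he heret
  have hFsub : F ⊆ f '' F := by
    rintro p ⟨hp, hpZ⟩
    rcases mem_or_mem_image_of_mem_closure_forwardOrbit hf hVc hp with h | ⟨q, hq, rfl⟩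
    · exact absurd (subset_forwardOrbit f V h) hpZ
    · refine ⟨q, ⟨hq, fun hqZ => hpZ ?_⟩, rfl⟩
      simpa using image_forwardOrbit_subset f V 1 (mem_image_of_mem _ hqZ)
  obtain ⟨hFmaps, hFper⟩ := hFfin.exists_iterate_eq hFsub
  rw [Set.disjoint_left]
  intro p₀ hp₀ hp₀cl
  obtain ⟨O, hO, hPO, hOcl⟩ : ∃ O, IsOpen O ∧ P ⊆ O ∧ closure O ⊆ ((F \ P) ∪ closure A)ᶜ := by
    refine normal_exists_closure_subset hP.isClosed
      ((hFfin.subset sdiff_subset).isClosed.union isClosed_closure).isOpen_compl ?_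
    rintro p hp (h | h)
    · exact h.2 hp
    · exact Set.disjoint_left.1 hPA hp h
  have hOF : ∀ q ∈ closure O, q ∈ F → q ∈ P := fun q hq hqF => by
    by_contra hqP
    exact hOcl hq (Or.inl ⟨hqF, hqP⟩)
  have hOA : ∀ q ∈ closure O, q ∉ A := fun q hq hqA => hOcl hq (Or.inr (subset_closure hqA))
  obtain ⟨dA, -, -, hdA⟩ := hvisit 0 0
  have hseq : ∀ i : ℕ, ∃ v ∈ V, ∃ n, dA ≤ n ∧ dist (f^[n] v) p₀ < 1 / ((i:ℝ) + 1) := by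
    intro i
    have hcl : IsClosed (⋃ n ∈ Finset.range dA, f^[n] '' V) :=
      (Finset.range dA).finite_toSet.isClosed_biUnion fun n _ =>
        (hVc.image (hf.iterate n)).isClosed
    have hW : Metric.ball p₀ (1 / ((i:ℝ) + 1)) ∩ (⋃ n ∈ Finset.range dA, f^[n] '' V)ᶜ ∈ 𝓝 p₀ := by
      refine inter_mem (Metric.ball_mem_nhds _ (by positivity)) (hcl.isOpen_compl.mem_nhds ?_)
      intro h
      obtain ⟨n, _, hn⟩ := mem_iUnion₂.1 h
      exact hPZ p₀ hp₀ (image_subset_forwardOrbit f V n hn)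
    obtain ⟨z, ⟨hz1, hz2⟩, hz⟩ := mem_closure_iff_nhds.1 hp₀cl _ hW
    obtain ⟨n, v, hv, rfl⟩ := mem_iUnion.1 hz
    refine ⟨v, hv, n, ?_, hz1⟩
    by_contra! hlt
    exact hz2 (mem_iUnion₂.2 ⟨n, Finset.mem_range.2 hlt, v, hv, rfl⟩)
  choose v hv n hn hdist using hseq
  have hlim : Tendsto (fun i => f^[n i] (v i)) atTop (𝓝 p₀) := by
    rw [tendsto_iff_dist_tendsto_zero]
    exact squeeze_zero (fun _ => dist_nonneg) (fun i => (hdist i).le)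
      tendsto_one_div_add_atTop_nhds_zero_nat
  -- the last time before `n i` outside `O`
  have hm : ∀ i, ∃ m ≤ n i, f^[m] (v i) ∉ O ∧ ∀ l, m < l → l ≤ n i → f^[l] (v i) ∈ O := by
    classical
    intro i
    have hdA' : f^[dA] (v i) ∉ O := fun h => hOA _ (subset_closure h) (hdA _ (hv i))
    refine ⟨Nat.findGreatest (fun m => f^[m] (v i) ∉ O) (n i), Nat.findGreatest_le _,
      Nat.findGreatest_spec (P := fun m => f^[m] (v i) ∉ O) (hn i) hdA', fun l hl hln => ?_⟩
    by_contra h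
    exact Nat.findGreatest_is_greatest hl hln h
  choose m hmn hmO hml using hm
  set 𝒰 : Ultrafilter ℕ := hyperfilter ℕ with h𝒰
  have h𝒰le : (𝒰 : Filter ℕ) ≤ atTop := Nat.hyperfilter_le_atTop
  obtain ⟨r, hr⟩ : ∃ r, Tendsto (fun i => f^[m i] (v i)) 𝒰 (𝓝 r) := by
    obtain ⟨r, -, hr⟩ := isCompact_univ.ultrafilter_le_nhds
      (𝒰.map fun i => f^[m i] (v i)) (by simp)
    exact ⟨r, hr⟩
  have hrO : r ∉ O := by
    refine hO.isClosed_compl.mem_of_tendsto hr (Eventually.of_forall fun i => hmO i)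
  have hrcl : r ∈ closure Z := by
    refine isClosed_closure.mem_of_tendsto hr (Eventually.of_forall fun i => subset_closure ?_)
    exact image_subset_forwardOrbit f V (m i) ⟨v i, hv i, rfl⟩
  have hdich : (∃ h, f^[h] r = p₀) ∨ ∀ k ≥ 1, f^[k] r ∈ closure O := by
    by_cases hbig : ∀ k, ∀ᶠ i in (𝒰 : Filter ℕ), k ≤ n i - m i
    · right
      intro k hk
      refine mem_closure_of_tendsto (((hf.iterate k).tendsto r).comp hr) ?_
      filter_upwards [hbig k] with i hi
      simp only [Function.comp]
      rw [← Function.iterate_add_apply]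
      exact hml i _ (by omega) (by have := hmn i; omega)
    · left
      push Not at hbig
      obtain ⟨k, hk⟩ := hbig
      have : ∃ h ∈ Finset.range k, ∀ᶠ i in (𝒰 : Filter ℕ), n i - m i = h := by
        have := (Ultrafilter.finite_biUnion_mem_iff (f := 𝒰) (Finset.range k).finite_toSet
          (s := fun h => {i | n i - m i = h})).1 (by
            filter_upwards [hk] with i hi
            simpa using hi)
        exact this
      obtain ⟨h, -, hh⟩ := this
      refine ⟨h, tendsto_nhds_unique (((hf.iterate h).tendsto r).comp hr) ?_⟩
      refine (hlim.mono_left h𝒰le).congr' ?_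
      filter_upwards [hh] with i hi
      simp only [Function.comp]
      rw [← Function.iterate_add_apply]
      congr 1
      have := hmn i
      omega
  by_cases hrZ : r ∈ Z
  · rcases hdich with ⟨h, hh⟩ | hall
    · exact hPZ p₀ hp₀ (hh ▸ image_forwardOrbit_subset f V h (mem_image_of_mem _ hrZ))
    · obtain ⟨l, u, hu, rfl⟩ := mem_iUnion.1 hrZ
      obtain ⟨d, hd, -, hdA⟩ := hvisit (l + 1) 0
      have := hall (d - l) (by omega)
      rw [← Function.iterate_add_apply, Nat.sub_add_cancel (by omega)] at this
      exact hOA _ this (hdA u hu)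
  · have hrF : r ∈ F := ⟨hrcl, hrZ⟩
    obtain ⟨k, hk⟩ : ∃ k, f^[k] r ∈ P := by
      rcases hdich with ⟨h, hh⟩ | hall
      · exact ⟨h, hh ▸ hp₀⟩
      · exact ⟨1, hOF _ (hall 1 le_rfl) (hFmaps hrF)⟩
    obtain ⟨m, hm, hmr⟩ := hFper r hrF
    have h1 := hPfn (m * k - k) hk
    rw [← Function.iterate_add_apply, Nat.sub_add_cancel (Nat.le_mul_of_pos_left _ hm)] at h1
    have h2 : f^[m * k] r = r := by
      rw [Function.iterate_mul]
      exact Function.iterate_fixed hmr k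
    rw [h2] at h1
    exact hrO (hPO h1)

/-- `A` and `B` have arbitrarily large finite independence sets. -/
def HasLargeIndep {G : Type*} (f : G → G) (A B : Set G) : Prop :=
  ∀ n : ℕ, ∃ I : Finset ℕ, n ≤ I.card ∧
    ∀ S : ℕ → Bool, ∃ z, ∀ i ∈ I, f^[i] z ∈ if S i then A else B

theorem isINPair_iff {G : Type*} [TopologicalSpace G] {f : G → G} {x y : G} :
    IsINPair f x y ↔ ∀ U ∈ 𝓝 x, ∀ V ∈ 𝓝 y, HasLargeIndep f U V := by
  constructor
  · intro h U hU V hV n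
    obtain ⟨I, hn, hI⟩ := h U V hU hV (n + 1)
    refine ⟨I, by omega, fun S => ?_⟩
    obtain ⟨z, hz⟩ := hI I Subset.rfl (Finset.card_pos.1 (by omega)) S
    exact ⟨z, fun i hi => mem_iInter₂.1 hz i hi⟩
  · intro h U V hU hV n
    obtain ⟨I, hn, hI⟩ := h U hU V hV n
    refine ⟨I, hn, fun J hJ _ S => ?_⟩
    obtain ⟨z, hz⟩ := hI S
    exact ⟨z, mem_iInter₂.2 fun i hi => hz i (hJ hi)⟩

namespace HasLargeIndep

variable {G : Type*} {f : G → G} {A B : Set G}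

theorem mono {A' B' : Set G} (h : HasLargeIndep f A B) (hA : A ⊆ A') (hB : B ⊆ B') :
    HasLargeIndep f A' B' := by
  intro n
  obtain ⟨I, hn, hI⟩ := h n
  refine ⟨I, hn, fun S => ?_⟩
  obtain ⟨z, hz⟩ := hI S
  refine ⟨z, fun i hi => ?_⟩
  have := hz i hi
  split_ifs at this ⊢
  · exact hA this
  · exact hB this

theorem symm (h : HasLargeIndep f A B) : HasLargeIndep f B A := by
  intro n
  obtain ⟨I, hn, hI⟩ := h n
  refine ⟨I, hn, fun S => ?_⟩
  obtain ⟨z, hz⟩ := hI (fun i => !(S i))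
  refine ⟨z, fun i hi => ?_⟩
  have := hz i hi
  cases hS : S i <;> simpa [hS] using this

theorem preimage (h : HasLargeIndep f A B) : HasLargeIndep f (f ⁻¹' A) (f ⁻¹' B) := by
  classical
  intro n
  obtain ⟨I, hn, hI⟩ := h (n + 1)
  refine ⟨(I.erase 0).image Nat.pred, ?_, fun S => ?_⟩
  · rw [Finset.card_image_of_injOn]
    · have : I.card - 1 ≤ (I.erase 0).card := Finset.pred_card_le_card_erase
      omega
    · intro a ha b hb hab
      simp only [Finset.coe_erase, Set.mem_sdiff, mem_singleton_iff] at ha hb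
      simp only [Nat.pred_eq_sub_one] at hab
      omega
  · obtain ⟨z, hz⟩ := hI (fun i => S (i - 1))
    refine ⟨z, fun i hi => ?_⟩
    simp only [Finset.mem_image, Finset.mem_erase] at hi
    obtain ⟨j, ⟨hj0, hj⟩, rfl⟩ := hi
    have := hz j hj
    obtain ⟨k, rfl⟩ := Nat.exists_eq_succ_of_ne_zero hj0
    simp only [Nat.succ_eq_add_one, Nat.add_sub_cancel, Function.iterate_succ_apply'] at this
    simp only [Nat.succ_eq_add_one, Nat.pred_eq_sub_one, Nat.add_sub_cancel]
    cases hS : S k <;> simpa [hS] using this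

theorem iterate (h : HasLargeIndep f A B) {q : ℕ} (hq : 0 < q) : HasLargeIndep f^[q] A B := by
  classical
  intro n
  obtain ⟨I, hn, hI⟩ := h (q * n)
  obtain ⟨r, -, hr⟩ := Finset.exists_le_card_fiber_of_mul_le_card_of_maps_to
    (s := I) (t := Finset.range q) (f := fun i => i % q) (n := n)
    (fun i _ => Finset.mem_range.2 (Nat.mod_lt _ hq)) ⟨0, Finset.mem_range.2 hq⟩ (by simpa using hn)
  refine ⟨({i ∈ I | i % q = r}).image (fun i => i / q), ?_, fun S => ?_⟩
  · rwa [Finset.card_image_of_injOn]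
    intro a ha b hb hab
    simp only [Finset.coe_filter, mem_ofPred_eq] at ha hb
    simp only at hab
    rw [← Nat.mod_add_div a q, ← Nat.mod_add_div b q, ha.2, hb.2, hab]
  · obtain ⟨z, hz⟩ := hI (fun i => S (i / q))
    refine ⟨f^[r] z, fun i hi => ?_⟩
    simp only [Finset.mem_image, Finset.mem_filter] at hi
    obtain ⟨j, ⟨hj, hjr⟩, rfl⟩ := hi
    rw [← Function.iterate_mul, ← Function.iterate_add_apply, ← hjr, add_comm, Nat.mod_add_div]
    exact hz j hj

theorem exists_times (h : HasLargeIndep f A B) (N : ℕ) : ∃ t : ℕ → ℕ,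
    (∀ j k, j < k → k < N → t j < t k) ∧
    ∀ S : ℕ → Bool, ∃ z, ∀ k < N, f^[t k] z ∈ if S k then A else B := by
  classical
  obtain ⟨I, hn, hI⟩ := h N
  let t : ℕ → ℕ := fun k => if h : k < I.card then I.orderEmbOfFin rfl ⟨k, h⟩ else 0
  have hlt : ∀ j k, j < k → k < N → t j < t k := by
    intro j k hjk hk
    have h1 : k < I.card := by omega
    have h2 : j < I.card := by omega
    simp only [t, h1, h2, dite_true]
    exact (I.orderEmbOfFin rfl).strictMono hjk
  refine ⟨t, hlt, fun S => ?_⟩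
  have hinj : ∀ j < N, ∀ k < N, t j = t k → j = k := by
    intro j hj k hk hjk
    rcases lt_trichotomy j k with h | h | h
    · have := hlt j k h hk; omega
    · exact h
    · have := hlt k j h hj; omega
  obtain ⟨z, hz⟩ := hI (fun i => decide (∃ k < N, t k = i ∧ S k = true))
  refine ⟨z, fun k hk => ?_⟩
  have hkI : t k ∈ I := by
    have h1 : k < I.card := by omega
    simp only [t, h1, dite_true]
    exact Finset.orderEmbOfFin_mem _ _ _
  have := hz (t k) hkI
  have hiff : (∃ k' < N, t k' = t k ∧ S k' = true) ↔ S k = true := by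
    constructor
    · rintro ⟨k', hk', h1, h2⟩
      rwa [← hinj k' hk' k hk h1]
    · exact fun hS => ⟨k, hk, rfl, hS⟩
  simpa [hiff] using this

theorem exists_two_steps (h : HasLargeIndep f A B) (T : ℕ) : ∃ d₀ ≥ T, ∃ d ≥ T,
    ∀ s₀ s₁ s₂ : Bool, ∃ z ∈ (if s₀ then A else B), f^[d₀] z ∈ (if s₁ then A else B) ∧
      f^[d₀ + d] z ∈ if s₂ then A else B := by
  obtain ⟨t, ht, hz⟩ := h.exists_times (2 * T + 3)
  have hgap : ∀ j k, j + k < 2 * T + 3 → t j + k ≤ t (j + k) := by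
    intro j k
    induction k with
    | zero => simp
    | succ k ih =>
      intro hk
      have := ih (by omega)
      have := ht (j + k) (j + (k + 1)) (by omega) hk
      omega
  have h1 := hgap 0 (T + 1) (by omega)
  have h2 := hgap (T + 1) (T + 1) (by omega)
  rw [zero_add] at h1
  refine ⟨t (T + 1) - t 0, by omega, t (T + 1 + (T + 1)) - t (T + 1), by omega, ?_⟩
  intro s₀ s₁ s₂
  obtain ⟨z, hz⟩ := hz (fun k => if k = 0 then s₀ else if k = T + 1 then s₁ else s₂)
  refine ⟨f^[t 0] z, by simpa using hz 0 (by omega), ?_, ?_⟩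
  · rw [← Function.iterate_add_apply, Nat.sub_add_cancel (by omega)]
    simpa using hz (T + 1) (by omega)
  · rw [← Function.iterate_add_apply, show t (T + 1) - t 0 + (t (T + 1 + (T + 1)) - t (T + 1)) + t 0
      = t (T + 1 + (T + 1)) by omega]
    simpa using hz (T + 1 + (T + 1)) (by omega)

end HasLargeIndep

theorem exists_mul_pow_mul_two_pow_lt (D : ℕ) : ∃ n ≥ 1, D * n ^ D * 2 ^ n < 3 ^ n := by
  have h := (tendsto_pow_const_div_const_pow_of_one_lt D (r := (3:ℝ) / 2) (by norm_num)).const_mul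
    (D : ℝ)
  rw [mul_zero] at h
  obtain ⟨n, hn, hn1⟩ := ((h.eventually (gt_mem_nhds zero_lt_one)).and
    (eventually_ge_atTop 1)).exists
  refine ⟨n, hn1, ?_⟩
  have h3 : (0:ℝ) < (3 / 2) ^ n := by positivity
  have h2 : (0:ℝ) < 2 ^ n := by positivity
  rw [← mul_div_assoc, div_lt_one h3, div_pow, lt_div_iff₀ h2] at hn
  exact_mod_cast hn

/-- A counting bound for families of subsets without large shattered sets. -/
theorem card_le_of_forall_shatters_lt (I : Finset ℕ) (hI : 1 ≤ I.card) (𝒜 : Finset (Finset ℕ))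
    (h𝒜 : 𝒜 ⊆ I.powerset) (D : ℕ) (hD : ∀ J, 𝒜.Shatters J → J.card < D) :
    𝒜.card ≤ D * I.card ^ D := by
  classical
  refine 𝒜.card_le_card_shatterer.trans ?_
  have hsub : 𝒜.shatterer ⊆ (Finset.range D).biUnion fun k => I.powersetCard k := by
    intro J hJ
    rw [Finset.mem_shatterer] at hJ
    simp only [Finset.mem_biUnion, Finset.mem_range, Finset.mem_powersetCard]
    refine ⟨_, hD J hJ, ?_, rfl⟩
    obtain ⟨u, hu, hJu⟩ := hJ (Finset.Subset.refl J)
    exact (Finset.inter_eq_left.1 hJu).trans (Finset.mem_powerset.1 (h𝒜 hu))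
  refine (Finset.card_le_card hsub).trans (Finset.card_biUnion_le.trans ?_)
  calc ∑ k ∈ Finset.range D, (I.powersetCard k).card
      ≤ ∑ k ∈ Finset.range D, I.card ^ D := by
        refine Finset.sum_le_sum fun k hk => ?_
        rw [Finset.card_powersetCard]
        exact (Nat.choose_le_pow _ _).trans
          (Nat.pow_le_pow_right hI (Finset.mem_range.1 hk).le)
    _ = D * I.card ^ D := by simp

theorem HasLargeIndep.of_union_left {G : Type*} {f : G → G} {A₁ A₂ B : Set G}
    (h : HasLargeIndep f (A₁ ∪ A₂) B) : HasLargeIndep f A₁ B ∨ HasLargeIndep f A₂ B := by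
  classical
  by_contra! hcon
  obtain ⟨h1, h2⟩ := hcon
  have hbound : ∀ {A}, ¬ HasLargeIndep f A B → ∃ D, ∀ I : Finset ℕ, D ≤ I.card →
      ¬ ∀ S : ℕ → Bool, ∃ z, ∀ i ∈ I, f^[i] z ∈ if S i then A else B := by
    intro A hA
    by_contra hD
    refine hA fun D => ?_
    by_contra hI
    exact hD ⟨D, fun I hle hS => hI ⟨I, hle, hS⟩⟩
  obtain ⟨D₁, hD₁⟩ := hbound h1
  obtain ⟨D₂, hD₂⟩ := hbound h2
  obtain ⟨n, hn1, hn⟩ := exists_mul_pow_mul_two_pow_lt (D₁ + D₂)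
  obtain ⟨I', hI'n, hI'⟩ := h n
  obtain ⟨I, hII', hIc⟩ := Finset.exists_subset_card_eq hI'n
  -- `F θ`: the patterns realized when `θ` prescribes the choice between `A₁` and `A₂`
  let F : Finset ℕ → Finset (Finset ℕ) := fun θ => I.powerset.filter fun S =>
    ∃ z, ∀ i ∈ I, f^[i] z ∈ if i ∈ S then (if i ∈ θ then A₁ else A₂) else B
  have hex : ∀ S ∈ I.powerset, ∃ T ⊆ S, ∀ R ⊆ I \ S, S ∈ F (T ∪ R) := by
    intro S hS
    obtain ⟨z, hz⟩ := hI' (fun i => decide (i ∈ S))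
    refine ⟨S.filter fun i => f^[i] z ∈ A₁, Finset.filter_subset _ _, fun R hR => ?_⟩
    refine Finset.mem_filter.2 ⟨hS, z, fun i hi => ?_⟩
    have hzi := hz i (hII' hi)
    by_cases hiS : i ∈ S
    · have hiR : i ∉ R := fun hiR => (Finset.mem_sdiff.1 (hR hiR)).2 hiS
      simp only [hiS, decide_true, if_true] at hzi
      by_cases hA : f^[i] z ∈ A₁
      · simp [hiS, hA]
      · simpa [hiS, hA, hiR] using hzi
    · simpa [hiS] using hzi
  choose! T hTS hT using hex
  have hcount : 3 ^ n ≤ ∑ θ ∈ I.powerset, (F θ).card := by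
    have h3 : ∑ S ∈ I.powerset, (I \ S).powerset.card = 3 ^ n := by
      have := Finset.sum_pow_mul_eq_add_pow 1 2 I
      rw [hIc] at this
      rw [← show (1 + 2 : ℕ) = 3 from rfl, ← this]
      refine Finset.sum_congr rfl fun S hS => ?_
      rw [Finset.card_powerset, Finset.card_sdiff_of_subset (Finset.mem_powerset.1 hS), hIc]
      simp
    rw [← h3, ← Finset.card_sigma, ← Finset.card_sigma]
    refine Finset.card_le_card_of_injOn (fun p => ⟨T p.1 ∪ p.2, p.1⟩) ?_ ?_
    · rintro ⟨S, R⟩ hp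
      simp only [Finset.coe_sigma, mem_sigma_iff, Finset.mem_coe, Finset.mem_powerset] at hp ⊢
      exact ⟨Finset.union_subset ((hTS S (Finset.mem_powerset.2 hp.1)).trans hp.1)
        (hp.2.trans Finset.sdiff_subset), hT S (Finset.mem_powerset.2 hp.1) R hp.2⟩
    · rintro ⟨S, R⟩ hp ⟨S', R'⟩ hp' heq
      simp only [Finset.coe_sigma, mem_sigma_iff, Finset.mem_coe, Finset.mem_powerset] at hp hp'
      simp only [Sigma.mk.injEq, heq_eq_eq] at heq
      obtain ⟨h1, rfl⟩ := heq
      have hR : ∀ R ⊆ I \ S, (T S ∪ R) \ S = R := by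
        intro R hR
        ext i
        simp only [Finset.mem_sdiff, Finset.mem_union]
        constructor
        · rintro ⟨h | h, hi⟩
          · exact absurd (hTS S (Finset.mem_powerset.2 hp.1) h) hi
          · exact h
        · exact fun h => ⟨Or.inr h, (Finset.mem_sdiff.1 (hR h)).2⟩
      rw [← hR R hp.2, ← hR R' hp'.2, h1]
  obtain ⟨θ, hθ⟩ : ∃ θ, (D₁ + D₂) * n ^ (D₁ + D₂) < (F θ).card := by
    by_contra! hall
    have := Finset.sum_le_card_nsmul I.powerset (fun θ => (F θ).card) _ fun θ _ => hall θ
    rw [Finset.card_powerset, hIc, smul_eq_mul, mul_comm] at this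
    omega
  obtain ⟨J, hJ, hJc⟩ : ∃ J, (F θ).Shatters J ∧ D₁ + D₂ ≤ J.card := by
    by_contra! hall
    have := card_le_of_forall_shatters_lt I (by omega) (F θ) (Finset.filter_subset _ _) _ hall
    rw [hIc] at this
    omega
  have hJI : J ⊆ I := by
    obtain ⟨u, hu, hJu⟩ := hJ (Finset.Subset.refl J)
    exact (Finset.inter_eq_left.1 hJu).trans (Finset.mem_powerset.1 (Finset.mem_filter.1 hu).1)
  have hsh : ∀ S : ℕ → Bool, ∃ z, ∀ i ∈ J,
      f^[i] z ∈ if S i then (if i ∈ θ then A₁ else A₂) else B := by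
    intro S
    obtain ⟨u, hu, hJu⟩ := hJ (Finset.filter_subset (fun i => S i = true) J)
    obtain ⟨z, hz⟩ := (Finset.mem_filter.1 hu).2
    refine ⟨z, fun i hi => ?_⟩
    have hiff : i ∈ u ↔ S i = true := by
      have := Finset.ext_iff.1 hJu i
      simpa [hi] using this
    simpa [hiff] using hz i (hJI hi)
  have hsplit : (J ∩ θ).card + (J \ θ).card = J.card := Finset.card_inter_add_card_sdiff J θ
  rcases le_or_gt D₁ (J ∩ θ).card with hle | hgt
  · refine hD₁ _ hle fun S => ?_
    obtain ⟨z, hz⟩ := hsh S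
    refine ⟨z, fun i hi => ?_⟩
    have hi' := Finset.mem_inter.1 hi
    simpa [hi'.2] using hz i hi'.1
  · refine hD₂ (J \ θ) (by omega) fun S => ?_
    obtain ⟨z, hz⟩ := hsh S
    refine ⟨z, fun i hi => ?_⟩
    have hi' := Finset.mem_sdiff.1 hi
    simpa [hi'.2] using hz i hi'.1

theorem exists_ultrafilter_hasLargeIndep {G : Type*} {f : G → G} {F₁ F₂ : Filter G}
    (h : ∀ A ∈ F₁, ∀ B ∈ F₂, HasLargeIndep f A B) :
    ∃ U : Ultrafilter G, ↑U ≤ F₁ ∧ ∀ A ∈ U, ∀ B ∈ F₂, HasLargeIndep f A B := by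
  let N : Filter G :=
    { sets := {C | ∃ B ∈ F₂, ¬ HasLargeIndep f Cᶜ B}
      univ_sets := by
        refine ⟨univ, univ_mem, fun hcon => ?_⟩
        obtain ⟨I, hI, hz⟩ := hcon 1
        obtain ⟨i, hi⟩ := Finset.card_pos.1 hI
        obtain ⟨z, hz⟩ := hz fun _ => true
        simpa using hz i hi
      sets_of_superset := by
        rintro C C' ⟨B, hB, hC⟩ hCC'
        exact ⟨B, hB, fun hcon => hC (hcon.mono (compl_subset_compl.2 hCC') Subset.rfl)⟩
      inter_sets := by
        rintro C C' ⟨B, hB, hC⟩ ⟨B', hB', hC'⟩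
        refine ⟨B ∩ B', inter_mem hB hB', fun hcon => ?_⟩
        rw [compl_inter] at hcon
        rcases hcon.of_union_left with h | h
        · exact hC (h.mono Subset.rfl inter_subset_left)
        · exact hC' (h.mono Subset.rfl inter_subset_right) }
  have hne : (F₁ ⊓ N).NeBot := by
    rw [inf_neBot_iff]
    rintro A hA C ⟨B, hB, hC⟩
    by_contra hemp
    rw [not_nonempty_iff_eq_empty, ← disjoint_iff_inter_eq_empty] at hemp
    exact hC ((h A hA B hB).mono hemp.subset_compl_right Subset.rfl)
  obtain ⟨U, hU⟩ := Ultrafilter.exists_le (F₁ ⊓ N)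
  refine ⟨U, hU.trans inf_le_left, fun A hA B hB => ?_⟩
  by_contra hcon
  have : Aᶜ ∈ N := ⟨B, hB, by rwa [compl_compl]⟩
  exact Ultrafilter.compl_notMem_iff.2 hA ((hU.trans inf_le_right) this)

section IN

variable {G : Type*} [TopologicalSpace G] {f : G → G} {x y : G}

theorem IsINPair.symm (h : IsINPair f x y) : IsINPair f y x := by
  rw [isINPair_iff] at h ⊢
  exact fun U hU V hV => (h V hV U hU).symm

theorem IsINPair.iterate (h : IsINPair f x y) {q : ℕ} (hq : 0 < q) : IsINPair f^[q] x y := by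
  rw [isINPair_iff] at h ⊢
  exact fun U hU V hV => (h U hU V hV).iterate hq

theorem IsINPair.exists_lift [T2Space G] [CompactSpace G] (hf : Continuous f)
    (h : IsINPair f x y) : ∃ x' y', f x' = x ∧ f y' = y ∧ IsINPair f x' y' := by
  rw [isINPair_iff] at h
  have h0 : ∀ A ∈ comap f (𝓝 x), ∀ B ∈ comap f (𝓝 y), HasLargeIndep f A B := by
    rintro A ⟨U, hU, hUA⟩ B ⟨V, hV, hVB⟩
    exact (h U hU V hV).preimage.mono hUA hVB
  obtain ⟨U₁, hU₁, h1⟩ := exists_ultrafilter_hasLargeIndep h0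
  obtain ⟨U₂, hU₂, h2⟩ := exists_ultrafilter_hasLargeIndep (F₁ := comap f (𝓝 y)) (F₂ := U₁)
    (fun B hB A hA => (h1 A hA B hB).symm)
  obtain ⟨x', -, hx'⟩ := isCompact_univ.ultrafilter_le_nhds U₁ (by simp)
  obtain ⟨y', -, hy'⟩ := isCompact_univ.ultrafilter_le_nhds U₂ (by simp)
  refine ⟨x', y', ?_, ?_, isINPair_iff.2 fun U hU V hV => (h2 V (hy' hV) U (hx' hU)).symm⟩
  · exact tendsto_nhds_unique ((hf.tendsto x').mono_left hx') (tendsto_iff_comap.2 hU₁)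
  · exact tendsto_nhds_unique ((hf.tendsto y').mono_left hy') (tendsto_iff_comap.2 hU₂)

theorem IsINPair.exists_backward_orbits [T2Space G] [CompactSpace G] (hf : Continuous f)
    (h : IsINPair f x y) : ∃ X Y : ℕ → G, X 0 = x ∧ Y 0 = y ∧ (∀ n, f (X (n + 1)) = X n) ∧
      (∀ n, f (Y (n + 1)) = Y n) ∧ ∀ n, IsINPair f (X n) (Y n) := by
  have step : ∀ p : {p : G × G // IsINPair f p.1 p.2}, ∃ q : {p : G × G // IsINPair f p.1 p.2},
      f q.1.1 = p.1.1 ∧ f q.1.2 = p.1.2 := by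
    rintro ⟨⟨a, b⟩, hab⟩
    obtain ⟨a', b', ha, hb, hab'⟩ := hab.exists_lift hf
    exact ⟨⟨⟨a', b'⟩, hab'⟩, ha, hb⟩
  choose s hs using step
  let q : ℕ → {p : G × G // IsINPair f p.1 p.2} := fun n => s^[n] ⟨(x, y), h⟩
  have hq : ∀ n, q (n + 1) = s (q n) := fun n => Function.iterate_succ_apply' s n _
  exact ⟨fun n => (q n).1.1, fun n => (q n).1.2, rfl, rfl,
    fun n => by change f (q (n + 1)).1.1 = (q n).1.1; rw [hq]; exact (hs _).1,
    fun n => by change f (q (n + 1)).1.2 = (q n).1.2; rw [hq]; exact (hs _).2, fun n => (q n).2⟩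

end IN

theorem isPreconnected_iInter_of_antitone {X : Type*} [TopologicalSpace X] [T2Space X]
    [CompactSpace X] {D : ℕ → Set X} (hD : Antitone D) (hc : ∀ n, IsClosed (D n))
    (hp : ∀ n, IsPreconnected (D n)) : IsPreconnected (⋂ n, D n) := by
  rw [isPreconnected_iff_subset_of_fully_disjoint_closed (isClosed_iInter hc)]
  intro u v hu hv huv hd
  obtain ⟨U, V, hU, hV, huU, hvV, hUV⟩ :=
    SeparatedNhds.of_isCompact_isCompact hu.isCompact hv.isCompact hd
  obtain ⟨n, hn⟩ := exists_subset_nhds_of_isCompact (V := D) hD.directed_ge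
    (fun n => (hc n).isCompact) (U := U ∪ V)
    (fun x hx => (hU.union hV).mem_nhds (union_subset_union huU hvV (huv hx)))
  rcases (hp n).subset_or_subset hU hV hUV hn with h | h
  · left
    intro z hz
    refine (huv hz).resolve_right fun hzv => ?_
    exact Set.disjoint_left.1 hUV (h (mem_iInter.1 hz n)) (hvV hzv)
  · right
    intro z hz
    refine (huv hz).resolve_left fun hzu => ?_
    exact Set.disjoint_left.1 hUV (huU hzu) (h (mem_iInter.1 hz n))

theorem image_iInter_iterate_eq {X : Type*} [TopologicalSpace X] [T2Space X] [CompactSpace X]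
    {g : X → X} (hg : Continuous g) {D : Set X} (hD : IsClosed D) (hgD : g '' D ⊆ D) :
    Antitone (fun n => g^[n] '' D) ∧ g '' (⋂ n : ℕ, g^[n] '' D) = ⋂ n : ℕ, g^[n] '' D := by
  have hanti : Antitone (fun n => g^[n] '' D) := by
    refine antitone_nat_of_succ_le fun n => ?_
    change g^[n + 1] '' D ⊆ g^[n] '' D
    rw [Function.iterate_succ, image_comp]
    exact image_mono hgD
  have hsucc : ∀ n, g '' (g^[n] '' D) = g^[n + 1] '' D := fun n => by
    rw [Function.iterate_succ', image_comp]
  refine ⟨hanti, Subset.antisymm ?_ ?_⟩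
  · refine subset_iInter fun n => ?_
    refine (image_mono (iInter_subset _ n)).trans ?_
    rw [hsucc]
    exact hanti (Nat.le_succ n)
  · intro z hz
    have hcl : ∀ n, IsClosed (g^[n] '' D ∩ g ⁻¹' {z}) := fun n =>
      ((hD.isCompact.image (hg.iterate n)).isClosed).inter (isClosed_singleton.preimage hg)
    obtain ⟨w, hw⟩ := IsCompact.nonempty_iInter_of_sequence_nonempty_isCompact_isClosed
      (fun n => g^[n] '' D ∩ g ⁻¹' {z})
      (fun n => inter_subset_inter_left _ (hanti (Nat.le_succ n)))
      (fun n => by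
        have := mem_iInter.1 hz (n + 1)
        rw [← hsucc] at this
        obtain ⟨w, hw, hwz⟩ := this
        exact ⟨w, hw, hwz⟩)
      (hcl 0).isCompact hcl
    rw [mem_iInter] at hw
    exact ⟨w, mem_iInter.2 fun n => (hw n).1, (hw 0).2⟩

/-- A continuous map which moves two points of a connected subset of an edge in opposite
directions has a fixed point there. -/
theorem IsEdge.exists_fixed {G : Type*} [TopologicalSpace G] [T2Space G] {φ : ℝ → G}
    (h : IsEdge φ) {g : G → G} (hg : Continuous g) {S : Set G} (hS : IsPreconnected S)
    (hSφ : S ⊆ φ '' Icc 0 1) (hgS : g '' S ⊆ φ '' Icc 0 1) {m : ℝ} {a b : G}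
    (ha : a ∈ S) (hb : b ∈ S) (ha₁ : a ∉ φ '' Icc m 1) (ha₂ : g a ∉ φ '' Icc 0 m)
    (hb₁ : b ∉ φ '' Icc 0 m) (hb₂ : g b ∉ φ '' Icc m 1) : ∃ p ∈ S, g p = p := by
  let r : G → ℝ := Function.invFunOn φ (Icc 0 1)
  have hr : ∀ z ∈ φ '' Icc 0 1, r z ∈ Icc (0:ℝ) 1 ∧ φ (r z) = z := fun z hz =>
    ⟨Function.invFunOn_mem hz, Function.invFunOn_eq hz⟩
  have hrc : ContinuousOn r (φ '' Icc 0 1) := by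
    rw [continuousOn_iff_isClosed]
    intro t ht
    refine ⟨φ '' (Icc 0 1 ∩ t), ((isCompact_Icc.inter_right ht).image h.continuous).isClosed, ?_⟩
    ext z
    constructor
    · rintro ⟨hz, hzφ⟩
      exact ⟨⟨r z, ⟨(hr z hzφ).1, hz⟩, (hr z hzφ).2⟩, hzφ⟩
    · rintro ⟨⟨s, ⟨hs, hst⟩, rfl⟩, hzφ⟩
      refine ⟨?_, hzφ⟩
      have : r (φ s) = s := h.eq_of_eq (hr _ hzφ).1 hs (hr _ hzφ).2
      simpa [this] using hst
  have hlt : ∀ z ∈ φ '' Icc 0 1, z ∉ φ '' Icc m 1 → r z < m := fun z hz hzm => by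
    by_contra! hle
    exact hzm ⟨r z, ⟨hle, (hr z hz).1.2⟩, (hr z hz).2⟩
  have hgt : ∀ z ∈ φ '' Icc 0 1, z ∉ φ '' Icc 0 m → m < r z := fun z hz hzm => by
    by_contra! hle
    exact hzm ⟨r z, ⟨(hr z hz).1.1, hle⟩, (hr z hz).2⟩
  obtain ⟨p, hp, hpr⟩ := hS.intermediate_value₂ ha hb (f := r) (g := fun z => r (g z))
    (hrc.mono hSφ) (hrc.comp hg.continuousOn fun z hz => hgS (mem_image_of_mem g hz))
    ((hlt a (hSφ ha) ha₁).trans (hgt _ (hgS (mem_image_of_mem g ha)) ha₂)).le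
    ((hlt _ (hgS (mem_image_of_mem g hb)) hb₂).trans (hgt b (hSφ hb) hb₁)).le
  exact ⟨p, hp, (hr _ (hgS (mem_image_of_mem g hp))).2.symm.trans
    ((congrArg φ hpr.symm).trans (hr p (hSφ hp)).2)⟩

/-- Without horseshoes, a point with sufficiently many distinct iterates has a neighbourhood
whose returns are confined to an arc missing a given finite set. -/
theorem EdgeSys.exists_confining {G : Type*} [MetricSpace G] {ι : Type} [Finite ι]
    (E : EdgeSys G ι) {f : G → G} (hf : Continuous f) (hH : ¬ HasHorseshoe f) {P : Set G}
    (hP : P.Finite) : ∃ M : ℕ, ∀ (w : G) (S : Finset ℕ), M ≤ S.card →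
      InjOn (fun k => f^[k] w) S → ∃ k ∈ S, ∃ i a b, 0 ≤ a ∧ b ≤ 1 ∧
        f^[k] w ∈ E.φ i '' Ioo a b ∧ Disjoint P (E.φ i '' Icc a b) ∧ ∃ V₀ ∈ 𝓝 w, ∃ D₀, ∀ V ⊆ V₀,
          IsCompact V → IsConnected V → ∀ d ≥ D₀, (f^[d] '' V ∩ V).Nonempty →
            f^[d + k] '' V ⊆ E.φ i '' Ioo a b := by
  classical
  obtain ⟨M, hM⟩ := E.exists_arc 11 hP
  refine ⟨M, fun w S hS hinj => ?_⟩
  obtain ⟨i, t, ht, hmem, hPt⟩ := hM (S.image fun k => f^[k] w)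
    (by rwa [Finset.card_image_of_injOn hinj])
  have hex : ∀ j < 11, ∃ k ∈ S, f^[k] w = E.φ i (t j) := fun j hj => by
    simpa using (hmem j hj).2
  choose! κ hκS hκ using hex
  have h0 := (hmem 0 (by norm_num)).1
  have h10 := (hmem 10 (by norm_num)).1
  have h05 := ht 0 5 (by norm_num) (by norm_num)
  have h510 := ht 5 10 (by norm_num) (by norm_num)
  obtain ⟨V₀, hV₀, hV⟩ := (E.isEdge i).exists_nhds_image_subset hf hH ht h0.1.le h10.2.le (w := w)
    (k := fun j => κ (2 * j + 1)) (fun j hj => hκ _ (by omega))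
  refine ⟨κ 5, hκS 5 (by norm_num), i, t 0, t 10, h0.1.le, h10.2.le,
    ⟨t 5, ⟨h05, h510⟩, (hκ 5 (by norm_num)).symm⟩, ?_, V₀, hV₀,
    ∑ j ∈ Finset.range 5, (κ (2 * j + 1) + 1), fun V hVV hVc hVconn d hd hret => ?_⟩
  · rw [Set.disjoint_right]
    rintro _ ⟨s, hs, rfl⟩
    exact hPt 0 (by norm_num) 10 (by norm_num) s hs
  · refine hV V hVV hVc hVconn d (fun j hj => ?_) hret
    have : κ (2 * j + 1) + 1 ≤ _ := Finset.single_le_sum (f := fun j => κ (2 * j + 1) + 1)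
      (fun _ _ => Nat.zero_le _) (Finset.mem_range.2 hj)
    change κ (2 * j + 1) < d + κ (2 * 2 + 1)
    omega

theorem EdgeSys.exists_disjoint_closure_forwardOrbit {G : Type*} [MetricSpace G] [CompactSpace G]
    {ι : Type} [Finite ι] (E : EdgeSys G ι) {f : G → G} (hf : Continuous f)
    (hH : ¬ HasHorseshoe f) {P : Set G} (hP : P.Finite) (hPf : MapsTo f P P) :
    ∃ M : ℕ, ∀ (w : G) (S : Finset ℕ), M ≤ S.card → InjOn (fun k => f^[k] w) S →
      ∃ V₀ ∈ 𝓝 w, ∀ V ⊆ V₀, IsCompact V → IsConnected V →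
        (∀ T, ∃ d ≥ T, (f^[d] '' V ∩ V).Nonempty) → Disjoint P (closure (forwardOrbit f V)) := by
  obtain ⟨M, hM⟩ := E.exists_confining hf hH hP
  refine ⟨M, fun w S hS hinj => ?_⟩
  obtain ⟨k, -, i, a, b, -, -, -, hPd, V₀, hV₀, D₀, hV⟩ := hM w S hS hinj
  refine ⟨V₀, hV₀, fun V hVV hVc hVconn hub => ?_⟩
  refine E.disjoint_closure_forwardOrbit hf hVc hVconn (hV V hVV hVc hVconn) hub hP hPf ?_
  exact hPd.mono_right (closure_minimal (image_mono Ioo_subset_Icc_self)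
    (isCompact_Icc.image (E.isEdge i).continuous).isClosed)

/-- An image `f^K(V)` where `V` is a compact connected neighbourhood of the `K`-th point of the
backward orbit `ys`. -/
def IsBackwardNhd {G : Type*} [TopologicalSpace G] (f : G → G) (ys : ℕ → G) (B : Set G) : Prop :=
  ∃ K, ∃ V ∈ 𝓝 (ys K), IsCompact V ∧ IsConnected V ∧ f^[K] '' V = B

section BackwardOrbit

variable {G : Type*} {f : G → G} {ys : ℕ → G}

theorem iterate_backward (hys : ∀ n, f (ys (n + 1)) = ys n) (m n : ℕ) :
    f^[m] (ys (n + m)) = ys n := by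
  induction m with
  | zero => rfl
  | succ m ih => rw [Function.iterate_succ_apply, ← add_assoc, hys, ih]

theorem iterate_backward_of_le (hys : ∀ n, f (ys (n + 1)) = ys n) {m n : ℕ} (h : m ≤ n) :
    f^[m] (ys n) = ys (n - m) := by
  conv_lhs => rw [← Nat.sub_add_cancel h]
  exact iterate_backward hys m (n - m)

theorem injective_backward (hys : ∀ n, f (ys (n + 1)) = ys n)
    (hper : ∀ m ≥ 1, f^[m] (ys 0) ≠ ys 0) : Function.Injective ys := by
  have key : ∀ m n, m < n → ys m ≠ ys n := by
    intro m n hmn heq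
    apply hper (n - m) (by omega)
    have h1 := iterate_backward_of_le hys (le_refl m)
    have h2 := iterate_backward_of_le hys (le_refl n)
    rw [Nat.sub_self] at h1 h2
    rw [← h1, ← Function.iterate_add_apply, Nat.sub_add_cancel hmn.le, heq, h2, ← heq, h1]
  intro m n h
  rcases lt_trichotomy m n with hmn | hmn | hmn
  · exact absurd h (key m n hmn)
  · exact hmn
  · exact absurd h.symm (key n m hmn)

variable [TopologicalSpace G] {B : Set G}

namespace IsBackwardNhd

theorem isConnected (h : IsBackwardNhd f ys B) (hf : Continuous f) : IsConnected B := by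
  obtain ⟨K, V, -, -, hV, rfl⟩ := h
  exact hV.image _ (hf.iterate K).continuousOn

theorem mem (h : IsBackwardNhd f ys B) (hys : ∀ n, f (ys (n + 1)) = ys n) : ys 0 ∈ B := by
  obtain ⟨K, V, hV, -, -, rfl⟩ := h
  exact ⟨ys K, mem_of_mem_nhds hV, by rw [iterate_backward_of_le hys le_rfl, Nat.sub_self]⟩

theorem exists_subset [T2Space G] [CompactSpace G] [LocallyConnectedSpace G] (hf : Continuous f)
    (hys : ∀ n, f (ys (n + 1)) = ys n) (h : IsBackwardNhd f ys B) {K : ℕ} {O : Set G}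
    (hO : O ∈ 𝓝 (ys K)) : ∃ B' ⊆ B, B' ⊆ f^[K] '' O ∧ IsBackwardNhd f ys B' := by
  obtain ⟨L, W, hW, -, -, rfl⟩ := h
  have hpre : ∀ (m : ℕ) (U : Set G), U ∈ 𝓝 (ys m) → ∀ n, m ≤ n → f^[n - m] ⁻¹' U ∈ 𝓝 (ys n) := by
    intro m U hU n hmn
    refine (hf.iterate (n - m)).continuousAt.preimage_mem_nhds ?_
    rwa [iterate_backward_of_le hys (Nat.sub_le n m), Nat.sub_sub_self hmn]
  obtain ⟨V, hV, hVs, hVc, hVconn⟩ := exists_compact_connected_nhds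
    (inter_mem (hpre L W hW (max K L) (le_max_right _ _)) (hpre K O hO (max K L) (le_max_left _ _)))
  refine ⟨f^[max K L] '' V, ?_, ?_, _, V, hV, hVc, hVconn, rfl⟩
  · rintro _ ⟨v, hv, rfl⟩
    exact ⟨_, (hVs hv).1, by
      rw [← Function.iterate_add_apply, Nat.add_sub_cancel' (le_max_right _ _)]⟩
  · rintro _ ⟨v, hv, rfl⟩
    exact ⟨_, (hVs hv).2, by
      rw [← Function.iterate_add_apply, Nat.add_sub_cancel' (le_max_left _ _)]⟩

theorem exists_subset_inter [T2Space G] [CompactSpace G] [LocallyConnectedSpace G]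
    (hf : Continuous f) (hys : ∀ n, f (ys (n + 1)) = ys n) {B₁ B₂ : Set G}
    (h₁ : IsBackwardNhd f ys B₁) (h₂ : IsBackwardNhd f ys B₂) :
    ∃ B' ⊆ B₁, B' ⊆ B₂ ∧ IsBackwardNhd f ys B' := by
  obtain ⟨K, V, hV, -, -, rfl⟩ := h₂
  exact h₁.exists_subset hf hys hV

end IsBackwardNhd

end BackwardOrbit

section INBackward

variable {G : Type*} [TopologicalSpace G] {f : G → G} {xs ys : ℕ → G}

theorem IsINPair.exists_return {x y : G} (h : IsINPair f x y) {V : Set G} (hV : V ∈ 𝓝 y) (T : ℕ) :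
    ∃ d ≥ T, (f^[d] '' V ∩ V).Nonempty := by
  obtain ⟨d, hd, _, -, hz⟩ := (isINPair_iff.1 h univ univ_mem V hV).exists_two_steps T
  obtain ⟨z, hz, hz', -⟩ := hz false false false
  exact ⟨d, hd, f^[d] z, ⟨z, hz, rfl⟩, hz'⟩

/-- Backward neighbourhoods return to themselves while visiting both points of an IN-pair. -/
theorem IsBackwardNhd.exists_return (hf : Continuous f) (hxs : ∀ n, f (xs (n + 1)) = xs n)
    (hys : ∀ n, f (ys (n + 1)) = ys n) (hIN : ∀ n, IsINPair f (xs n) (ys n)) {B : Set G}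
    (hB : IsBackwardNhd f ys B) {U W : Set G} (hU : U ∈ 𝓝 (xs 0)) (hW : W ∈ 𝓝 (ys 0)) (T : ℕ) :
    ∃ d ≥ T, (f^[d] '' B ∩ U).Nonempty ∧ (f^[d] '' B ∩ (B ∩ W)).Nonempty := by
  obtain ⟨K, V, hV, -, -, rfl⟩ := hB
  have hpre : ∀ {zs : ℕ → G}, (∀ n, f (zs (n + 1)) = zs n) → ∀ {O : Set G}, O ∈ 𝓝 (zs 0) →
      f^[K] ⁻¹' O ∈ 𝓝 (zs K) := by
    intro zs hzs O hO
    refine (hf.iterate K).continuousAt.preimage_mem_nhds ?_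
    rwa [iterate_backward_of_le hzs le_rfl, Nat.sub_self]
  obtain ⟨d, hd, _, -, hz⟩ := (isINPair_iff.1 (hIN K) _ (hpre hxs hU) _
    (inter_mem hV (hpre hys hW))).exists_two_steps T
  have hcomm : ∀ z, f^[d] (f^[K] z) = f^[K] (f^[d] z) := fun z => by
    rw [← Function.iterate_add_apply, add_comm, Function.iterate_add_apply]
  refine ⟨d, hd, ?_, ?_⟩
  · obtain ⟨z, hz, hz', -⟩ := hz false true true
    exact ⟨_, ⟨_, ⟨z, hz.1, rfl⟩, rfl⟩, by rw [hcomm]; exact hz'⟩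
  · obtain ⟨z, hz, hz', -⟩ := hz false false true
    exact ⟨_, ⟨_, ⟨z, hz.1, rfl⟩, rfl⟩, by rw [hcomm]; exact ⟨⟨_, hz'.1, rfl⟩, hz'.2⟩⟩

end INBackward

section Confinement

variable {G : Type*} [MetricSpace G] [CompactSpace G] [LocallyConnectedSpace G] {ι : Type}
  [Finite ι] {f : G → G} {xs ys : ℕ → G}

theorem EdgeSys.exists_backwardNhd_notMem (E : EdgeSys G ι) (hf : Continuous f)
    (hH : ¬ HasHorseshoe f) (hys : ∀ n, f (ys (n + 1)) = ys n)
    (hIN : ∀ n, IsINPair f (xs n) (ys n)) (hinj : Function.Injective ys) {p : G} {m : ℕ}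
    (hm : 1 ≤ m) (hp : f^[m] p = p) :
    ∃ B, IsBackwardNhd f ys B ∧ p ∉ closure (forwardOrbit f B) := by
  let P : Set G := (fun k => f^[k] p) '' Iio m
  have hPf : MapsTo f P P := by
    rintro _ ⟨k, hk, rfl⟩
    rcases Nat.lt_or_ge (k + 1) m with h | h
    · exact ⟨k + 1, h, Function.iterate_succ_apply' f k p⟩
    · have : k + 1 = m := le_antisymm hk h
      refine ⟨0, hm, ?_⟩
      change p = f (f^[k] p)
      rw [← Function.iterate_succ_apply' f k p, Nat.succ_eq_add_one, this, hp]
  obtain ⟨M, hM⟩ := E.exists_disjoint_closure_forwardOrbit hf hH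
    (P := P) ((finite_Iio m).image _) hPf
  obtain ⟨V₀, hV₀, hV⟩ := hM (ys M) (Finset.range M) (by simp) (by
    intro a ha b hb hab
    simp only [Finset.coe_range, mem_Iio] at ha hb
    simp only [iterate_backward_of_le hys ha.le, iterate_backward_of_le hys hb.le] at hab
    have := hinj hab
    omega)
  obtain ⟨V, hVn, hVV, hVc, hVconn⟩ := exists_compact_connected_nhds hV₀
  refine ⟨f^[M] '' V, ⟨M, V, hVn, hVc, hVconn, rfl⟩, fun hcl => ?_⟩
  refine Set.disjoint_left.1 (hV V hVV hVc hVconn fun T => (hIN M).exists_return hVn T)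
    (⟨0, hm, rfl⟩ : p ∈ P) (closure_mono ?_ hcl)
  refine iUnion_subset fun n => ?_
  rw [← image_comp, ← Function.iterate_add]
  exact image_subset_forwardOrbit f V _

theorem EdgeSys.exists_periodic_mem_image_backwardNhd (E : EdgeSys G ι) (hf : Continuous f)
    (hH : ¬ HasHorseshoe f) (hxs : ∀ n, f (xs (n + 1)) = xs n)
    (hys : ∀ n, f (ys (n + 1)) = ys n) (hne : xs 0 ≠ ys 0)
    (hIN : ∀ n, IsINPair f (xs n) (ys n)) (hinj : Function.Injective ys) {B : Set G}
    (hB : IsBackwardNhd f ys B) (T : ℕ) :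
    ∃ i ≥ T, ∃ p ∈ f^[i] '' B, ∃ m ≥ 1, f^[m] p = p := by
  obtain ⟨L, W, hW, -, -, rfl⟩ := hB
  obtain ⟨M, hM⟩ := E.exists_confining hf hH (P := ∅) finite_empty
  set K := L + M with hK
  obtain ⟨k, hk, i, a, b, ha, hb, hwk, -, V₀, hV₀, D₀, hV⟩ := hM (ys K) (Finset.range M) (by simp)
    (by
      intro a ha b hb hab
      simp only [Finset.coe_range, mem_Iio] at ha hb
      simp only [iterate_backward_of_le hys (show a ≤ K by omega),
        iterate_backward_of_le hys (show b ≤ K by omega)] at hab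
      have := hinj hab
      omega)
  have hkM := Finset.mem_range.1 hk
  have hφ := E.isEdge i
  set φ := E.φ i
  have hIcc : ∀ {s t : ℝ}, IsClosed (φ '' Icc s t) := (isCompact_Icc.image hφ.continuous).isClosed
  have hAφ : φ '' Ioo a b ⊆ φ '' Icc 0 1 :=
    image_mono (Ioo_subset_Icc_self.trans (Icc_subset_Icc ha hb))
  have hxk : f^[k] (xs K) ≠ f^[k] (ys K) := by
    intro heq
    apply hne
    have h1 := iterate_backward_of_le hxs (le_refl K)
    have h2 := iterate_backward_of_le hys (le_refl K)
    rw [Nat.sub_self] at h1 h2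
    rw [← h1, ← h2, ← Nat.sub_add_cancel (show k ≤ K by omega), Function.iterate_add_apply,
      Nat.sub_add_cancel (show k ≤ K by omega), heq, ← Function.iterate_add_apply,
      Nat.sub_add_cancel (show k ≤ K by omega)]
  -- a parameter separating `f^k(xs K)` from `f^k(ys K)` along the edge
  obtain ⟨m, hm⟩ : ∃ m, (f^[k] (xs K) ∉ φ '' Icc m 1 ∧ f^[k] (ys K) ∉ φ '' Icc 0 m) ∨
      (f^[k] (xs K) ∉ φ '' Icc 0 m ∧ f^[k] (ys K) ∉ φ '' Icc m 1) := by
    obtain ⟨t, ht, hty⟩ := hwk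
    rw [← hty]
    have ht0 : 0 < t := ha.trans_lt ht.1
    have ht1 : t < 1 := ht.2.trans_le hb
    have hout : ∀ u v s, 0 ≤ u → v ≤ 1 → 0 ≤ s → s ≤ 1 → s ∉ Icc u v → φ s ∉ φ '' Icc u v := by
      rintro u v s hu hv hs hs' hsn ⟨s', hs'', heq⟩
      have := hφ.eq_of_eq (s := s') (t := s) ⟨hu.trans hs''.1, hs''.2.trans hv⟩ ⟨hs, hs'⟩ heq
      exact hsn (this ▸ hs'')
    by_cases hx : f^[k] (xs K) ∈ φ '' Icc 0 1
    · obtain ⟨s, hs, hsx⟩ := hx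
      rw [← hsx]
      have hst : s ≠ t := by
        rintro rfl
        exact hxk (hsx.symm.trans hty)
      rcases lt_or_gt_of_ne hst with h | h
      · refine ⟨(s + t) / 2, Or.inl ⟨?_, ?_⟩⟩
        · exact hout _ _ _ (by linarith [hs.1]) le_rfl hs.1 hs.2 (by
            rintro ⟨h1, h2⟩; linarith)
        · exact hout _ _ _ le_rfl (by linarith) ht0.le ht1.le (by
            rintro ⟨h1, h2⟩; linarith)
      · refine ⟨(s + t) / 2, Or.inr ⟨?_, ?_⟩⟩
        · exact hout _ _ _ le_rfl (by linarith [hs.2]) hs.1 hs.2 (by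
            rintro ⟨h1, h2⟩; linarith)
        · exact hout _ _ _ (by linarith [hs.1]) le_rfl ht0.le ht1.le (by
            rintro ⟨h1, h2⟩; linarith)
    · refine ⟨t / 2, Or.inl ⟨fun h => hx (image_mono (Icc_subset_Icc_left (by linarith)) h), ?_⟩⟩
      exact hout _ _ _ le_rfl (by linarith) ht0.le ht1.le (by rintro ⟨h1, h2⟩; linarith)
  have hpre : ∀ {z : G} {O : Set G}, IsClosed O → f^[k] z ∉ O → f^[k] ⁻¹' Oᶜ ∈ 𝓝 z :=
    fun hO hz => (hf.iterate k).continuousAt.preimage_mem_nhds (hO.isOpen_compl.mem_nhds hz)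
  have hWK : f^[K - L] ⁻¹' W ∈ 𝓝 (ys K) := by
    refine (hf.iterate (K - L)).continuousAt.preimage_mem_nhds ?_
    rwa [iterate_backward_of_le hys (Nat.sub_le K L), Nat.sub_sub_self (by omega)]
  -- reduction to the two positions of `m`
  have main : ∀ C₁ C₂ : Set G, IsClosed C₁ → IsClosed C₂ → f^[k] (xs K) ∉ C₁ →
      f^[k] (ys K) ∉ C₂ → (∀ (g : G → G) (S : Set G) (a b : G), Continuous g → IsPreconnected S →
        S ⊆ φ '' Icc 0 1 → g '' S ⊆ φ '' Icc 0 1 → a ∈ S → b ∈ S → a ∉ C₁ → g a ∉ C₂ → b ∉ C₂ →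
        g b ∉ C₁ → ∃ p ∈ S, g p = p) →
      ∃ i ≥ T, ∃ p ∈ f^[i] '' (f^[L] '' W), ∃ m ≥ 1, f^[m] p = p := by
    intro C₁ C₂ hC₁ hC₂ hx hy hfix
    obtain ⟨V, hVn, hVs, hVc, hVconn⟩ := exists_compact_connected_nhds
      (inter_mem (inter_mem hV₀ hWK) (hpre hC₂ hy))
    obtain ⟨d₀, hd₀, d, hd, hz⟩ := (isINPair_iff.1 (hIN K) _ (hpre hC₁ hx) V hVn).exists_two_steps
      (T + K + D₀ + 1)
    have hV' := hV V (fun v hv => (hVs hv).1.1) hVc hVconn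
    have hcomm : ∀ d z, f^[d + k] z = f^[k] (f^[d] z) := fun d z => by
      rw [add_comm, Function.iterate_add_apply]
    have hret : (f^[d₀] '' V ∩ V).Nonempty := by
      obtain ⟨z, hz, hz', -⟩ := hz false false false
      exact ⟨_, ⟨z, hz, rfl⟩, hz'⟩
    have hret' : (f^[d₀ + d] '' V ∩ V).Nonempty := by
      obtain ⟨z, hz, -, hz'⟩ := hz false false false
      exact ⟨_, ⟨z, hz, rfl⟩, hz'⟩
    obtain ⟨u, hu, hu₁, hu₂⟩ := hz false true false
    obtain ⟨v, hv, hv₁, hv₂⟩ := hz false false true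
    have hstep : ∀ z, f^[d] (f^[d₀ + k] z) = f^[d₀ + d + k] z := fun z => by
      rw [← Function.iterate_add_apply]
      congr 1
      omega
    have hgS : f^[d] '' (f^[d₀ + k] '' V) = f^[d₀ + d + k] '' V := by
      rw [image_image]
      exact image_congr fun z _ => hstep z
    obtain ⟨p, ⟨q, hq, rfl⟩, hp⟩ := hfix f^[d] (f^[d₀ + k] '' V) (f^[d₀ + k] u) (f^[d₀ + k] v)
      (hf.iterate d) (hVconn.isPreconnected.image _ (hf.iterate _).continuousOn)
      ((hV' d₀ (by omega) hret).trans hAφ)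
      (hgS ▸ (hV' (d₀ + d) (by omega) hret').trans hAφ) ⟨u, hu, rfl⟩ ⟨v, hv, rfl⟩
      (by rw [hcomm]; exact hu₁) (by rw [hstep, hcomm]; exact (hVs hu₂).2)
      (by rw [hcomm]; exact (hVs hv₁).2) (by rw [hstep, hcomm]; exact hv₂)
    refine ⟨d₀ + k - K, by omega, f^[d₀ + k] q, ⟨_, ⟨_, (hVs hq).1.2, rfl⟩, ?_⟩, d, by omega, hp⟩
    rw [← Function.iterate_add_apply, ← Function.iterate_add_apply]
    congr 1
    omega
  rcases hm with ⟨h1, h2⟩ | ⟨h1, h2⟩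
  · exact main _ _ hIcc hIcc h1 h2 fun g S a b hg hS hSφ hgS ha hb h1 h2 h3 h4 =>
      hφ.exists_fixed hg hS hSφ hgS ha hb h1 h2 h3 h4
  · exact main _ _ hIcc hIcc h1 h2 fun g S a b hg hS hSφ hgS ha hb h1 h2 h3 h4 =>
      hφ.exists_fixed hg hS hSφ hgS hb ha h3 h4 h1 h2

end Confinement

/-- `k` is the smallest positive return time of `D` to itself, and divides all of them. -/
def IsReturnPeriod {G : Type*} (f : G → G) (D : Set G) (k : ℕ) : Prop :=
  1 ≤ k ∧ (f^[k] '' D ∩ D).Nonempty ∧ ∀ d, (f^[d] '' D ∩ D).Nonempty → k ∣ d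

section ReturnPeriod

variable {G : Type*} {f : G → G} {D D' : Set G} {k k' : ℕ}

theorem exists_isReturnPeriod (hD : ∀ d, (f^[d] '' D ∩ D).Nonempty → f^[d] '' D ⊆ D)
    (hret : ∃ e ≥ 1, (f^[e] '' D ∩ D).Nonempty) : ∃ k, IsReturnPeriod f D k := by
  classical
  obtain ⟨h1, hne⟩ := Nat.find_spec hret
  set k := Nat.find hret
  have hmul : ∀ q, MapsTo f^[k * q] D D := fun q => by
    rw [Function.iterate_mul]
    exact (mapsTo_iff_image_subset.2 (hD k hne)).iterate q
  refine ⟨k, h1, hne, fun d hd => ?_⟩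
  rw [Nat.dvd_iff_mod_eq_zero]
  by_contra h0
  have hlt : d % k < k := Nat.mod_lt _ h1
  refine Nat.find_min hret hlt ⟨Nat.pos_of_ne_zero h0, ?_⟩
  obtain ⟨_, ⟨z, hz, rfl⟩, -⟩ := hne
  refine ⟨f^[d] z, ⟨f^[k * (d / k)] z, hmul _ hz, ?_⟩, hD d hd ⟨z, hz, rfl⟩⟩
  rw [← Function.iterate_add_apply, Nat.mod_add_div]

theorem IsReturnPeriod.le_of_subset (h : IsReturnPeriod f D k) (h' : IsReturnPeriod f D' k')
    (hDD : D' ⊆ D) : k ≤ k' :=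
  Nat.le_of_dvd h'.1 (h.2.2 k' (h'.2.1.mono (inter_subset_inter (image_mono hDD) hDD)))

theorem IsReturnPeriod.disjoint (h : IsReturnPeriod f D k) (hD : f^[k] '' D ⊆ D) {i j : ℕ}
    (hi : i < k) (hj : j < k) (hij : i ≠ j) : Disjoint (f^[i] '' D) (f^[j] '' D) := by
  wlog hlt : i < j generalizing i j
  · exact (this hj hi hij.symm (by omega)).symm
  rw [Set.disjoint_left]
  rintro _ ⟨u, hu, rfl⟩ ⟨v, hv, hvu⟩
  have : k ∣ k - i + j := h.2.2 _ ⟨f^[k] u, ⟨v, hv, by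
    rw [Function.iterate_add_apply, hvu, ← Function.iterate_add_apply,
      Nat.sub_add_cancel hi.le]⟩, hD ⟨u, hu, rfl⟩⟩
  have h2 : k ∣ j - i := by
    rw [show k - i + j = k + (j - i) by omega] at this
    exact (Nat.dvd_add_right (dvd_refl k)).1 this
  have := Nat.le_of_dvd (by omega) h2
  omega

end ReturnPeriod

/-- The component containing `y` of the closed invariant set generated by `B`. -/
def orbitComponent {G : Type*} [TopologicalSpace G] (f : G → G) (y : G) (B : Set G) : Set G :=
  connectedComponentIn (closure (forwardOrbit f B)) y

section OrbitComponent

variable {G : Type*} [TopologicalSpace G] {f : G → G} {y : G} {B : Set G}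

theorem mapsTo_closure_forwardOrbit (hf : Continuous f) (B : Set G) (n : ℕ) :
    f^[n] '' closure (forwardOrbit f B) ⊆ closure (forwardOrbit f B) :=
  (image_closure_subset_closure_image (hf.iterate n)).trans
    (closure_mono (image_forwardOrbit_subset f B n))

theorem IsPreconnected.subset_orbitComponent (hf : Continuous f) {n : ℕ} {S : Set G}
    (hS : IsPreconnected S) (hSD : (S ∩ orbitComponent f y B).Nonempty)
    (hSn : S ⊆ f^[n] '' closure (forwardOrbit f B)) : S ⊆ orbitComponent f y B := by
  obtain ⟨z, hz, hzD⟩ := hSD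
  rw [orbitComponent, connectedComponentIn_eq hzD]
  exact hS.subset_connectedComponentIn hz (hSn.trans (mapsTo_closure_forwardOrbit hf B n))

theorem subset_orbitComponent (hB : IsPreconnected B) (hy : y ∈ B) : B ⊆ orbitComponent f y B :=
  hB.subset_connectedComponentIn hy ((subset_forwardOrbit f B).trans subset_closure)

theorem image_orbitComponent_subset (hf : Continuous f) (d : ℕ)
    (h : (f^[d] '' orbitComponent f y B ∩ orbitComponent f y B).Nonempty) :
    f^[d] '' orbitComponent f y B ⊆ orbitComponent f y B :=
  (isPreconnected_connectedComponentIn.image _ (hf.iterate d).continuousOn).subset_orbitComponent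
    hf h (image_mono (connectedComponentIn_subset _ _))

theorem isClosed_orbitComponent : IsClosed (orbitComponent f y B) := by
  by_cases hy : y ∈ closure (forwardOrbit f B)
  · refine isClosed_of_closure_subset ?_
    refine isPreconnected_connectedComponentIn.closure.subset_connectedComponentIn
      (subset_closure (mem_connectedComponentIn hy)) ?_
    exact closure_minimal (connectedComponentIn_subset _ _) isClosed_closure
  · rw [orbitComponent, connectedComponentIn_eq_empty hy]
    exact isClosed_empty

theorem orbitComponent_mono {B' : Set G} (h : B' ⊆ B) :
    orbitComponent f y B' ⊆ orbitComponent f y B :=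
  connectedComponentIn_mono y (closure_mono (forwardOrbit_mono h))

end OrbitComponent

section PeriodicContinuum

variable {G : Type*} [MetricSpace G] [CompactSpace G] [LocallyConnectedSpace G] {ι : Type}
  [Finite ι] {f : G → G} {xs ys : ℕ → G}

theorem EdgeSys.exists_isReturnPeriod_ge (E : EdgeSys G ι) (hf : Continuous f)
    (hH : ¬ HasHorseshoe f) (hxs : ∀ n, f (xs (n + 1)) = xs n)
    (hys : ∀ n, f (ys (n + 1)) = ys n) (hne : xs 0 ≠ ys 0)
    (hIN : ∀ n, IsINPair f (xs n) (ys n)) (hinj : Function.Injective ys) (N : ℕ) :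
    ∃ B k, IsBackwardNhd f ys B ∧ N ≤ k ∧ IsReturnPeriod f (orbitComponent f (ys 0) B) k := by
  classical
  by_contra! hcon
  have hBD : ∀ {B}, IsBackwardNhd f ys B → B ⊆ orbitComponent f (ys 0) B := fun hB =>
    subset_orbitComponent (hB.isConnected hf).isPreconnected (hB.mem hys)
  have hper : ∀ B, IsBackwardNhd f ys B → ∃ k, IsReturnPeriod f (orbitComponent f (ys 0) B) k := by
    intro B hB
    refine exists_isReturnPeriod (image_orbitComponent_subset hf) ?_
    obtain ⟨e, he, -, h⟩ := hB.exists_return hf hxs hys hIN univ_mem univ_mem 1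
    exact ⟨e, he, h.mono (inter_subset_inter (image_mono (hBD hB))
      (inter_subset_left.trans (hBD hB)))⟩
  choose! κ hκ using hper
  have hB0 : ∃ B, IsBackwardNhd f ys B := by
    obtain ⟨V, hV, -, hVc, hVconn⟩ := exists_compact_connected_nhds (univ_mem : univ ∈ 𝓝 (ys 0))
    exact ⟨V, 0, V, hV, hVc, hVconn, by simp⟩
  have hbd : ∀ B, IsBackwardNhd f ys B → κ B < N := fun B hB => by
    by_contra! h
    exact hcon B (κ B) hB h (hκ B hB)
  -- choose a backward neighbourhood with the largest return period
  obtain ⟨Bm, hBm, hmax⟩ : ∃ Bm, IsBackwardNhd f ys Bm ∧ ∀ B, IsBackwardNhd f ys B →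
      κ B ≤ κ Bm := by
    let S : Set ℕ := κ '' {B | IsBackwardNhd f ys B}
    have hSf : S.Finite := (finite_Iio N).subset (by rintro _ ⟨B, hB, rfl⟩; exact hbd B hB)
    obtain ⟨B₀, hB₀⟩ := hB0
    obtain ⟨_, ⟨Bm, hBm, rfl⟩, hm⟩ := hSf.exists_maximal ⟨κ B₀, B₀, hB₀, rfl⟩
    refine ⟨Bm, hBm, fun B hB => ?_⟩
    by_contra! hlt
    exact absurd (hm ⟨B, hB, rfl⟩ hlt.le) (not_le.2 hlt)
  set k := κ Bm
  have hk1 : 1 ≤ k := (hκ Bm hBm).1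
  have hκk : ∀ B, IsBackwardNhd f ys B → B ⊆ Bm → κ B = k := fun B hB hBB =>
    le_antisymm (hmax B hB) ((hκ Bm hBm).le_of_subset (hκ B hB) (orbitComponent_mono hBB))
  have hyD : ∀ B, IsBackwardNhd f ys B → B ⊆ Bm → ∀ n,
      f^[k * n] (ys 0) ∈ orbitComponent f (ys 0) B := by
    intro B hB hBB n
    have h1 := (hκ B hB).2.1
    rw [hκk B hB hBB] at h1
    rw [Function.iterate_mul]
    exact (mapsTo_iff_image_subset.2 (image_orbitComponent_subset hf k h1)).iterate n
      (hBD hB (hB.mem hys))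
  have hyinj : Function.Injective fun n => f^[k * n] (ys 0) := by
    have key : ∀ m n, m < n → f^[k * m] (ys 0) ≠ f^[k * n] (ys 0) := by
      intro m n hmn heq
      obtain ⟨B, hB, hp⟩ := E.exists_backwardNhd_notMem hf hH hys hIN hinj
        (p := f^[k * m] (ys 0)) (m := k * n - k * m)
        (Nat.sub_pos_of_lt (Nat.mul_lt_mul_of_pos_left hmn hk1))
        (by rw [← Function.iterate_add_apply,
              Nat.sub_add_cancel (Nat.mul_le_mul_left k hmn.le), ← heq])
      exact hp (subset_closure (image_subset_forwardOrbit f B _ ⟨_, hB.mem hys, rfl⟩))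
    intro m n h
    rcases lt_trichotomy m n with hmn | hmn | hmn
    · exact absurd h (key m n hmn)
    · exact hmn
    · exact absurd h.symm (key n m hmn)
  -- an open arc around some `f^(kn)(ys 0)` contained in all components
  obtain ⟨A, n, hA, hAD⟩ : ∃ A n, A ∈ 𝓝 (f^[k * n] (ys 0)) ∧
      ∀ B, IsBackwardNhd f ys B → B ⊆ Bm → A ⊆ orbitComponent f (ys 0) B := by
    obtain ⟨M, hM⟩ := E.exists_arc 5 (P := ∅) finite_empty
    obtain ⟨i, t, ht, hmem, -⟩ := hM ((Finset.range M).image fun n => f^[k * n] (ys 0))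
      (by rw [Finset.card_image_of_injective _ hyinj, Finset.card_range])
    have hex : ∀ j < 5, ∃ n, f^[k * n] (ys 0) = E.φ i (t j) := fun j hj => by
      obtain ⟨n, -, hn⟩ := Finset.mem_image.1 (hmem j hj).2
      exact ⟨n, hn⟩
    have h0 := (hmem 0 (by norm_num)).1
    have h4 := (hmem 4 (by norm_num)).1
    have h01 := ht 0 1 (by norm_num) (by norm_num)
    have h12 := ht 1 2 (by norm_num) (by norm_num)
    have h23 := ht 2 3 (by norm_num) (by norm_num)
    have h34 := ht 3 4 (by norm_num) (by norm_num)
    have htD : ∀ B, IsBackwardNhd f ys B → B ⊆ Bm → ∀ j < 5,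
        E.φ i (t j) ∈ orbitComponent f (ys 0) B := by
      intro B hB hBB j hj
      obtain ⟨n, hn⟩ := hex j hj
      rw [← hn]
      exact hyD B hB hBB n
    have hdich : ∀ B, IsBackwardNhd f ys B → B ⊆ Bm →
        E.φ i '' Ioo (t 0) (t 2) ⊆ orbitComponent f (ys 0) B ∨
        E.φ i '' Ioo (t 2) (t 4) ⊆ orbitComponent f (ys 0) B := by
      intro B hB hBB
      by_contra! hnot
      obtain ⟨h1, h2⟩ := hnot
      rw [image_subset_iff, not_subset] at h1 h2
      obtain ⟨s, hs, hsD⟩ := h1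
      obtain ⟨s', hs', hsD'⟩ := h2
      have hsub := (E.isEdge i).subset_image_Ioo_of_notMem
        (isPreconnected_connectedComponentIn (F := closure (forwardOrbit f B)) (x := ys 0))
        (a := s) (b := s') (by linarith [hs.1, h0.1]) (by linarith [hs'.2, h4.2])
        ⟨_, htD B hB hBB 2 (by norm_num), t 2, ⟨hs.2, hs'.1⟩, rfl⟩ hsD hsD'
      obtain ⟨r, hr, hr0⟩ := hsub (htD B hB hBB 0 (by norm_num))
      have := (E.isEdge i).eq_of_eq (s := r) (t := t 0)
        ⟨by linarith [hr.1, hs.1, h0.1], by linarith [hr.2, hs'.2, h4.2]⟩ ⟨h0.1.le, h0.2.le⟩ hr0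
      linarith [hr.1, hs.1]
    by_cases hall : ∀ B, IsBackwardNhd f ys B → B ⊆ Bm →
        E.φ i '' Ioo (t 0) (t 2) ⊆ orbitComponent f (ys 0) B
    · obtain ⟨n, hn⟩ := hex 1 (by norm_num)
      exact ⟨_, n, hn ▸ (E.isEdge i).image_Ioo_mem_nhds h0.1.le (by linarith [h4.2]) ⟨h01, h12⟩,
        hall⟩
    · push Not at hall
      obtain ⟨B₁, hB₁, hBB₁, hnot⟩ := hall
      obtain ⟨n, hn⟩ := hex 3 (by norm_num)
      refine ⟨_, n, hn ▸ (E.isEdge i).image_Ioo_mem_nhds (by linarith [h0.1]) h4.2.le ⟨h23, h34⟩,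
        fun B hB hBB => ?_⟩
      obtain ⟨B', hB'B, hB'₁, hB'⟩ := hB.exists_subset_inter hf hys hB₁
      refine ((hdich B' hB' (hB'B.trans hBB)).resolve_left fun h => hnot ?_).trans
        (orbitComponent_mono hB'B)
      exact h.trans (orbitComponent_mono hB'₁)
  obtain ⟨B₁, -, hB₁O, hB₁⟩ := hBm.exists_subset hf hys (K := 0)
    ((hf.iterate (k * n)).continuousAt.preimage_mem_nhds hA)
  rw [Function.iterate_zero, image_id] at hB₁O
  obtain ⟨j, hj, _, ⟨b, hb, rfl⟩, m, hm, hmp⟩ := E.exists_periodic_mem_image_backwardNhd hf hH hxs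
    hys hne hIN hinj hB₁ (k * n)
  obtain ⟨B₂, hB₂, hpB₂⟩ := E.exists_backwardNhd_notMem hf hH hys hIN hinj hm hmp
  obtain ⟨B₃, hB₃m, hB₃₂, hB₃⟩ := hBm.exists_subset_inter hf hys hB₂
  refine hpB₂ (closure_mono (forwardOrbit_mono hB₃₂) ?_)
  refine mapsTo_closure_forwardOrbit hf B₃ (j - k * n) ⟨f^[k * n] b,
    connectedComponentIn_subset _ _ (hAD B₃ hB₃ hB₃m (hB₁O hb)), ?_⟩
  rw [← Function.iterate_add_apply, Nat.sub_add_cancel hj]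

theorem EdgeSys.exists_periodic_continuum (E : EdgeSys G ι) (hf : Continuous f)
    (hH : ¬ HasHorseshoe f) (hxs : ∀ n, f (xs (n + 1)) = xs n)
    (hys : ∀ n, f (ys (n + 1)) = ys n) (hne : xs 0 ≠ ys 0)
    (hIN : ∀ n, IsINPair f (xs n) (ys n)) (hinj : Function.Injective ys) (N : ℕ) :
    ∃ K k, N ≤ k ∧ 1 ≤ k ∧ IsClosed K ∧ IsConnected K ∧ f^[k] '' K = K ∧
      (∀ i j, i < k → j < k → i ≠ j → Disjoint (f^[i] '' K) (f^[j] '' K)) ∧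
      xs 0 ∈ K ∧ ys 0 ∈ K := by
  obtain ⟨B, k, hB, hkN, hk⟩ := E.exists_isReturnPeriod_ge hf hH hxs hys hne hIN hinj N
  set D := orbitComponent f (ys 0) B
  have hBD : B ⊆ D := subset_orbitComponent (hB.isConnected hf).isPreconnected (hB.mem hys)
  have hDc : IsClosed D := isClosed_orbitComponent
  have hDp : IsPreconnected D := isPreconnected_connectedComponentIn
  have hkD : f^[k] '' D ⊆ D := image_orbitComponent_subset hf k hk.2.1
  obtain ⟨hanti, heq⟩ := image_iInter_iterate_eq (hf.iterate k) hDc hkD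
  have hcl : ∀ n, IsClosed ((f^[k])^[n] '' D) := fun n =>
    (hDc.isCompact.image ((hf.iterate k).iterate n)).isClosed
  have hmem : ∀ z, (∀ U ∈ 𝓝 z, ∀ T, ∃ d ≥ T, (f^[d] '' B ∩ U).Nonempty ∧
      (f^[d] '' B ∩ B).Nonempty) → z ∈ ⋂ n, (f^[k])^[n] '' D := by
    intro z hz
    refine mem_iInter.2 fun n => ?_
    rw [← (hcl n).closure_eq, mem_closure_iff_nhds]
    intro U hU
    obtain ⟨d, hd, ⟨_, ⟨b, hb, rfl⟩, hbU⟩, hret⟩ := hz U hU (k * n)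
    obtain ⟨q, rfl⟩ := hk.2.2 d (hret.mono (inter_subset_inter (image_mono hBD) hBD))
    refine ⟨_, hbU, ?_⟩
    have hnq : n ≤ q := Nat.le_of_mul_le_mul_left hd hk.1
    refine hanti hnq ⟨b, hBD hb, ?_⟩
    rw [Function.iterate_mul]
  refine ⟨⋂ n, (f^[k])^[n] '' D, k, hkN, hk.1, isClosed_iInter hcl, ⟨⟨ys 0, ?_⟩, ?_⟩, heq, ?_, ?_, ?_⟩
  rotate_left 1
  · exact isPreconnected_iInter_of_antitone hanti hcl fun n =>
      hDp.image _ ((hf.iterate k).iterate n).continuousOn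
  · intro i j hi hj hij
    have hsub : (⋂ n, (f^[k])^[n] '' D) ⊆ D := (iInter_subset _ 0).trans (by simp)
    exact (hk.disjoint hkD hi hj hij).mono (image_mono hsub) (image_mono hsub)
  · refine hmem _ fun U hU T => ?_
    obtain ⟨d, hd, h1, h2⟩ := hB.exists_return hf hxs hys hIN hU univ_mem T
    exact ⟨d, hd, h1, h2.mono (inter_subset_inter_right _ inter_subset_left)⟩
  all_goals
    refine hmem _ fun U hU T => ?_
    obtain ⟨d, hd, -, h2⟩ := hB.exists_return hf hxs hys hIN univ_mem hU T
    exact ⟨d, hd, h2.mono (inter_subset_inter_right _ inter_subset_right),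
      h2.mono (inter_subset_inter_right _ inter_subset_left)⟩

end PeriodicContinuum

/-- Points arbitrarily close to `w` come arbitrarily close to `x` and then return to `w`. -/
def ReturnsVia {G : Type*} [TopologicalSpace G] (f : G → G) (w x : G) : Prop :=
  ∀ W ∈ 𝓝 w, ∀ U ∈ 𝓝 x, ∃ b ∈ W, ∃ n s, f^[n] b ∈ U ∧ f^[s] (f^[n] b) ∈ W

theorem ReturnsVia.iterate {G : Type*} [TopologicalSpace G] {f : G → G} (hf : Continuous f)
    {w x : G} (h : ReturnsVia f w x) (hx : f x = x) (K : ℕ) : ReturnsVia f (f^[K] w) x := by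
  intro W hW U hU
  obtain ⟨b, hb, n, s, hn, hs⟩ := h _ ((hf.iterate K).continuousAt.preimage_mem_nhds hW)
    (f^[K] ⁻¹' U) ((hf.iterate K).continuousAt.preimage_mem_nhds (by
      rwa [Function.iterate_fixed hx]))
  have hc : ∀ m z, f^[m] (f^[K] z) = f^[K] (f^[m] z) := fun m z => by
    rw [← Function.iterate_add_apply, add_comm, Function.iterate_add_apply]
  exact ⟨_, hb, n, s, by rw [hc]; exact hn, by rw [hc, hc]; exact hs⟩

theorem ReturnsVia.exists_return {G : Type*} [TopologicalSpace G] [T2Space G] {f : G → G}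
    (hf : Continuous f) {w x : G} (h : ReturnsVia f w x) (hx : f x = x) {V : Set G}
    (hV : V ∈ 𝓝 w) (hVc : IsClosed V) (hxV : x ∉ V) (T : ℕ) :
    ∃ d ≥ T, (f^[d] '' V ∩ V).Nonempty := by
  have hU : (⋂ j ∈ Iio T, f^[j] ⁻¹' Vᶜ) ∈ 𝓝 x := by
    refine (biInter_mem (finite_Iio T)).2 fun j _ => ?_
    refine (hf.iterate j).continuousAt.preimage_mem_nhds ?_
    rw [Function.iterate_fixed hx]
    exact hVc.isOpen_compl.mem_nhds hxV
  obtain ⟨b, hb, n, s, hn, hs⟩ := h V hV _ hU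
  have hsT : T ≤ s := by
    by_contra hlt
    exact mem_iInter₂.1 hn s (not_le.1 hlt) hs
  exact ⟨s + n, by omega, _, ⟨b, hb, rfl⟩, by rwa [Function.iterate_add_apply]⟩

section Periodic

variable {G : Type*} [MetricSpace G] [CompactSpace G] {f : G → G} {x y : G}

theorem IsINPair.exists_almost_return (hf : Continuous f) (hx : f x = x) (h : IsINPair f x y)
    {ρ : ℝ} (hρ : 0 < ρ) (hρy : ρ < dist y x) (K : ℕ) {δ : ℝ} (hδ : 0 < δ) :
    ∃ w, (∀ k < K, dist (f^[k] w) x ≤ ρ) ∧ ρ ≤ dist (f^[K] w) x ∧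
      ∃ n s, dist (f^[n] w) x < δ ∧ dist (f^[s] (f^[n] w)) w < δ := by
  obtain ⟨c, -, hcfin, hc⟩ := finite_cover_balls_of_compact (isCompact_univ (X := G)) (half_pos hδ)
  have hU : (⋂ k ∈ Iic K, f^[k] ⁻¹' Metric.ball x (min ρ δ)) ∈ 𝓝 x := by
    refine (biInter_mem (finite_Iic K)).2 fun j _ => ?_
    refine (hf.iterate j).continuousAt.preimage_mem_nhds ?_
    rw [Function.iterate_fixed hx]
    exact Metric.ball_mem_nhds x (lt_min hρ hδ)
  have hV : {z | ρ < dist z x} ∈ 𝓝 y :=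
    (isOpen_lt continuous_const (continuous_id.dist continuous_const)).mem_nhds hρy
  set m := hcfin.toFinset.card
  obtain ⟨t, ht, hS⟩ := (isINPair_iff.1 h _ hU _ hV).exists_times (2 * (m + 1))
  obtain ⟨p, hp⟩ := hS fun k => k % 2 = 0
  have hpU : ∀ i ≤ m, ∀ k ≤ K, dist (f^[k + t (2 * i)] p) x < min ρ δ := by
    intro i hi k hk
    have := hp (2 * i) (by omega)
    simp only [Nat.mul_mod_right, decide_true, if_true] at this
    rw [Function.iterate_add_apply]
    exact mem_iInter₂.1 this k hk
  have hpV : ∀ i ≤ m, ρ < dist (f^[t (2 * i + 1)] p) x := by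
    intro i hi
    have := hp (2 * i + 1) (by omega)
    rw [if_neg (by simp)] at this
    exact this
  have hex : ∀ i ≤ m, ∃ τ, t (2 * i) + K < τ ∧ τ ≤ t (2 * i + 1) ∧
      ρ ≤ dist (f^[τ] p) x ∧ ∀ j, t (2 * i) ≤ j → j < τ → dist (f^[j] p) x ≤ ρ := by
    classical
    intro i hi
    have hlt : t (2 * i) < t (2 * i + 1) := ht _ _ (by omega) (by omega)
    have he : ∃ τ, t (2 * i) ≤ τ ∧ ρ ≤ dist (f^[τ] p) x := ⟨_, hlt.le, (hpV i hi).le⟩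
    refine ⟨Nat.find he, ?_, Nat.find_min' he ⟨hlt.le, (hpV i hi).le⟩, (Nat.find_spec he).2, ?_⟩
    · by_contra hle
      have h1 := Nat.find_spec he
      have h2 := hpU i hi (Nat.find he - t (2 * i)) (by omega)
      rw [Nat.sub_add_cancel h1.1] at h2
      exact absurd h1.2 (not_le.2 (h2.trans_le (min_le_left _ _)))
    · intro j hj hjlt
      by_contra hgt
      exact Nat.find_min he hjlt ⟨hj, (not_le.1 hgt).le⟩
  choose! τ hτ₁ hτ₂ hτ₃ hτ₄ using hex
  have hcov : ∀ z, ∃ a ∈ hcfin.toFinset, dist z a < δ / 2 := by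
    intro z
    obtain ⟨a, ha, hz⟩ := mem_iUnion₂.1 (hc (mem_univ z))
    exact ⟨a, hcfin.mem_toFinset.2 ha, hz⟩
  choose g hg hgd using hcov
  obtain ⟨i, hi, j, hj, hij, hgij⟩ := Finset.exists_ne_map_eq_of_card_lt_of_maps_to
    (s := Finset.range (m + 1)) (t := hcfin.toFinset) (by simp [m])
    (f := fun i => g (f^[τ i - K] p)) (fun i _ => hg _)
  simp only [Finset.mem_range, Nat.lt_succ_iff] at hi hj
  have main : ∀ i j, i < j → j ≤ m → g (f^[τ i - K] p) = g (f^[τ j - K] p) →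
      ∃ w, (∀ k < K, dist (f^[k] w) x ≤ ρ) ∧ ρ ≤ dist (f^[K] w) x ∧
      ∃ n s, dist (f^[n] w) x < δ ∧ dist (f^[s] (f^[n] w)) w < δ := by
    intro i j hij hj hgij
    have hi : i ≤ m := hij.le.trans hj
    have h1 := hτ₁ i hi
    have h2 := hτ₂ i hi
    have h3 := hτ₁ j hj
    have h4 : t (2 * i + 1) < t (2 * j) := ht _ _ (by omega) (by omega)
    have e1 : f^[t (2 * j) - (τ i - K)] (f^[τ i - K] p) = f^[t (2 * j)] p := by
      rw [← Function.iterate_add_apply, Nat.sub_add_cancel (by omega)]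
    refine ⟨f^[τ i - K] p, fun k hk => ?_, ?_, t (2 * j) - (τ i - K), τ j - K - t (2 * j), ?_, ?_⟩
    · rw [← Function.iterate_add_apply]
      exact hτ₄ i hi _ (by omega) (by omega)
    · rw [← Function.iterate_add_apply, Nat.add_sub_cancel' (by omega)]
      exact hτ₃ i hi
    · rw [e1]
      simpa using (hpU j hj 0 (Nat.zero_le _)).trans_le (min_le_right _ _)
    · rw [e1, ← Function.iterate_add_apply, Nat.sub_add_cancel (by omega)]
      have ha := hgd (f^[τ j - K] p)
      have hb := hgd (f^[τ i - K] p)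
      rw [hgij] at hb
      calc _ ≤ _ := dist_triangle_right _ _ (g (f^[τ j - K] p))
        _ < δ := by linarith
  rcases lt_or_gt_of_ne hij with h | h
  · exact main i j h hj hgij
  · exact main j i h hi hgij.symm

theorem IsINPair.exists_returnsVia (hf : Continuous f) (hx : f x = x) (h : IsINPair f x y)
    {ρ : ℝ} (hρ : 0 < ρ) (hρy : ρ < dist y x) (K : ℕ) :
    ∃ w, (∀ k < K, dist (f^[k] w) x ≤ ρ) ∧ ρ ≤ dist (f^[K] w) x ∧ ReturnsVia f w x := by
  choose w hw₁ hw₂ n s hn hs using fun j : ℕ =>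
    h.exists_almost_return hf hx hρ hρy K (Nat.one_div_pos_of_nat (α := ℝ) (n := j))
  obtain ⟨z, -, g, hg, hgz⟩ := isCompact_univ.tendsto_subseq (x := w) fun _ => mem_univ _
  have hd : ∀ k, Tendsto (fun j => dist (f^[k] (w (g j))) x) atTop (𝓝 (dist (f^[k] z) x)) :=
    fun k => (((hf.iterate k).tendsto z).comp hgz).dist tendsto_const_nhds
  have h0 : Tendsto (fun j => 1 / ((g j : ℝ) + 1)) atTop (𝓝 0) :=
    (tendsto_one_div_add_atTop_nhds_zero_nat (𝕜 := ℝ)).comp hg.tendsto_atTop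
  refine ⟨z, fun k hk => le_of_tendsto' (hd k) fun j => hw₁ _ k hk,
    ge_of_tendsto' (hd K) fun j => hw₂ _, fun W hW U hU => ?_⟩
  have h1 : Tendsto (fun j => f^[n (g j)] (w (g j))) atTop (𝓝 x) :=
    tendsto_iff_dist_tendsto_zero.2
      (squeeze_zero (fun _ => dist_nonneg) (fun j => (hn (g j)).le) h0)
  have h2 : Tendsto (fun j => f^[s (g j)] (f^[n (g j)] (w (g j)))) atTop (𝓝 z) := by
    rw [tendsto_iff_dist_tendsto_zero] at hgz ⊢
    have := h0.add hgz
    rw [add_zero] at this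
    refine squeeze_zero (fun _ => dist_nonneg) (fun j => ?_) this
    exact (dist_triangle _ (w (g j)) _).trans (add_le_add_left (hs (g j)).le _)
  obtain ⟨j, hj₁, hj₂, hj₃⟩ :=
    ((h1.eventually hU).and ((h2.eventually hW).and (hgz.eventually hW))).exists
  exact ⟨_, hj₃, _, _, hj₁, hj₂⟩

theorem EdgeSys.exists_periodic_returnsVia [LocallyConnectedSpace G] {ι : Type} [Finite ι]
    (E : EdgeSys G ι) (hf : Continuous f) (hH : ¬ HasHorseshoe f) (hx : f x = x)
    (h : IsINPair f x y) {ρ : ℝ} (hρ : 0 < ρ) (hρy : ρ < dist y x) :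
    ∃ q, dist q x = ρ ∧ (∃ m ≥ 1, f^[m] q = q) ∧ ReturnsVia f q x := by
  obtain ⟨K, hK⟩ := E.exists_disjoint_closure_forwardOrbit hf hH (finite_singleton x)
    (mapsTo_singleton.2 hx)
  obtain ⟨w, hw₁, hw₂, hw₃⟩ := h.exists_returnsVia hf hx hρ hρy K
  have hwx : w ≠ x := by
    rintro rfl
    rw [Function.iterate_fixed hx, dist_self] at hw₂
    exact absurd hρ (not_lt.2 hw₂)
  have hninj : ¬ InjOn (fun k => f^[k] w) (Finset.range (K + 1)) := by
    intro hinj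
    obtain ⟨V₀, hV₀, hV⟩ := hK w _ (by simp) hinj
    obtain ⟨V, hVn, hVV, hVc, hVconn⟩ :=
      exists_compact_connected_nhds (inter_mem hV₀ (isOpen_ne.mem_nhds hwx))
    have hxV : x ∉ V := fun hxV => (hVV hxV).2 rfl
    refine Set.disjoint_left.1 (hV V (hVV.trans inter_subset_left) hVc hVconn fun T =>
      hw₃.exists_return hf hx hVn hVc.isClosed hxV T) (mem_singleton x) ?_
    refine mem_closure_iff_nhds.2 fun U hU => ?_
    obtain ⟨b, hb, n, -, hn, -⟩ := hw₃ V hVn U hU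
    exact ⟨_, hn, image_subset_forwardOrbit f V n ⟨b, hb, rfl⟩⟩
  obtain ⟨a, b, hab, hb, heq⟩ : ∃ a b, a < b ∧ b ≤ K ∧ f^[a] w = f^[b] w := by
    simp only [InjOn, Finset.coe_range, mem_Iio, Nat.lt_succ_iff] at hninj
    push Not at hninj
    obtain ⟨a, ha, b, hb, heq, hne⟩ := hninj
    rcases lt_or_gt_of_ne hne with h | h
    · exact ⟨a, b, h, hb, heq⟩
    · exact ⟨b, a, h, ha, heq.symm⟩
  have hqe : f^[K] w = f^[K - (b - a)] w := by
    rw [← Nat.sub_add_cancel hb, Function.iterate_add_apply, ← heq, ← Function.iterate_add_apply]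
    congr 2
    omega
  refine ⟨f^[K] w, le_antisymm ?_ hw₂, ⟨b - a, by omega, ?_⟩, hw₃.iterate hf hx K⟩
  · rw [hqe]
    exact hw₁ _ (by omega)
  · conv_lhs => rw [hqe]
    rw [← Function.iterate_add_apply, Nat.add_sub_cancel' (by omega)]

end Periodic

/-- Points arbitrarily close to `q` visit the germ at `φ s` of the arc `t ↦ φ (s + t)`
arbitrarily close to `φ s` and then return to `q`. -/
def ReturnsViaGerm {G : Type*} [TopologicalSpace G] (f : G → G) (q : G) (φ : ℝ → G) (s : ℝ) :
    Prop :=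
  ∀ W ∈ 𝓝 q, ∀ a > 0, ∃ b ∈ W, ∃ n, ∃ v ∈ Ioo 0 a, s + v < 1 ∧ f^[n] b = φ (s + v) ∧
    ∃ m, f^[m] (φ (s + v)) ∈ W

theorem EdgeSys.exists_germ_nhds {G : Type*} [TopologicalSpace G] [T2Space G] {ι : Type}
    [Finite ι] (E : EdgeSys G ι) (x : G) {a : ℝ} (ha : 0 < a) :
    ∃ U ∈ 𝓝 x, ∀ z ∈ U, z ≠ x → ∃ i, ∃ s ∈ Ico (0:ℝ) 1, E.φ i s = x ∧
      ∃ v ∈ Ioo 0 a, s + v ≤ 1 ∧ z = E.φ i (s + v) := by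
  let T : ι → Set ℝ := fun i => {t ∈ Icc (0:ℝ) 1 | ∀ s ∈ Icc (0:ℝ) 1, E.φ i s = x → a ≤ |t - s|}
  have hT : ∀ i, IsCompact (T i) := by
    intro i
    refine isCompact_Icc.of_isClosed_subset ?_ (sep_subset _ _)
    have : T i = Icc 0 1 ∩ ⋂ s ∈ {s | s ∈ Icc (0:ℝ) 1 ∧ E.φ i s = x}, {t | a ≤ |t - s|} := by
      ext t
      simp [T]
    rw [this]
    refine isClosed_Icc.inter (isClosed_biInter fun s _ => ?_)
    exact isClosed_le continuous_const (by fun_prop)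
  have hcl : IsClosed (⋃ i, E.φ i '' T i) :=
    isClosed_iUnion_of_finite fun i => ((hT i).image (E.isEdge i).continuous).isClosed
  refine ⟨(⋃ i, E.φ i '' T i)ᶜ, hcl.isOpen_compl.mem_nhds ?_, fun z hz hzx => ?_⟩
  · rw [mem_compl_iff, mem_iUnion]
    rintro ⟨i, t, ht, htx⟩
    have := ht.2 t ht.1 htx
    simp only [sub_self, abs_zero] at this
    exact absurd ha (not_lt.2 this)
  · obtain ⟨i, t, ht, rfl⟩ := E.cover z
    have : ¬ ∀ s ∈ Icc (0:ℝ) 1, E.φ i s = x → a ≤ |t - s| := fun hall =>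
      hz (mem_iUnion.2 ⟨i, t, ⟨ht, hall⟩, rfl⟩)
    push Not at this
    obtain ⟨s, hs, hsx, hlt⟩ := this
    have hts : t ≠ s := by
      rintro rfl
      exact hzx hsx
    rw [abs_lt] at hlt
    rcases lt_or_gt_of_ne hts with h | h
    · obtain ⟨j, hj⟩ := E.rev i
      refine ⟨j, 1 - s, ⟨by linarith [hs.2], by linarith [ht.1]⟩, ?_, s - t,
        ⟨by linarith, by linarith⟩, by linarith [ht.1], ?_⟩
      · rw [hj, sub_sub_cancel, hsx]
      · rw [hj]
        congr 1
        ring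
    · exact ⟨i, s, ⟨hs.1, h.trans_le ht.2⟩, hsx, t - s, ⟨by linarith, by linarith⟩,
        by linarith [ht.2], by congr 1; ring⟩

theorem EdgeSys.exists_returnsViaGerm {G : Type*} [TopologicalSpace G] [T2Space G] {ι : Type}
    [Finite ι] (E : EdgeSys G ι) {f : G → G} {q x : G} (hx : f x = x)
    (h : ReturnsVia f q x) (hqx : q ≠ x) :
    ∃ i, ∃ s ∈ Ico (0:ℝ) 1, E.φ i s = x ∧ ReturnsViaGerm f q (E.φ i) s := by
  by_contra hcon
  push Not at hcon
  have hbad : ∀ i, ∃ W ∈ 𝓝 q, ∃ a > 0, ∀ s ∈ Ico (0:ℝ) 1, E.φ i s = x →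
      ¬ ∃ b ∈ W, ∃ n, ∃ v ∈ Ioo 0 a, s + v < 1 ∧ f^[n] b = E.φ i (s + v) ∧
        ∃ m, f^[m] (E.φ i (s + v)) ∈ W := by
    intro i
    by_cases hs : ∃ s ∈ Ico (0:ℝ) 1, E.φ i s = x
    · obtain ⟨s, hs, hsx⟩ := hs
      have := hcon i s hs hsx
      unfold ReturnsViaGerm at this
      push Not at this
      obtain ⟨W, hW, a, ha, hWa⟩ := this
      refine ⟨W, hW, a, ha, fun s' hs' hsx' => ?_⟩
      rw [(E.isEdge i).eq_of_eq (Ico_subset_Icc_self hs') (Ico_subset_Icc_self hs)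
        (hsx'.trans hsx.symm)]
      push Not
      exact hWa
    · push Not at hs
      exact ⟨univ, univ_mem, 1, one_pos, fun s hs' hsx => absurd hsx (hs s hs')⟩
  choose W hW a ha hWa using hbad
  obtain ⟨c, hc, hca⟩ : ∃ c > 0, ∀ i, c ≤ a i ∧ ∀ s ∈ Ico (0:ℝ) 1, E.φ i s = x → c ≤ 1 - s := by
    have : ∀ i, ∃ c > 0, c ≤ a i ∧ ∀ s ∈ Ico (0:ℝ) 1, E.φ i s = x → c ≤ 1 - s := by
      intro i
      by_cases hs : ∃ s ∈ Ico (0:ℝ) 1, E.φ i s = x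
      · obtain ⟨s, hs, hsx⟩ := hs
        refine ⟨min (a i) (1 - s), lt_min (ha i) (by linarith [hs.2]), min_le_left _ _,
          fun s' hs' hsx' => ?_⟩
        rw [(E.isEdge i).eq_of_eq (Ico_subset_Icc_self hs') (Ico_subset_Icc_self hs)
          (hsx'.trans hsx.symm)]
        exact min_le_right _ _
      · push Not at hs
        exact ⟨a i, ha i, le_rfl, fun s hs' hsx => absurd hsx (hs s hs')⟩
    choose c hc hca using this
    obtain ⟨i₀, -, -⟩ := E.cover x
    have : Nonempty ι := ⟨i₀⟩
    obtain ⟨i, hi⟩ := Finite.exists_min c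
    exact ⟨c i, hc i, fun j => ⟨(hi j).trans (hca j).1, fun s hs hsx =>
      (hi j).trans ((hca j).2 s hs hsx)⟩⟩
  obtain ⟨U, hU, hUx⟩ := E.exists_germ_nhds x hc
  obtain ⟨b, hb, n, m, hn, hm⟩ := h ((⋂ i, W i) ∩ {x}ᶜ)
    (inter_mem (iInter_mem.2 hW) (isOpen_ne.mem_nhds hqx)) U hU
  have hne : f^[n] b ≠ x := by
    intro heq
    rw [heq, Function.iterate_fixed hx] at hm
    exact hm.2 rfl
  obtain ⟨i, s, hs, hsx, v, hv, -, hz⟩ := hUx _ hn hne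
  have h1 := (hca i).2 s hs hsx
  exact hWa i s hs hsx ⟨b, mem_iInter.1 hb.1 i, n, v, ⟨hv.1, hv.2.trans_le (hca i).1⟩,
    by linarith [hv.2], hz, m, by rw [← hz]; exact mem_iInter.1 hm.1 i⟩

/-- A continuum `B` covered by images of arbitrarily small pieces of a germ and returning to the
germ produces a horseshoe. -/
theorem hasHorseshoe_of_germ {G : Type*} [MetricSpace G] {f : G → G} (hf : Continuous f) {φ : ℝ → G} (hφ : IsEdge φ) {s : ℝ}
    (hs : s ∈ Ico (0:ℝ) 1) {B : Set G} (hB : IsCompact B) (hBc : IsConnected B) {q : G} (hq : B ∈ 𝓝 q)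
    (hx : f (φ s) = φ s) (hxB : φ s ∉ B) {m : ℕ} (hm : 1 ≤ m) (hper : f^[m] q = q)
    (hgerm : ReturnsViaGerm f q φ s)
    (hcov : ∀ a > 0, ∃ v ∈ Ioo 0 a, s + v ≤ 1 ∧ ∃ n, B ⊆ f^[n] '' (φ '' Icc s (s + v))) :
    HasHorseshoe f := by
  have hqB := mem_of_mem_nhds hq
  -- small pieces of the germ away from `φ s`
  have hcov' : ∀ a > 0, ∃ c v, 0 < c ∧ c ≤ v ∧ v < a ∧ s + v ≤ 1 ∧
      ∃ n, B ⊆ f^[n] '' (φ '' Icc (s + c) (s + v)) := by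
    intro a ha
    obtain ⟨v, hv, hv1, n, hn⟩ := hcov a ha
    have hcont : Continuous fun r => f^[n] (φ (s + r)) :=
      (hf.iterate n).comp (hφ.continuous.comp (by fun_prop))
    have h0 : {r | f^[n] (φ (s + r)) ∉ B} ∈ 𝓝 (0:ℝ) := by
      refine hcont.continuousAt.preimage_mem_nhds (hB.isClosed.isOpen_compl.mem_nhds ?_)
      simp only [add_zero]
      rwa [Function.iterate_fixed hx]
    obtain ⟨c, hc, hcs⟩ := Metric.mem_nhds_iff.1 h0
    have hsub : B ⊆ f^[n] '' (φ '' Icc (s + c) (s + v)) := by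
      intro z hz
      obtain ⟨_, ⟨t, ht, rfl⟩, hzt⟩ := hn hz
      refine ⟨_, ⟨t, ⟨?_, ht.2⟩, rfl⟩, hzt⟩
      by_contra hlt
      have : t - s ∈ Metric.ball (0:ℝ) c := by
        rw [Metric.mem_ball, Real.dist_eq, sub_zero, abs_of_nonneg (by linarith [ht.1])]
        linarith
      have := hcs this
      rw [mem_ofPred_eq, add_sub_cancel, hzt] at this
      exact this hz
    refine ⟨c, v, hc, ?_, hv.2, hv1, n, hsub⟩
    obtain ⟨_, ⟨t, ht, -⟩, -⟩ := hsub hqB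
    linarith [ht.1, ht.2]
  have key : ∀ c₁ v₁ c₂ v₂ n₁ n₂ n, 0 < c₂ → v₂ < c₁ → c₁ ≤ v₁ → s + v₁ ≤ 1 → 1 ≤ n →
      B ⊆ f^[n₁] '' (φ '' Icc (s + c₁) (s + v₁)) → B ⊆ f^[n₂] '' (φ '' Icc (s + c₂) (s + v₂)) →
      φ '' Icc (s + c₁) (s + v₁) ⊆ f^[n] '' B → φ '' Icc (s + c₂) (s + v₂) ⊆ f^[n] '' B →
      HasHorseshoe f := by
    intro c₁ v₁ c₂ v₂ n₁ n₂ n hc₂ hv₂ hcv₁ hv₁ hn h₁ h₂ h₃ h₄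
    refine hasHorseshoe_of_images hf hB hBc.nonempty (isCompact_Icc.image hφ.continuous)
      (isCompact_Icc.image hφ.continuous) ?_ hn h₃ h₄ h₁ h₂
    rw [Set.disjoint_left]
    rintro _ ⟨t, ht, rfl⟩ ⟨u, hu, hut⟩
    have := hφ.eq_of_eq ⟨by linarith [hu.1, hs.1], by linarith [hu.2]⟩
      ⟨by linarith [ht.1, hu.1, hu.2, hs.1], by linarith [ht.2]⟩ hut
    linarith [ht.1, hu.2]
  -- the germ stays away from `B` and from the orbit of `q` near `φ s`
  let O : Set G := (fun k => f^[k] q) '' Iio m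
  have hO : ∀ k, f^[k] q ∈ O := fun k =>
    ⟨k % m, Nat.mod_lt _ hm, (show Function.IsPeriodicPt f m q from hper).iterate_mod_apply k⟩
  have hxO : φ s ∉ O := by
    rintro ⟨k, hk, hkx⟩
    have : f^[m - k] (f^[k] q) = φ s := by
      change f^[k] q = φ s at hkx
      rw [hkx, Function.iterate_fixed hx]
    rw [← Function.iterate_add_apply, Nat.sub_add_cancel hk.le, hper] at this
    exact hxB (this ▸ hqB)
  have hcl : IsClosed (O ∪ B) := ((finite_Iio m).image _).isClosed.union hB.isClosed
  obtain ⟨c₀, hc₀, hc₀1, hc₀s⟩ : ∃ c₀ > 0, s + c₀ ≤ 1 ∧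
      ∀ r, 0 ≤ r → r < c₀ → φ (s + r) ∉ O ∪ B := by
    have hcont : Continuous fun r => φ (s + r) := hφ.continuous.comp (by fun_prop)
    have h0 : (fun r => φ (s + r)) ⁻¹' (O ∪ B)ᶜ ∈ 𝓝 (0:ℝ) :=
      hcont.continuousAt.preimage_mem_nhds (hcl.isOpen_compl.mem_nhds (by
        rw [add_zero]
        rintro (h | h)
        exacts [hxO h, hxB h]))
    obtain ⟨c, hc, hcs⟩ := Metric.mem_nhds_iff.1 h0
    refine ⟨min c (1 - s), lt_min hc (by linarith [hs.2]), ?_, fun r hr hrc => hcs ?_⟩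
    · linarith [min_le_right c (1 - s)]
    · rw [Metric.mem_ball, Real.dist_eq, sub_zero, abs_of_nonneg hr]
      exact hrc.trans_le (min_le_left _ _)
  obtain ⟨c₁, v₁, hc₁, hcv₁, hv₁, hv₁', n₁, h₁⟩ := hcov' c₀ hc₀
  obtain ⟨c₂, v₂, hc₂, hcv₂, hv₂, hv₂', n₂, h₂⟩ := hcov' c₁ hc₁
  obtain ⟨b, hb, n, v, hv, hv1, hnb, -⟩ := hgerm B hq c₂ hc₂
  have hvO : φ (s + v) ∉ O ∪ B := hc₀s v hv.1.le (by linarith [hv.2])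
  have hn : 1 ≤ n := by
    rcases Nat.eq_zero_or_pos n with rfl | h
    · exact absurd (Or.inr (hnb ▸ hb)) hvO
    · exact h
  have hS : IsPreconnected (f^[n] '' B) :=
    hBc.isPreconnected.image _ (hf.iterate n).continuousOn
  rcases hφ.image_Ioc_subset_or_image_Ico_subset (s₁ := s + v) (s₂ := s + v) (α := s)
    (β := s + c₀) hS hs.1 hc₀1
    ⟨_, ⟨b, hb, hnb⟩, _, ⟨le_rfl, le_rfl⟩, rfl⟩ (fun hsub => by
      obtain ⟨t, ht, htq⟩ := hsub ⟨q, hqB, rfl⟩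
      refine hc₀s (t - s) (by linarith [ht.1]) (by linarith [ht.2]) (Or.inl ?_)
      rw [add_sub_cancel, htq]
      exact hO n) with h | h
  · obtain ⟨c₃, v₃, hc₃, hcv₃, hv₃, hv₃', n₃, h₃⟩ := hcov' v hv.1
    obtain ⟨c₄, v₄, hc₄, hcv₄, hv₄, hv₄', n₄, h₄⟩ := hcov' c₃ hc₃
    refine key c₃ v₃ c₄ v₄ n₃ n₄ n hc₄ hv₄ hcv₃ hv₃' hn h₃ h₄
      (subset_trans (image_mono fun t ht => ?_) h) (subset_trans (image_mono fun t ht => ?_) h)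
    · exact ⟨by linarith [ht.1], by linarith [ht.2]⟩
    · exact ⟨by linarith [ht.1], by linarith [ht.2]⟩
  · refine key c₁ v₁ c₂ v₂ n₁ n₂ n hc₂ hv₂ hcv₁ hv₁' hn h₁ h₂
      (subset_trans (image_mono fun t ht => ?_) h) (subset_trans (image_mono fun t ht => ?_) h)
    · exact ⟨by linarith [ht.1, hv.2], by linarith [ht.2]⟩
    · exact ⟨by linarith [ht.1, hv.2], by linarith [ht.2]⟩

section Contradiction

variable {G : Type*} [MetricSpace G] [CompactSpace G] {f : G → G}

/-- A fixed point of a graph map without horseshoes is not part of an IN-pair. -/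
theorem EdgeSys.not_isINPair_of_fixed [LocallyConnectedSpace G] {ι : Type} [Finite ι]
    (E : EdgeSys G ι) (hf : Continuous f) (hH : ¬ HasHorseshoe f) {x y : G} (hx : f x = x)
    (hxy : x ≠ y) : ¬ IsINPair f x y := by
  intro h
  have hr : 0 < dist y x := dist_pos.2 hxy.symm
  have hq : ∀ ρ : Ioo 0 (dist y x), ∃ q, dist q x = ρ ∧ (∃ m ≥ 1, f^[m] q = q) ∧
      ∃ i, ∃ s ∈ Ico (0:ℝ) 1, E.φ i s = x ∧ ReturnsViaGerm f q (E.φ i) s := by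
    intro ρ
    obtain ⟨q, hqρ, hper, hret⟩ := E.exists_periodic_returnsVia hf hH hx h ρ.2.1 ρ.2.2
    refine ⟨q, hqρ, hper, E.exists_returnsViaGerm hx hret ?_⟩
    rintro rfl
    rw [dist_self] at hqρ
    exact absurd ρ.2.1 (by rw [← hqρ]; exact lt_irrefl _)
  choose q hqρ hper g hg using hq
  have : Infinite (Ioo 0 (dist y x)) := (Ioo_infinite hr).to_subtype
  obtain ⟨i, hi⟩ := Finite.exists_infinite_fiber g
  have hqinj : Function.Injective q := fun a b hab => Subtype.ext (by rw [← hqρ, ← hqρ, hab])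
  have hQinf : (q '' (g ⁻¹' {i})).Infinite := (Set.infinite_coe_iff.1 hi).image hqinj.injOn
  have hQ : ∀ p ∈ q '' (g ⁻¹' {i}), (∃ m ≥ 1, f^[m] p = p) ∧
      ∃ s ∈ Ico (0:ℝ) 1, E.φ i s = x ∧ ReturnsViaGerm f p (E.φ i) s := by
    rintro _ ⟨ρ, rfl, rfl⟩
    exact ⟨hper ρ, hg ρ⟩
  obtain ⟨M, hM⟩ := E.exists_arc 7 (finite_singleton x)
  obtain ⟨Q, hQs, hQc⟩ := hQinf.exists_subset_card_eq M
  obtain ⟨j, t, htlt, htQ, htx⟩ := hM Q hQc.ge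
  have hψ := E.isEdge j
  have hφ := E.isEdge i
  set ψ := E.φ j
  set φ := E.φ i
  obtain ⟨-, s, hs, hsx, -⟩ := hQ _ (hQs (htQ 0 (by omega)).2)
  have hret : ∀ k < 7, (∃ m ≥ 1, f^[m] (ψ (t k)) = ψ (t k)) ∧
      ReturnsViaGerm f (ψ (t k)) φ s := by
    intro k hk
    obtain ⟨hp, s', hs', hsx', hr⟩ := hQ _ (hQs (htQ k hk).2)
    rw [hφ.eq_of_eq (Ico_subset_Icc_self hs') (Ico_subset_Icc_self hs) (hsx'.trans hsx.symm)]
      at hr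
    exact ⟨hp, hr⟩
  have h01 := htlt 0 1 (by omega) (by omega)
  have h12 := htlt 1 2 (by omega) (by omega)
  have h23 := htlt 2 3 (by omega) (by omega)
  have h34 := htlt 3 4 (by omega) (by omega)
  have h45 := htlt 4 5 (by omega) (by omega)
  have h56 := htlt 5 6 (by omega) (by omega)
  have h0 := (htQ 0 (by omega)).1.1
  have h6 := (htQ 6 (by omega)).1.2
  have hxψ : x ∉ ψ '' Icc (t 0) (t 6) := by
    rintro ⟨u, hu, hux⟩
    exact htx 0 (by omega) 6 (by omega) u hu hux
  have hwin : ∀ {u v k}, k < 7 → t 0 ≤ u → v ≤ t 6 → u < t k → t k < v →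
      ¬ ∀ a > 0, ∃ w ∈ Ioo 0 a, s + w ≤ 1 ∧ ∃ n, ψ '' Icc u v ⊆ f^[n] '' (φ '' Icc s (s + w)) := by
    intro u v k hk hu hv huk hkv hcov
    obtain ⟨⟨m, hm, hmp⟩, hr⟩ := hret k hk
    refine hH (hasHorseshoe_of_germ hf hφ hs (isCompact_Icc.image hψ.continuous)
      ((isConnected_Icc (huk.trans hkv).le).image _ hψ.continuous.continuousOn)
      (q := ψ (t k)) ?_ (by rw [hsx, hx]) ?_ hm hmp hr hcov)
    · exact mem_of_superset (hψ.image_Ioo_mem_nhds (by linarith) (by linarith) ⟨huk, hkv⟩)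
        (image_mono Ioo_subset_Icc_self)
    · rw [hsx]
      exact fun hmem => hxψ (image_mono (Icc_subset_Icc hu hv) hmem)
  have hL := hwin (u := (t 0 + t 1) / 2) (v := t 2) (k := 1) (by omega) (by linarith)
    (by linarith) (by linarith) (by linarith)
  have hR := hwin (u := t 4) (v := (t 5 + t 6) / 2) (k := 5) (by omega) (by linarith)
    (by linarith) (by linarith) (by linarith)
  push Not at hL hR
  obtain ⟨a₁, ha₁, hL⟩ := hL
  obtain ⟨a₂, ha₂, hR⟩ := hR
  obtain ⟨-, -, -, v, hv, hv1, -, n, hn⟩ := (hret 3 (by omega)).2 _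
    (hψ.image_Ioo_mem_nhds (a := t 2) (b := t 4) (by linarith) (by linarith) ⟨h23, h34⟩) _
    (lt_min ha₁ ha₂)
  have hS : IsPreconnected (f^[n] '' (φ '' Icc s (s + v))) :=
    (isPreconnected_Icc.image _ hφ.continuous.continuousOn).image _ (hf.iterate n).continuousOn
  rcases hψ.image_Ioc_subset_or_image_Ico_subset (s₁ := t 2) (s₂ := t 4) hS h0.le h6.le
    ⟨_, ⟨_, ⟨s + v, ⟨by linarith [hv.1], le_rfl⟩, rfl⟩, rfl⟩,
      image_mono Ioo_subset_Icc_self hn⟩ (fun hsub => hxψ (image_mono Ioo_subset_Icc_self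
        (hsub ⟨x, ⟨s, ⟨le_rfl, by linarith [hv.1]⟩, hsx⟩, Function.iterate_fixed hx n⟩)))
    with h | h
  · exact hL v ⟨hv.1, hv.2.trans_le (min_le_left _ _)⟩ hv1.le n
      ((image_mono fun r (hr : r ∈ Icc _ _) => show r ∈ Ioc _ _ from
        ⟨by linarith [hr.1], hr.2⟩).trans h)
  · exact hR v ⟨hv.1, hv.2.trans_le (min_le_right _ _)⟩ hv1.le n
      ((image_mono fun r (hr : r ∈ Icc _ _) => show r ∈ Ico _ _ from
        ⟨hr.1, by linarith [hr.2]⟩).trans h)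

/-- A periodic point of a graph map without horseshoes is not part of an IN-pair. -/
theorem EdgeSys.not_isINPair_of_periodic [LocallyConnectedSpace G] {ι : Type} [Finite ι]
    (E : EdgeSys G ι) (hf : Continuous f) (hH : ¬ HasHorseshoe f) {x : G} {m : ℕ}
    (hm : 1 ≤ m) (hx : f^[m] x = x) {y : G} (hxy : x ≠ y) : ¬ IsINPair f x y := fun h =>
  E.not_isINPair_of_fixed (hf.iterate m) (fun h' => hH (h'.of_iterate hm)) hx hxy (h.iterate hm)

end Contradiction

section Subgraph

theorem isTopGraph_of_finite {X : Type*} [TopologicalSpace X] [CompactSpace X] [ConnectedSpace X]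
    {κ : Type*} [Finite κ] (A : κ → Set X) (a b : κ → X) (harc : ∀ i, IsArcWithEnds (A i) (a i) (b i))
    (hcov : ⋃ i, A i = univ) (hinter : ∀ i j, i ≠ j → A i ∩ A j = ∅ ∨
      ∃ p, A i ∩ A j = {p} ∧ p ∈ ({a i, b i} : Set X) ∧ p ∈ ({a j, b j} : Set X)) :
    IsTopGraph X := by
  obtain ⟨n, ⟨e⟩⟩ := Finite.exists_equiv_fin κ
  refine ⟨inferInstance, inferInstance, n, A ∘ e.symm, a ∘ e.symm, b ∘ e.symm, fun i => harc _,
    ?_, fun i j hij => hinter _ _ (e.symm.injective.ne hij)⟩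
  rw [← hcov]
  exact e.symm.surjective.iUnion_comp A

namespace ArcSys

variable {G : Type*} [TopologicalSpace G] {n : ℕ}

/-- The parameters of the `i`-th arc at which it lies in `K`. -/
def params (E : ArcSys G n) (K : Set G) (i : Fin n) : Set ℝ := Icc 0 1 ∩ E.φ i ⁻¹' K

/-- Maximal nondegenerate parameter intervals of the arcs inside `K`. -/
structure IsPiece (E : ArcSys G n) (K : Set G) (p : Fin n × ℝ × ℝ) : Prop where
  lt : p.2.1 < p.2.2
  subset : Icc p.2.1 p.2.2 ⊆ E.params K p.1
  maximal : ∀ S, IsPreconnected S → S ⊆ E.params K p.1 → (S ∩ Icc p.2.1 p.2.2).Nonempty →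
    S ⊆ Icc p.2.1 p.2.2

variable {E : ArcSys G n} {K : Set G} {p q : Fin n × ℝ × ℝ}

theorem IsPiece.left_mem (h : E.IsPiece K p) : p.2.1 ∈ E.params K p.1 :=
  h.subset (left_mem_Icc.2 h.lt.le)

theorem IsPiece.right_mem (h : E.IsPiece K p) : p.2.2 ∈ E.params K p.1 :=
  h.subset (right_mem_Icc.2 h.lt.le)

theorem exists_isPiece (hK : IsClosed K) {i : Fin n} {c d t : ℝ} (hcd : c < d)
    (h : Icc c d ⊆ E.params K i) (ht : t ∈ Icc c d) :
    ∃ p, E.IsPiece K p ∧ p.1 = i ∧ t ∈ Icc p.2.1 p.2.2 := by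
  have hT : IsCompact (E.params K i) :=
    isCompact_Icc.inter_right (hK.preimage (E.continuous i))
  have hcl : IsClosed (connectedComponentIn (E.params K i) c) := by
    refine isClosed_of_closure_subset ?_
    refine isPreconnected_connectedComponentIn.closure.subset_connectedComponentIn
      (subset_closure (mem_connectedComponentIn (h (left_mem_Icc.2 hcd.le)))) ?_
    exact closure_minimal (connectedComponentIn_subset _ _) hT.isClosed
  have hcpt := hT.of_isClosed_subset hcl (connectedComponentIn_subset _ _)
  have hconn : IsConnected (connectedComponentIn (E.params K i) c) :=
    isConnected_connectedComponentIn_iff.2 (h (left_mem_Icc.2 hcd.le))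
  have heq := eq_Icc_of_connected_compact hconn hcpt
  set a := sInf (connectedComponentIn (E.params K i) c)
  set b := sSup (connectedComponentIn (E.params K i) c)
  have hsub : Icc c d ⊆ Icc a b := by
    rw [← heq]
    exact isPreconnected_Icc.subset_connectedComponentIn (left_mem_Icc.2 hcd.le) h
  have hac := hsub (left_mem_Icc.2 hcd.le)
  have hdb := hsub (right_mem_Icc.2 hcd.le)
  refine ⟨(i, a, b), ⟨hac.1.trans_lt (hcd.trans_le hdb.2), ?_, ?_⟩, rfl, hsub ht⟩
  · rw [← heq]
    exact connectedComponentIn_subset _ _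
  · rintro S hS hST ⟨z, hzS, hz⟩
    rw [← heq] at hz ⊢
    rw [connectedComponentIn_eq hz]
    exact hS.subset_connectedComponentIn hzS hST

theorem IsPiece.eq_of_inter_nonempty (hp : E.IsPiece K p) (hq : E.IsPiece K q) (h : p.1 = q.1)
    (hne : (Icc p.2.1 p.2.2 ∩ Icc q.2.1 q.2.2).Nonempty) : p = q := by
  obtain ⟨i, a, b⟩ := p
  obtain ⟨j, c, d⟩ := q
  obtain rfl : i = j := h
  have h1 := hp.maximal _ isPreconnected_Icc hq.subset (by rwa [inter_comm] at hne)
  have h2 := hq.maximal _ isPreconnected_Icc hp.subset hne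
  have h3 := (Icc_subset_Icc_iff hq.lt.le).1 h1
  have h4 := (Icc_subset_Icc_iff hp.lt.le).1 h2
  simp only at h3 h4
  rw [le_antisymm h3.1 h4.1, le_antisymm h3.2 h4.2]

/-- Left of a piece not starting at `0` there is a gap. -/
theorem IsPiece.exists_gap (hp : E.IsPiece K p) {r : ℝ} (hr : 0 ≤ r) (hrp : r < p.2.1) :
    ∃ s ∈ Ico r p.2.1, E.φ p.1 s ∉ K := by
  by_contra! hcon
  have : Icc r p.2.1 ⊆ E.params K p.1 := fun s hs =>
    ⟨⟨hr.trans hs.1, hs.2.trans hp.left_mem.1.2⟩, by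
      rcases hs.2.lt_or_eq with h | h
      · exact hcon s ⟨hs.1, h⟩
      · rw [h]
        exact hp.left_mem.2⟩
  have := hp.maximal _ isPreconnected_Icc this
    ⟨_, right_mem_Icc.2 hrp.le, left_mem_Icc.2 hp.lt.le⟩ (left_mem_Icc.2 hrp.le)
  exact absurd this.1 (not_le.2 hrp)

theorem finite_isPiece [T2Space G] (hK : IsPreconnected K) : {p | E.IsPiece K p}.Finite := by
  have hlt : ∀ p q, E.IsPiece K p → E.IsPiece K q → p.1 = q.1 → (p.2.1 = 0 ↔ q.2.1 = 0) →
      ¬ p.2.2 < q.2.1 := by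
    rintro ⟨i, a, b⟩ ⟨j, c, d⟩ hp hq hij h0 hbc
    obtain rfl : i = j := hij
    simp only at h0 hbc
    have ha := hp.left_mem.1.1
    have hb := hp.right_mem.1.1
    have hab := hp.lt
    simp only at ha hb hab
    have ha0 : 0 < a := ha.lt_of_ne fun h => by
      have := h0.1 h.symm
      linarith
    obtain ⟨r, hr, hrK⟩ := hp.exists_gap le_rfl ha0
    obtain ⟨s, hs, hsK⟩ := hq.exists_gap hb hbc
    simp only at hr hs hrK hsK
    have hc1 := hq.left_mem.1.2
    obtain ⟨u, hu, hue⟩ := (E.isEdge i).subset_image_Ioo_of_notMem hK hr.1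
      (hs.2.le.trans hc1) ⟨_, hp.left_mem.2, a, ⟨hr.2, hab.trans_le hs.1⟩, rfl⟩ hrK hsK
      hq.left_mem.2
    have := (E.isEdge i).eq_of_eq ⟨hr.1.trans hu.1.le, hu.2.le.trans (hs.2.le.trans hc1)⟩
      hq.left_mem.1 hue
    simp only at this
    linarith [hu.2, hs.2]
  refine Set.Finite.of_finite_image (f := fun p : Fin n × ℝ × ℝ => (p.1, decide (p.2.1 = 0)))
    (toFinite _) ?_
  intro p hp q hq hpq
  simp only [Prod.mk.injEq, decide_eq_decide] at hpq
  refine hp.eq_of_inter_nonempty hq hpq.1 ?_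
  have h1 := not_lt.1 (hlt p q hp hq hpq.1 hpq.2)
  have h2 := not_lt.1 (hlt q p hq hp hpq.1.symm hpq.2.symm)
  exact ⟨max p.2.1 q.2.1, ⟨le_max_left _ _, max_le hp.lt.le h1⟩,
    le_max_right _ _, max_le h2 hq.lt.le⟩

theorem exists_isPiece_of_mem_Ioo [T2Space G] (hKcl : IsClosed K) (hK : IsPreconnected K)
    (hnt : K.Nontrivial) {i : Fin n} {t : ℝ} (ht : t ∈ Ioo (0:ℝ) 1) (htK : E.φ i t ∈ K) :
    ∃ p, E.IsPiece K p ∧ p.1 = i ∧ t ∈ Icc p.2.1 p.2.2 := by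
  obtain ⟨w, hw, hwt⟩ := hnt.exists_ne (E.φ i t)
  have hnh : Ioo (0:ℝ) 1 ∩ E.φ i ⁻¹' {w}ᶜ ∈ 𝓝 t :=
    inter_mem (Ioo_mem_nhds ht.1 ht.2)
      ((E.continuous i).continuousAt.preimage_mem_nhds (isOpen_ne.mem_nhds hwt.symm))
  obtain ⟨a, b, hab, habs⟩ := mem_nhds_iff_exists_Ioo_subset.1 hnh
  obtain ⟨c, hac, hct⟩ := exists_between hab.1
  obtain ⟨d, htd, hdb⟩ := exists_between hab.2
  have hI : Icc c d ⊆ Ioo (0:ℝ) 1 ∩ E.φ i ⁻¹' {w}ᶜ :=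
    fun s hs => habs ⟨hac.trans_le hs.1, hs.2.trans_lt hdb⟩
  by_cases hL : Icc c t ⊆ E.φ i ⁻¹' K
  · exact exists_isPiece hKcl hct
      (fun s hs => ⟨Ioo_subset_Icc_self (hI ⟨hs.1, hs.2.trans htd.le⟩).1, hL hs⟩)
      (right_mem_Icc.2 hct.le)
  by_cases hR : Icc t d ⊆ E.φ i ⁻¹' K
  · exact exists_isPiece hKcl htd
      (fun s hs => ⟨Ioo_subset_Icc_self (hI ⟨hct.le.trans hs.1, hs.2⟩).1, hR hs⟩)
      (left_mem_Icc.2 htd.le)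
  rw [not_subset] at hL hR
  obtain ⟨r, hr, hrK⟩ := hL
  obtain ⟨s, hs, hsK⟩ := hR
  have hrI := hI ⟨hr.1, hr.2.trans htd.le⟩
  have hsI := hI ⟨hct.le.trans hs.1, hs.2⟩
  have hrt : r < t := hr.2.lt_of_ne fun h => hrK (h ▸ htK)
  have hts : t < s := hs.1.lt_of_ne fun h => hsK (h ▸ htK)
  obtain ⟨u, hu, huw⟩ := (E.isEdge i).subset_image_Ioo_of_notMem hK hrI.1.1.le hsI.1.2.le
    ⟨_, htK, t, ⟨hrt, hts⟩, rfl⟩ hrK hsK hw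
  exact absurd huw (hI ⟨hr.1.trans hu.1.le, hu.2.le.trans hs.2⟩).2

theorem exists_isPiece_of_mem [T2Space G] (E : ArcSys G n) (hKcl : IsClosed K)
    (hK : IsPreconnected K) (hnt : K.Nontrivial) {z : G} (hz : z ∈ K) :
    ∃ p, E.IsPiece K p ∧ z ∈ E.φ p.1 '' Icc p.2.1 p.2.2 := by
  let V : Set G := ⋃ i, E.φ i '' {0, 1}
  have hV : V.Finite := finite_iUnion fun i => (toFinite _).image _
  have hcl : IsClosed (⋃ p ∈ {p | E.IsPiece K p}, E.φ p.1 '' Icc p.2.1 p.2.2) :=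
    (finite_isPiece hK).isClosed_biUnion fun p _ =>
      (isCompact_Icc.image (E.continuous p.1)).isClosed
  have hsub : K \ V ⊆ ⋃ p ∈ {p | E.IsPiece K p}, E.φ p.1 '' Icc p.2.1 p.2.2 := by
    rintro y ⟨hy, hyV⟩
    obtain ⟨i, t, ht, rfl⟩ := E.cover y
    have ht0 : t ≠ 0 := fun h => hyV (mem_iUnion.2 ⟨i, t, Or.inl h, rfl⟩)
    have ht1 : t ≠ 1 := fun h => hyV (mem_iUnion.2 ⟨i, t, Or.inr h, rfl⟩)
    obtain ⟨p, hp, rfl, htp⟩ := exists_isPiece_of_mem_Ioo (E := E) hKcl hK hnt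
      ⟨ht.1.lt_of_ne ht0.symm, ht.2.lt_of_ne ht1⟩ hy
    exact mem_biUnion hp ⟨t, htp, rfl⟩
  have hzcl : z ∈ closure (K \ V) := by
    rw [mem_closure_iff_frequently]
    have hacc := accPt_iff_frequently.1 (hK.preperfect_of_nontrivial hnt z hz)
    have hev : ∀ᶠ y in 𝓝 z, y ∉ V \ {z} :=
      (hV.subset sdiff_subset).isClosed.isOpen_compl.mem_nhds fun h => h.2 rfl
    exact (hacc.and_eventually hev).mono fun y hy =>
      ⟨hy.1.2, fun hyV => hy.2 ⟨hyV, hy.1.1⟩⟩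
  obtain ⟨p, hp, hzp⟩ := mem_iUnion₂.1 (closure_minimal hsub hcl hzcl)
  exact ⟨p, hp, hzp⟩

theorem IsPiece.isArcWithEnds (hp : E.IsPiece K p) :
    IsArcWithEnds ((↑) ⁻¹' (E.φ p.1 '' Icc p.2.1 p.2.2) : Set K)
      ⟨E.φ p.1 p.2.1, hp.left_mem.2⟩ ⟨E.φ p.1 p.2.2, hp.right_mem.2⟩ := by
  have hpos := sub_pos.2 hp.lt
  have hmem : ∀ u : Icc (0:ℝ) 1, p.2.1 + u * (p.2.2 - p.2.1) ∈ Icc p.2.1 p.2.2 := fun u =>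
    ⟨by nlinarith [u.2.1], by nlinarith [u.2.2]⟩
  refine ⟨fun u => ⟨E.φ p.1 (p.2.1 + u * (p.2.2 - p.2.1)), (hp.subset (hmem u)).2⟩, ?_, ?_, ?_,
    ?_, ?_⟩
  · exact ((E.continuous p.1).comp (by fun_prop)).subtype_mk _
  · intro u v huv
    have := E.injOn p.1 (hp.subset (hmem u)).1 (hp.subset (hmem v)).1 (Subtype.ext_iff.1 huv)
    exact Subtype.ext (mul_right_cancel₀ hpos.ne' (add_left_cancel this))
  · ext ⟨z, hz⟩
    constructor
    · rintro ⟨u, hu⟩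
      exact ⟨_, hmem u, Subtype.ext_iff.1 hu⟩
    · rintro ⟨t, ht, htz⟩
      refine ⟨⟨(t - p.2.1) / (p.2.2 - p.2.1), div_nonneg (sub_nonneg.2 ht.1) hpos.le,
        (div_le_one hpos).2 (sub_le_sub_right ht.2 _)⟩, Subtype.ext ?_⟩
      simp only [div_mul_cancel₀ _ hpos.ne', add_sub_cancel]
      exact htz
  · simp
  · simp

theorem IsPiece.eq_of_eq_zero_or_one (hp : E.IsPiece K p) {s : ℝ} (hs : s ∈ Icc p.2.1 p.2.2)
    (h : s = 0 ∨ s = 1) : s = p.2.1 ∨ s = p.2.2 := by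
  rcases h with rfl | rfl
  · exact Or.inl (le_antisymm hp.left_mem.1.1 hs.1)
  · exact Or.inr (le_antisymm hs.2 hp.right_mem.1.2)

/-- Nondegenerate subcontinua of graphs are graphs. -/
theorem isTopGraph_subtype [T2Space G] [CompactSpace G] (E : ArcSys G n) (hKcl : IsClosed K)
    (hK : IsConnected K) (hnt : K.Nontrivial) : IsTopGraph K := by
  have : CompactSpace K := isCompact_iff_compactSpace.1 hKcl.isCompact
  have : ConnectedSpace K := isConnected_iff_connectedSpace.1 hK
  have : Finite {p | E.IsPiece K p} := (finite_isPiece hK.isPreconnected).to_subtype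
  refine isTopGraph_of_finite (κ := {p | E.IsPiece K p})
    (fun p => (↑) ⁻¹' (E.φ p.1.1 '' Icc p.1.2.1 p.1.2.2))
    (fun p => ⟨E.φ p.1.1 p.1.2.1, p.2.left_mem.2⟩)
    (fun p => ⟨E.φ p.1.1 p.1.2.2, p.2.right_mem.2⟩) (fun p => p.2.isArcWithEnds) ?_ ?_
  · refine eq_univ_of_forall fun z => ?_
    obtain ⟨p, hp, hz⟩ := E.exists_isPiece_of_mem hKcl hK.isPreconnected hnt z.2
    exact mem_iUnion.2 ⟨⟨p, hp⟩, hz⟩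
  · rintro ⟨p, hp⟩ ⟨q, hq⟩ hpq
    rw [or_iff_not_imp_left]
    intro hne
    obtain ⟨⟨z, hzK⟩, ⟨s, hs, hsz⟩, ⟨t, ht, htz⟩⟩ := nonempty_iff_ne_empty.2 hne
    simp only at hs hsz ht htz
    have hsI := (hp.subset hs).1
    have htI := (hq.subset ht).1
    have hij : p.1 ≠ q.1 := by
      intro hij
      rw [hij] at hsz
      have := E.injOn q.1 hsI htI (hsz.trans htz.symm)
      exact hpq (Subtype.ext (hp.eq_of_inter_nonempty hq hij ⟨s, hs, this ▸ ht⟩))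
    refine ⟨⟨z, hzK⟩, Subset.antisymm ?_ ?_, ?_, ?_⟩
    · rintro ⟨z', hz'K⟩ ⟨⟨s', hs', hsz'⟩, ⟨t', ht', htz'⟩⟩
      simp only at hs' hsz' ht' htz'
      refine Subtype.ext ?_
      change z' = z
      rw [← hsz', ← hsz]
      exact E.unique p.1 q.1 hij _ (hp.subset hs').1 _ (hq.subset ht').1 _ hsI _ htI
        (hsz'.trans htz'.symm) (hsz.trans htz.symm)
    · rintro _ rfl
      exact ⟨⟨s, hs, hsz⟩, ⟨t, ht, htz⟩⟩
    · rcases hp.eq_of_eq_zero_or_one hs (E.endpoint _ _ hij s hsI t htI (hsz.trans htz.symm))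
        with rfl | rfl
      · exact Or.inl (Subtype.ext hsz.symm)
      · exact Or.inr (Subtype.ext hsz.symm)
    · rcases hq.eq_of_eq_zero_or_one ht
        (E.endpoint _ _ hij.symm t htI s hsI (htz.trans hsz.symm)) with rfl | rfl
      · exact Or.inl (Subtype.ext htz.symm)
      · exact Or.inr (Subtype.ext htz.symm)

end ArcSys

end Subgraph

/-- The set `K` is a continuum of period `k`. -/
structure IsPeriodicContinuum {G : Type*} [TopologicalSpace G] (f : G → G) (K : Set G) (k : ℕ) :
    Prop where
  pos : 1 ≤ k
  isClosed : IsClosed K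
  isConnected : IsConnected K
  image_eq : f^[k] '' K = K
  disjoint : ∀ i j, i < k → j < k → i ≠ j → Disjoint (f^[i] '' K) (f^[j] '' K)

theorem IsPeriodicContinuum.iterate_mem {G : Type*} [TopologicalSpace G] {f : G → G} {K : Set G}
    {k : ℕ} (h : IsPeriodicContinuum f K k) {x : G} (hx : x ∈ K) (i j : ℕ) :
    f^[i + k * j] x ∈ f^[i] '' K := by
  rw [Function.iterate_add_apply, Function.iterate_mul]
  exact mem_image_of_mem _
    ((show MapsTo f^[k] K K from fun z hz => h.image_eq ▸ mem_image_of_mem _ hz).iterate j hx)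

section Solenoid

variable {G : Type*} [MetricSpace G] {f : G → G} {x y : G}

theorem EdgeSys.asymptotic_of_periodicContinuum {ι : Type} [Finite ι] (E : EdgeSys G ι)
    (hf : Continuous f)
    (h : ∀ N, ∃ K k, N ≤ k ∧ IsPeriodicContinuum f K k ∧ x ∈ K ∧ y ∈ K) : Asymptotic f x y := by
  rw [Asymptotic, Metric.tendsto_atTop]
  by_contra! hcon
  obtain ⟨ε, hε, hbad⟩ := hcon
  obtain ⟨D, hD, hDS⟩ := E.exists_finite_cut hε
  have hinf : {n | ε ≤ dist (f^[n] x) (f^[n] y)}.Infinite := by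
    refine Set.infinite_of_forall_exists_gt fun N => ?_
    obtain ⟨n, hn, hdn⟩ := hbad (N + 1)
    rw [Real.dist_0_eq_abs, abs_of_nonneg dist_nonneg] at hdn
    exact ⟨n, hdn, hn⟩
  obtain ⟨I, hI, hIc⟩ := hinf.exists_subset_card_eq (hD.toFinset.card + 1)
  obtain ⟨K, k, hk, hK, hxK, hyK⟩ := h (I.sup id + 1)
  have hIk : ∀ i ∈ I, i < k := fun i hi => by
    have := Finset.le_sup (f := id) hi
    simp only [id] at this
    omega
  have : Nonempty G := ⟨x⟩
  have hmeet : ∀ i ∈ I, ∃ z ∈ hD.toFinset, z ∈ f^[i] '' K := by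
    intro i hi
    by_contra! hno
    refine absurd (hDS (f^[i] '' K) (hK.isConnected.isPreconnected.image _
      (hf.iterate i).continuousOn) ?_ _ ⟨x, hxK, rfl⟩ _ ⟨y, hyK, rfl⟩) (not_lt.2 (hI hi))
    exact Set.disjoint_left.2 fun z hz hzD => hno z (hD.mem_toFinset.2 hzD) hz
  choose! g hgD hg using hmeet
  obtain ⟨i, hi, j, hj, hij, heq⟩ := Finset.exists_ne_map_eq_of_card_lt_of_maps_to
    (s := I) (t := hD.toFinset) (by omega) (f := g) hgD
  exact Set.disjoint_left.1 (hK.disjoint i j (hIk i hi) (hIk j hj) hij) (hg i hi)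
    (heq ▸ hg j hj)

variable [CompactSpace G]

theorem IsPeriodicContinuum.omegaSet_subset (hf : Continuous f) {K : Set G} {k : ℕ}
    (h : IsPeriodicContinuum f K k) (hx : x ∈ K) :
    omegaSet f x ⊆ ⋃ i ∈ Finset.range k, f^[i] '' K := by
  have hcl : IsClosed (⋃ i ∈ Finset.range k, f^[i] '' K) :=
    (Finset.finite_toSet (Finset.range k)).isClosed_biUnion fun i _ =>
      (h.isClosed.isCompact.image (hf.iterate i)).isClosed
  refine (iInter_subset _ 0).trans (closure_minimal ?_ hcl)
  rintro _ ⟨m, -, rfl⟩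
  refine mem_biUnion (x := m % k) (Finset.mem_coe.2 (Finset.mem_range.2 (Nat.mod_lt _ h.pos))) ?_
  have := h.iterate_mem hx (m % k) (m / k)
  rwa [Nat.mod_add_div] at this

theorem IsPeriodicContinuum.omegaSet_inter_nonempty (hf : Continuous f) {K : Set G} {k : ℕ}
    (h : IsPeriodicContinuum f K k) (hx : x ∈ K) (i : ℕ) :
    (omegaSet f x ∩ f^[i] '' K).Nonempty := by
  have hc : IsCompact (f^[i] '' K) := h.isClosed.isCompact.image (hf.iterate i)
  obtain ⟨z, hz, g, hg, hgz⟩ := hc.tendsto_subseq fun j => h.iterate_mem hx i j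
  refine ⟨z, mem_iInter.2 fun n => ?_, hz⟩
  refine mem_closure_of_tendsto hgz ((eventually_ge_atTop n).mono fun j hj => ?_)
  refine ⟨i + k * g j, ?_, rfl⟩
  have h1 := hg.id_le j
  have h2 := Nat.le_mul_of_pos_left (g j) h.pos
  simp only [id] at h1
  exact mem_Ici.2 (by omega)

theorem ArcSys.isSolenoid_of_periodicContinuum {n : ℕ} (E : ArcSys G n) (hf : Continuous f)
    (hxy : x ≠ y) (h : ∀ N, ∃ K k, N ≤ k ∧ IsPeriodicContinuum f K k ∧ x ∈ K ∧ y ∈ K) :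
    IsSolenoid f (omegaSet f x) := by
  refine ⟨fun hfin => ?_, fun N => ?_⟩
  · obtain ⟨K, k, hk, hK, hx, -⟩ := h (hfin.toFinset.card + 1)
    choose g hg using fun i => hK.omegaSet_inter_nonempty hf hx i
    obtain ⟨i, hi, j, hj, hij, heq⟩ := Finset.exists_ne_map_eq_of_card_lt_of_maps_to
      (s := Finset.range k) (t := hfin.toFinset) (by rw [Finset.card_range]; omega) (f := g)
      (fun i _ => hfin.mem_toFinset.2 (hg i).1)
    exact Set.disjoint_left.1 (hK.disjoint i j (Finset.mem_range.1 hi) (Finset.mem_range.1 hj) hij)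
      (hg i).2 (heq ▸ (hg j).2)
  · obtain ⟨K, k, hk, hK, hx, hy⟩ := h N
    exact ⟨_, k, hk, ⟨K, ⟨⟨hK.isClosed, hK.isConnected,
      E.isTopGraph_subtype hK.isClosed hK.isConnected ⟨x, hx, y, hy, hxy⟩⟩, hK.pos, hK.image_eq,
      hK.disjoint⟩, rfl⟩, hK.omegaSet_subset hf hx⟩

end Solenoid

/-- For a graph map with zero topological entropy, every non-diagonal IN-pair is
asymptotic and `ω_f(x)` is a solenoid. -/
theorem inPair_asymptotic_and_solenoid {G : Type*} [MetricSpace G]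
    (hG : IsTopGraph G) (f : G → G) (hf : Continuous f)
    (hent : Dynamics.coverEntropy f Set.univ = 0)
    (x y : G) (hxy : x ≠ y) (hIN : IsINPair f x y) :
    Asymptotic f x y ∧ IsSolenoid f (omegaSet f x) := by
  have : CompactSpace G := hG.1
  obtain ⟨n, ⟨A⟩⟩ := hG.exists_arcSys
  have : LocallyConnectedSpace G := A.locallyConnectedSpace
  have hH : ¬ HasHorseshoe f := fun h => h.coverEntropy_pos.ne' hent
  obtain ⟨X, Y, rfl, rfl, hX, hY, hXY⟩ := hIN.exists_backward_orbits hf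
  have hinj : Function.Injective Y := injective_backward hY fun m hm hper =>
    A.toEdgeSys.not_isINPair_of_periodic hf hH hm hper hxy.symm hIN.symm
  have h : ∀ N, ∃ K k, N ≤ k ∧ IsPeriodicContinuum f K k ∧ X 0 ∈ K ∧ Y 0 ∈ K := by
    intro N
    obtain ⟨K, k, hN, hk, hcl, hconn, himg, hdisj, hx, hy⟩ :=
      A.toEdgeSys.exists_periodic_continuum hf hH hX hY hxy hXY hinj N
    exact ⟨K, k, hN, ⟨hk, hcl, hconn, himg, hdisj⟩, hx, hy⟩
  exact ⟨A.toEdgeSys.asymptotic_of_periodicContinuum hf h,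
    A.isSolenoid_of_periodicContinuum hf hxy h⟩
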